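/- Let n, m, k be natural numbers with k > 0 and 2m > 3(n+1), and let X be a compact metric space of covering dimension at most n. Let T_k denote the join of k copies of the three-point discrete space {1,2,3}. Then X admits a topological embedding into ℝ^m if and only if the join X * T_k admits a topological embedding into ℝ^{m+2k}. -/

import Mathlib

open Topology Metric unitInterval

/-- Covering dimension at most `n`: every open cover admits an open refinement in which
each point lies in at most `n+1` members. -/
def CoveringDimLE (X : Type*) [TopologicalSpace X] (n : ℕ) : Prop :=
  ∀ U : Set (Set X), (∀ u ∈ U, IsOpen u) → ⋃₀ U = Set.univ →
    ∃ V : Set (Set X), (∀ v ∈ V, IsOpen v) ∧ ⋃₀ V = Set.univ ∧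
      (∀ v ∈ V, ∃ u ∈ U, v ⊆ u) ∧
      ∀ x : X, {v ∈ V | x ∈ v}.Finite ∧ {v ∈ V | x ∈ v}.ncard ≤ n + 1

lemma uiZeroNeOne : (0 : unitInterval) ≠ 1 := fun h =>
  zero_ne_one (α := ℝ) (congrArg Subtype.val h)

/-- The relation on `X × Y × [0,1]` generating the join `X * Y`:
`(x,y,0) ~ (x,y',0)` and `(x,y,1) ~ (x',y,1)`. -/
def joinRel (X Y : Type*) (a b : X × Y × unitInterval) : Prop :=
  a = b ∨ (a.2.2 = 0 ∧ b.2.2 = 0 ∧ a.1 = b.1) ∨ (a.2.2 = 1 ∧ b.2.2 = 1 ∧ a.2.1 = b.2.1)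

theorem joinRel_equivalence (X Y : Type*) : Equivalence (joinRel X Y) := by
  constructor
  · exact fun a => Or.inl rfl
  · rintro a b (rfl | ⟨h1, h2, h3⟩ | ⟨h1, h2, h3⟩)
    · exact Or.inl rfl
    · exact Or.inr (Or.inl ⟨h2, h1, h3.symm⟩)
    · exact Or.inr (Or.inr ⟨h2, h1, h3.symm⟩)
  · rintro a b c (rfl | ⟨h1, h2, h3⟩ | ⟨h1, h2, h3⟩) hbc
    · exact hbc
    · rcases hbc with rfl | ⟨g1, g2, g3⟩ | ⟨g1, g2, g3⟩
      · exact Or.inr (Or.inl ⟨h1, h2, h3⟩)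
      · exact Or.inr (Or.inl ⟨h1, g2, h3.trans g3⟩)
      · exact absurd (h2.symm.trans g1) uiZeroNeOne
    · rcases hbc with rfl | ⟨g1, g2, g3⟩ | ⟨g1, g2, g3⟩
      · exact Or.inr (Or.inr ⟨h1, h2, h3⟩)
      · exact absurd (g1.symm.trans h2) uiZeroNeOne
      · exact Or.inr (Or.inr ⟨h1, g2, h3.trans g3⟩)

def joinSetoid (X Y : Type*) : Setoid (X × Y × unitInterval) :=
  ⟨joinRel X Y, joinRel_equivalence X Y⟩

/-- The join `X * Y` of two spaces. -/
def Join (X : Type u) (Y : Type v) : Type (max u v) := Quotient (joinSetoid X Y)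

instance instTopJoin (X : Type u) (Y : Type v) [TopologicalSpace X] [TopologicalSpace Y] :
    TopologicalSpace (Join X Y) :=
  inferInstanceAs (TopologicalSpace (Quotient (joinSetoid X Y)))

/-- The join coordinate `p : X * Y → [0,1]`. -/
def joinParam (X Y : Type*) : Join X Y → unitInterval :=
  Quotient.lift (fun p => p.2.2) (by
    intro a b h
    have h' : joinRel X Y a b := h
    rcases h' with rfl | ⟨h1, h2, -⟩ | ⟨h1, h2, -⟩
    · rfl
    · exact h1.trans h2.symm
    · exact h1.trans h2.symm)

/-- `TJoin j` is the join of `j+1` copies of the three-point discrete space `Fin 3`. -/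
def TJoin : ℕ → Type
  | 0 => Fin 3
  | j + 1 => Join (Fin 3) (TJoin j)

instance instTopTJoin : ∀ j : ℕ, TopologicalSpace (TJoin j)
  | 0 => inferInstanceAs (TopologicalSpace (Fin 3))
  | j + 1 =>
    letI := instTopTJoin j
    inferInstanceAs (TopologicalSpace (Join (Fin 3) (TJoin j)))

/-- A set covered by countably many `C¹` images of `ℝ^d`. -/
def C1Dim {F : Type*} [NormedAddCommGroup F] [NormedSpace ℝ F] (A : Set F) (d : ℕ) : Prop :=
  ∃ P : ℕ → (Fin d → ℝ) → F, (∀ s, ContDiff ℝ 1 (P s)) ∧ A ⊆ ⋃ s, Set.range (P s)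

section C1Dim

variable {E F G : Type*} [NormedAddCommGroup E] [NormedSpace ℝ E] [NormedAddCommGroup F]
  [NormedSpace ℝ F] [NormedAddCommGroup G] [NormedSpace ℝ G]

lemma C1Dim.of_countable [FiniteDimensional ℝ E] {ι : Type*} [Countable ι] {A : Set F} {d : ℕ}
    (hd : Module.finrank ℝ E = d) (P : ι → E → F) (hP : ∀ s, ContDiff ℝ 1 (P s))
    (hA : A ⊆ ⋃ s, Set.range (P s)) : C1Dim A d := by
  have e : (Fin d → ℝ) ≃L[ℝ] E := ContinuousLinearEquiv.ofFinrankEq (by simp [hd])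
  rcases isEmpty_or_nonempty ι with hι | hι
  · refine ⟨fun _ _ => 0, fun _ => contDiff_const, fun x hx => ?_⟩
    simpa using hA hx
  · obtain ⟨g, hg⟩ := exists_surjective_nat ι
    refine ⟨fun s => P (g s) ∘ e, fun s => (hP _).comp e.contDiff, fun x hx => ?_⟩
    obtain ⟨i, y, rfl⟩ := Set.mem_iUnion.1 (hA hx)
    obtain ⟨s, rfl⟩ := hg i
    exact Set.mem_iUnion.2 ⟨s, e.symm y, by simp⟩

lemma C1Dim.mono {A B : Set F} {d : ℕ} (h : C1Dim B d) (hAB : A ⊆ B) : C1Dim A d := by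
  obtain ⟨P, h1, h2⟩ := h
  exact ⟨P, h1, hAB.trans h2⟩

lemma C1Dim.image {A : Set F} {d : ℕ} (h : C1Dim A d) {f : F → G} (hf : ContDiff ℝ 1 f) :
    C1Dim (f '' A) d := by
  obtain ⟨P, h1, h2⟩ := h
  refine ⟨fun s => f ∘ P s, fun s => hf.comp (h1 s), ?_⟩
  rintro _ ⟨x, hx, rfl⟩
  obtain ⟨i, y, rfl⟩ := Set.mem_iUnion.1 (h2 hx)
  exact Set.mem_iUnion.2 ⟨i, y, rfl⟩

lemma C1Dim.univ [FiniteDimensional ℝ F] :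
    C1Dim (Set.univ : Set F) (Module.finrank ℝ F) :=
  C1Dim.of_countable (ι := Unit) rfl (fun _ => id) (fun _ => contDiff_id)
    (by simp [Set.iUnion_const])

lemma C1Dim.prod {A : Set F} {B : Set G} {d e : ℕ} (hA : C1Dim A d) (hB : C1Dim B e) :
    C1Dim (A ×ˢ B) (d + e) := by
  obtain ⟨P, h1, h2⟩ := hA
  obtain ⟨Q, h3, h4⟩ := hB
  refine C1Dim.of_countable (ι := ℕ × ℕ) (E := (Fin d → ℝ) × (Fin e → ℝ)) (by simp)
    (fun s => Prod.map (P s.1) (Q s.2)) (fun s => (h1 _).prodMap (h3 _)) ?_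
  rintro ⟨x, y⟩ ⟨hx, hy⟩
  obtain ⟨i, a, rfl⟩ := Set.mem_iUnion.1 (h2 hx)
  obtain ⟨j, b, rfl⟩ := Set.mem_iUnion.1 (h4 hy)
  exact Set.mem_iUnion.2 ⟨(i, j), (a, b), rfl⟩

lemma C1Dim.pi {ι : Type*} [Fintype ι] {A : ι → Set F} {d : ℕ} (hA : ∀ i, C1Dim (A i) d) :
    C1Dim (Set.univ.pi A) (Fintype.card ι * d) := by
  choose P h1 h2 using hA
  refine C1Dim.of_countable (ι := ι → ℕ) (E := ι → Fin d → ℝ) (by simp [Module.finrank_pi_fintype])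
    (fun s τ i => P i (s i) (τ i)) (fun s => ?_) ?_
  · exact contDiff_pi.2 fun i => (h1 i (s i)).comp (contDiff_apply ℝ (Fin d → ℝ) i)
  · intro x hx
    have : ∀ i, ∃ s τ, P i s τ = x i := fun i => by
      obtain ⟨s, a, h⟩ := Set.mem_iUnion.1 (h2 i (hx i trivial))
      exact ⟨s, a, h⟩
    choose s τ h using this
    exact Set.mem_iUnion.2 ⟨s, τ, funext h⟩

lemma C1Dim.dimH_le {A : Set F} {d : ℕ} (hA : C1Dim A d) : dimH A ≤ d := by
  obtain ⟨P, h1, h2⟩ := hA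
  refine (dimH_mono h2).trans ?_
  rw [dimH_iUnion]
  exact iSup_le fun s => by simpa using (h1 s).dimH_range_le

lemma C1Dim.dense_compl [FiniteDimensional ℝ F] {A : Set F} {d : ℕ} (hA : C1Dim A d)
    (hd : d < Module.finrank ℝ F) : Dense Aᶜ :=
  dense_compl_of_dimH_lt_finrank (hA.dimH_le.trans_lt (by exact_mod_cast hd))

end C1Dim

/-- A finite partition of unity whose members have supports of diameter less than `ε`. -/
structure IsFinePartition {X Λ : Type*} [MetricSpace X] [Fintype Λ] (ρ : Λ → C(X, ℝ))
    (ε : ℝ) : Prop where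
  nonneg : ∀ a x, 0 ≤ ρ a x
  sum_eq_one : ∀ x, ∑ a, ρ a x = 1
  dist_lt : ∀ a x y, ρ a x ≠ 0 → ρ a y ≠ 0 → dist x y < ε

/-- The tensor product of two families of functions. -/
def tensorFamily {X Y Λ Γ : Type*} [TopologicalSpace X] [TopologicalSpace Y] (ρ : Λ → C(X, ℝ))
    (η : Γ → C(Y, ℝ)) (a : Λ × Γ) : C(X × Y, ℝ) :=
  ⟨fun p => ρ a.1 p.1 * η a.2 p.2, by fun_prop⟩

lemma IsFinePartition.mono {X Λ : Type*} [MetricSpace X] [Fintype Λ] {ρ : Λ → C(X, ℝ)}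
    {ε ε' : ℝ} (h : IsFinePartition ρ ε) (hε : ε ≤ ε') : IsFinePartition ρ ε' :=
  ⟨h.nonneg, h.sum_eq_one, fun a x y hx hy => (h.dist_lt a x y hx hy).trans_le hε⟩

lemma IsFinePartition.tensor {X Y Λ Γ : Type*} [MetricSpace X] [MetricSpace Y] [Fintype Λ]
    [Fintype Γ] {ρ : Λ → C(X, ℝ)} {η : Γ → C(Y, ℝ)} {ε : ℝ} (h : IsFinePartition ρ ε)
    (h' : IsFinePartition η ε) : IsFinePartition (tensorFamily ρ η) ε where
  nonneg a x := mul_nonneg (h.nonneg _ _) (h'.nonneg _ _)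
  sum_eq_one x := by
    simp only [tensorFamily, ContinuousMap.coe_mk, Fintype.sum_prod_type, ← Finset.mul_sum,
      h'.sum_eq_one, mul_one, h.sum_eq_one]
  dist_lt a x y hx hy := by
    simp only [tensorFamily, ContinuousMap.coe_mk, mul_ne_zero_iff] at hx hy
    rw [Prod.dist_eq]
    exact max_lt (h.dist_lt _ _ _ hx.1 hy.1) (h'.dist_lt _ _ _ hx.2 hy.2)

lemma exists_approx_of_isFinePartition {Z V : Type*} [MetricSpace Z] [CompactSpace Z]
    [NormedAddCommGroup V] [NormedSpace ℝ V] {f : Z → V} (hf : Continuous f) {δ : ℝ}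
    (hδ : 0 < δ) : ∃ ε > 0, ∀ (Λ : Type) [Fintype Λ] (ρ : Λ → C(Z, ℝ)), IsFinePartition ρ ε →
      ∃ D : Λ → V, (∀ a, (∃ z, ρ a z ≠ 0) → ∃ z, ρ a z ≠ 0 ∧ D a = f z) ∧
        ∀ z, ‖∑ a, ρ a z • D a - f z‖ < δ := by
  classical
  obtain ⟨ε, hε, h⟩ := Metric.uniformContinuous_iff.1
    (CompactSpace.uniformContinuous_of_continuous hf) δ hδ
  refine ⟨ε, hε, fun Λ _ ρ hρ => ?_⟩
  refine ⟨fun a => if h : ∃ z, ρ a z ≠ 0 then f h.choose else 0, fun a ha => ?_, fun z => ?_⟩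
  · exact ⟨ha.choose, ha.choose_spec, dif_pos ha⟩
  · have hz : f z = ∑ a, ρ a z • f z := by rw [← Finset.sum_smul, hρ.sum_eq_one, one_smul]
    conv_lhs => rw [hz, ← Finset.sum_sub_distrib]
    have key : ∀ a, ‖ρ a z • (if h : ∃ z, ρ a z ≠ 0 then f h.choose else 0) - ρ a z • f z‖
        ≤ ρ a z * δ ∧ (ρ a z ≠ 0 → ‖ρ a z • (if h : ∃ z, ρ a z ≠ 0 then f h.choose else 0) -
          ρ a z • f z‖ < ρ a z * δ) := by
      intro a
      by_cases ha : ρ a z = 0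
      · simp [ha]
      · have hex : ∃ z, ρ a z ≠ 0 := ⟨z, ha⟩
        have : ‖ρ a z • (if h : ∃ z, ρ a z ≠ 0 then f h.choose else 0) - ρ a z • f z‖
            < ρ a z * δ := by
          rw [dif_pos hex, ← smul_sub, norm_smul, Real.norm_of_nonneg (hρ.nonneg a z)]
          refine mul_lt_mul_of_pos_left ?_ ((hρ.nonneg a z).lt_of_ne' ha)
          rw [← dist_eq_norm]
          exact h (hρ.dist_lt a _ _ hex.choose_spec ha)
        exact ⟨this.le, fun _ => this⟩
    obtain ⟨a, ha⟩ : ∃ a, ρ a z ≠ 0 := by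
      by_contra! hall
      have := hρ.sum_eq_one z
      simp [hall] at this
    calc _ ≤ ∑ a, ‖ρ a z • (if h : ∃ z, ρ a z ≠ 0 then f h.choose else 0) - ρ a z • f z‖ :=
          norm_sum_le _ _
      _ < ∑ a, ρ a z * δ := Finset.sum_lt_sum (fun a _ => (key a).1)
          ⟨a, Finset.mem_univ _, (key a).2 ha⟩
      _ = δ := by rw [← Finset.sum_mul, hρ.sum_eq_one, one_mul]

/-- Finite-dimensionality, expressed through fine partitions of unity whose joint image is
covered by `C¹` images of `ℝ^n`. -/
def FinDimLE (X : Type*) [MetricSpace X] (n : ℕ) : Prop :=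
  ∀ ε > (0 : ℝ), ∃ (Λ : Type) (_ : Fintype Λ) (ρ : Λ → C(X, ℝ)), IsFinePartition ρ ε ∧
    C1Dim (Set.range fun x a => ρ a x) n

/-- The sets of points of a simplex with at most `n+1` nonzero coordinates is `n`-dimensional. -/
lemma c1Dim_simplex_skeleton (Λ : Type*) [Fintype Λ] (n : ℕ) :
    C1Dim {v : Λ → ℝ | ∑ a, v a = 1 ∧ {a | v a ≠ 0}.ncard ≤ n + 1} n := by
  classical
  refine C1Dim.of_countable (ι := Fin (n + 1) → Λ) (E := Fin n → ℝ) (by simp)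
    (fun s τ a => ∑ j : Fin (n + 1),
      (Fin.cons (1 - ∑ i, τ i) τ : Fin (n + 1) → ℝ) j * if s j = a then 1 else 0) ?_ ?_
  · intro s
    refine contDiff_pi.2 fun a => ?_
    simp only [Fin.sum_univ_succ, Fin.cons_zero, Fin.cons_succ]
    fun_prop
  · rintro v ⟨hv1, hv2⟩
    have hne : Nonempty Λ := by
      by_contra hΛ
      rw [not_nonempty_iff] at hΛ
      simp at hv1
    have hcard : Fintype.card {a | v a ≠ 0} ≤ Fintype.card (Fin (n + 1)) := by
      rw [Fintype.card_fin, ← Nat.card_eq_fintype_card]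
      exact hv2
    obtain ⟨e⟩ := Function.Embedding.nonempty_of_card_le hcard
    set s : Fin (n + 1) → Λ := Function.extend e Subtype.val (fun _ => Classical.arbitrary Λ)
    set c : Fin (n + 1) → ℝ := Function.extend e (fun a => v a) 0
    have key : ∀ a, ∑ j, c j * (if s j = a then 1 else 0) = v a := by
      intro a
      by_cases ha : v a ≠ 0
      · rw [Finset.sum_eq_single (e ⟨a, ha⟩)]
        · simp [c, s, e.injective.extend_apply]
        · intro j _ hj
          by_cases hje : ∃ b, e b = j
          · obtain ⟨b, rfl⟩ := hje
            have : (b : Λ) ≠ a := fun h => hj (by congr 1; exact Subtype.ext h)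
            simp [s, e.injective.extend_apply, this]
          · simp [c, Function.extend_apply' _ _ _ hje]
        · simp
      · rw [not_not] at ha
        rw [ha]
        refine Finset.sum_eq_zero fun j _ => ?_
        by_cases hje : ∃ b, e b = j
        · obtain ⟨b, rfl⟩ := hje
          have : (b : Λ) ≠ a := fun h => b.2 (h ▸ ha)
          simp [s, e.injective.extend_apply, this]
        · simp [c, Function.extend_apply' _ _ _ hje]
    have hc : ∑ j, c j = 1 := by
      rw [← hv1, ← Finset.sum_congr rfl fun a _ => key a, Finset.sum_comm]
      simp
    refine Set.mem_iUnion.2 ⟨s, Fin.tail c, ?_⟩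
    have : (Fin.cons (1 - ∑ i, Fin.tail c i) (Fin.tail c) : Fin (n + 1) → ℝ) = c := by
      rw [Fin.sum_univ_succ] at hc
      rw [show 1 - ∑ i, Fin.tail c i = c 0 by simp only [Fin.tail]; linarith]
      exact Fin.cons_self_tail c
    funext a
    simp only [this]
    exact key a

lemma CoveringDimLE.finDimLE {X : Type} [MetricSpace X] [CompactSpace X] {n : ℕ}
    (h : CoveringDimLE X n) : FinDimLE X n := by
  classical
  intro ε hε
  obtain ⟨V, hVo, hVu, hVr, hVn⟩ := h {u | ∃ x, u = ball x (ε / 2)}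
    (by rintro _ ⟨x, rfl⟩; exact isOpen_ball)
    (Set.eq_univ_of_forall fun x => ⟨_, ⟨x, rfl⟩, mem_ball_self (by positivity)⟩)
  obtain ⟨T, hTV, hT⟩ := isCompact_univ.elim_finite_subcover_image
    (b := V) (c := id) hVo (by rw [← hVu, Set.sUnion_eq_biUnion]; rfl)
  obtain ⟨hTfin, hT⟩ := hT
  have : Finite T := hTfin
  have : Fintype T := Fintype.ofFinite T
  obtain ⟨f, hf⟩ := PartitionOfUnity.exists_isSubordinate (s := (Set.univ : Set X)) isClosed_univ
    (fun t : T => (t : Set X)) (fun t => hVo _ (hTV t.2)) (by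
      intro x hx
      obtain ⟨t, ht, hxt⟩ := Set.mem_iUnion₂.1 (hT hx)
      exact Set.mem_iUnion.2 ⟨⟨t, ht⟩, hxt⟩)
  have hmem : ∀ (a : T) x, f a x ≠ 0 → x ∈ (a : Set X) := fun a x hx =>
    hf a (subset_tsupport _ hx)
  have hsum : ∀ x, ∑ a, f a x = 1 := fun x => by
    rw [← f.sum_eq_one (Set.mem_univ x), finsum_eq_sum_of_fintype]
  let e := Fintype.equivFin T
  refine ⟨Fin (Fintype.card T), inferInstance, fun a => f (e.symm a), ⟨fun a x => f.nonneg _ x,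
    fun x => ?_, fun a x y hx hy => ?_⟩, (c1Dim_simplex_skeleton _ n).mono ?_⟩
  · rw [← hsum x]; exact e.symm.sum_comp fun a => f a x
  · obtain ⟨_, ⟨z, rfl⟩, hz⟩ := hVr _ (hTV (e.symm a).2)
    have h1 := mem_ball.1 (hz (hmem _ _ hx))
    have h2 := mem_ball.1 (hz (hmem _ _ hy))
    linarith [dist_triangle_right x y z]
  · rintro _ ⟨x, rfl⟩
    refine ⟨by rw [← hsum x]; exact e.symm.sum_comp fun a => f a x, ?_⟩
    refine le_trans ?_ (hVn x).2
    refine Set.ncard_le_ncard_of_injOn (fun a => ((e.symm a : T) : Set X)) ?_ ?_ (hVn x).1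
    · intro a ha
      exact ⟨hTV (e.symm a).2, hmem _ _ ha⟩
    · intro a _ b _ hab
      exact e.symm.injective (Subtype.ext hab)

lemma isOpen_setOf_forall_mem {V D : Type*} [TopologicalSpace V] [TopologicalSpace D]
    {K : Set D} (hK : IsCompact K) {p : V → D → Prop} (hp : IsOpen {q : V × D | p q.1 q.2}) :
    IsOpen {v | ∀ t ∈ K, p v t} :=
  isOpen_iff_eventually.2 fun _ hv => hK.eventually_forall_of_forall_eventually fun t ht =>
    hp.eventually_mem (hv t ht)

section GeneralPosition

variable {D E F : Type*} [NormedAddCommGroup D] [NormedSpace ℝ D] [NormedAddCommGroup E]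
  [NormedSpace ℝ E] [NormedAddCommGroup F] [NormedSpace ℝ F] [FiniteDimensional ℝ F]

lemma dense_setOf_forall_ne_zero_local [FiniteDimensional ℝ D] [FiniteDimensional ℝ E]
    {M : D → E →L[ℝ] F} (hM : ContDiff ℝ 1 M)
    {T : Set D} {d : ℕ} (hd : C1Dim T d) (hlt : d < Module.finrank ℝ F) (t₀ : D)
    (hs : Function.Surjective (M t₀)) :
    ∃ r > 0, Dense {v : E | ∀ t ∈ T ∩ closedBall t₀ r, M t v ≠ 0} := by
  obtain ⟨N, hN⟩ := (M t₀).exists_rightInverse_of_surjective (LinearMap.range_eq_top.2 hs)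
  let B : D → F →L[ℝ] F := fun t => (M t).comp N
  have hB : ContDiff ℝ 1 B := hM.clm_comp contDiff_const
  have hB0 : B t₀ = (ContinuousLinearEquiv.refl ℝ F : F →L[ℝ] F) := hN
  have hinv : ∀ᶠ t in 𝓝 t₀, (B t).IsInvertible := by
    have h1 := ContinuousLinearEquiv.nhds (ContinuousLinearEquiv.refl ℝ F)
    rw [← hB0] at h1
    exact hB.continuous.continuousAt.eventually_mem h1
  obtain ⟨R, hR, hRinv⟩ := Metric.eventually_nhds_iff_ball.1 hinv
  have hsm : ∀ v₀ : E, ContDiffOn ℝ 1 (fun t => -((B t).inverse (M t v₀))) (ball t₀ R) := by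
    intro v₀ t ht
    refine ContDiffAt.contDiffWithinAt ?_
    have h1 : ContDiffAt ℝ 1 (fun t => (B t).inverse) t :=
      ((hRinv t ht).contDiffAt_map_inverse).comp t hB.contDiffAt
    have h2 : ContDiffAt ℝ 1 (fun t => M t v₀) t := (hM.clm_apply contDiff_const).contDiffAt
    exact (h1.clm_apply h2).neg
  refine ⟨R / 2, by positivity, fun v₀ => ?_⟩
  have hsub : T ∩ closedBall t₀ (R / 2) ⊆ ball t₀ R := fun t ht =>
    closedBall_subset_ball (by linarith) ht.2
  have hdense := (hsm v₀).dense_compl_image_of_dimH_lt_finrank (convex_ball _ _) hsub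
    ((dimH_mono Set.inter_subset_left).trans_lt
      (hd.dimH_le.trans_lt (by exact_mod_cast hlt)))
  have hcont : Continuous fun ω : F => v₀ + N ω := by fun_prop
  have hmaps : Set.MapsTo (fun ω : F => v₀ + N ω)
      ((fun t => -((B t).inverse (M t v₀))) '' (T ∩ closedBall t₀ (R / 2)))ᶜ
      {v : E | ∀ t ∈ T ∩ closedBall t₀ (R / 2), M t v ≠ 0} := by
    intro ω hω t ht hzero
    refine hω ⟨t, ht, ?_⟩
    have hi := hRinv t (hsub ht)
    have h1 : B t ω = -(M t v₀) := by
      rw [map_add] at hzero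
      exact eq_neg_of_add_eq_zero_right hzero
    have h2 : (B t).inverse (-(M t v₀)) = ω := by rw [hi.inverse_apply_eq, h1]
    rw [← h2, map_neg]
  simpa only [map_zero, add_zero] using map_mem_closure hcont (hdense 0) hmaps

/-- A generic vector is not in the kernel of any member of a family of surjections which depends on
fewer parameters than the dimension of the target. -/
lemma dense_setOf_forall_ne_zero [FiniteDimensional ℝ D] [FiniteDimensional ℝ E]
    {M : D → E →L[ℝ] F} (hM : ContDiff ℝ 1 M)
    {T : Set D} (hT : IsCompact T) (hs : ∀ t ∈ T, Function.Surjective (M t))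
    {d : ℕ} (hd : C1Dim T d) (hlt : d < Module.finrank ℝ F) :
    Dense {v : E | ∀ t ∈ T, M t v ≠ 0} := by
  choose! r hr hdense using fun t (ht : t ∈ T) =>
    dense_setOf_forall_ne_zero_local hM hd hlt t (hs t ht)
  obtain ⟨u, huT, hTu⟩ := hT.elim_nhds_subcover (fun t => closedBall t (r t))
    (fun t ht => closedBall_mem_nhds t (hr t ht))
  have : FiniteDimensional ℝ E := inferInstance
  have : CompleteSpace E := FiniteDimensional.complete ℝ E
  have key : Dense (⋂ t ∈ (u : Set D), {v : E | ∀ s ∈ T ∩ closedBall t (r t), M s v ≠ 0}) := by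
    refine dense_biInter_of_isOpen (fun t ht => ?_) u.countable_toSet
      fun t ht => hdense t (huT t ht)
    refine isOpen_setOf_forall_mem (hT.inter_right isClosed_closedBall) ?_
    refine isOpen_ne_fun ?_ continuous_const
    exact (hM.continuous.comp continuous_snd).clm_apply continuous_fst
  refine key.mono fun v hv t ht => ?_
  obtain ⟨s, hsu, hts⟩ := Set.mem_iUnion₂.1 (hTu ht)
  exact (Set.mem_iInter₂.1 hv s hsu) t ⟨ht, hts⟩

end GeneralPosition

section Generic

variable {X : Type} [MetricSpace X] {Q S B C : Type}

/-- Tuples of pairwise related, pairwise `ε`-separated points. -/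
def separatedTuples (Q : Type) (Rel : X → X → Prop) (ε : ℝ) : Set (Q → X) :=
  {y | (∀ i j, i ≠ j → ε ≤ dist (y i) (y j)) ∧ ∀ i j, Rel (y i) (y j)}

lemma separatedTuples_mono {Rel Rel' : X → X → Prop} (h : ∀ x y, Rel x y → Rel' x y)
    {ε ε' : ℝ} (hε : ε' ≤ ε) : separatedTuples Q Rel ε ⊆ separatedTuples Q Rel' ε' :=
  fun _ hy => ⟨fun i j hij => hε.trans (hy.1 i j hij), fun i j => h _ _ (hy.2 i j)⟩

lemma isCompact_separatedTuples [CompactSpace X] {Rel : X → X → Prop} (hRel : IsClosed {p : X × X | Rel p.1 p.2})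
    (ε : ℝ) : IsCompact (separatedTuples Q Rel ε) := by
  refine IsClosed.isCompact ?_
  have : separatedTuples Q Rel ε = (⋂ i, ⋂ j, ⋂ (_ : i ≠ j), {y | ε ≤ dist (y i) (y j)}) ∩
      ⋂ i, ⋂ j, (fun y : Q → X => (y i, y j)) ⁻¹' {p : X × X | Rel p.1 p.2} := by
    ext y
    simp [separatedTuples]
  rw [this]
  refine IsClosed.inter (isClosed_iInter fun i => isClosed_iInter fun j => isClosed_iInter
    fun _ => isClosed_le continuous_const (by fun_prop)) (isClosed_iInter fun i =>
      isClosed_iInter fun j => hRel.preimage (by fun_prop))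

variable [Fintype Q] [Fintype B]

/-- The integral linear combinations, prescribed by `L`, of the values of the functions `F b` at
the pairs of points of a tuple. -/
def evalRow (L : C → B × Q × Q → ℤ) (F : B → C(X × X, ℝ)) (y : Q → X) (c : C) : ℝ :=
  ∑ k, (L c k : ℝ) * F k.1 (y k.2.1, y k.2.2)

/-- The rows of an integral matrix are linearly independent. -/
def FullRank {K : Type} [Fintype K] (L : C → K → ℤ) : Prop :=
  ∀ z : C → ℝ, ∃ m : K → ℝ, ∀ c, ∑ k, (L c k : ℝ) * m k = z c

/-- The families of functions for which the conditions `L` have no common solution among the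
separated tuples satisfying the edge conditions given by `φ`. -/
def goodFamilies (Rel : X → X → Prop) {r : ℕ} (φ : Fin r → X → X → ℝ) (e f : S → Q)
    (L : C → B × Q × Q → ℤ) (ε : ℝ) : Set (B → C(X × X, ℝ)) :=
  {F | ∀ y ∈ separatedTuples Q Rel ε, (∀ s i, φ i (y (e s)) (y (f s)) = 0) →
    ∃ c, evalRow L F y c ≠ 0}

/-- General position of the relation `Rel`, which is thought of as given by `J` equations, with
respect to the further equations `φ`. -/
def Generic (n : ℕ) (Rel : X → X → Prop) (J : ℕ) {r : ℕ} (φ : Fin r → X → X → ℝ) : Prop :=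
  ∀ (q s b c : ℕ) (e f : Fin s → Fin q) (L : Fin c → Fin b × Fin q × Fin q → ℤ),
    Function.Injective f → (∀ s t, e s ≠ f t) → FullRank L →
    q * n + J < J * q + s * r + c → ∀ ε > 0, Dense (goodFamilies Rel φ e f L ε)

lemma Generic.dense [Fintype S] [Fintype C] {n J r : ℕ} {Rel : X → X → Prop}
    {φ : Fin r → X → X → ℝ} (h : Generic n Rel J φ) {e f : S → Q} {L : C → B × Q × Q → ℤ}
    (hf : Function.Injective f) (hef : ∀ s t, e s ≠ f t) (hL : FullRank L)
    (hcount : Fintype.card Q * n + J <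
      J * Fintype.card Q + Fintype.card S * r + Fintype.card C) {ε : ℝ} (hε : 0 < ε) :
    Dense (goodFamilies Rel φ e f L ε) := by
  let eQ := Fintype.equivFin Q
  let eS := Fintype.equivFin S
  let eB := Fintype.equivFin B
  let eC := Fintype.equivFin C
  let eK : Fin (Fintype.card B) × Fin (Fintype.card Q) × Fin (Fintype.card Q) ≃ B × Q × Q :=
    eB.symm.prodCongr (eQ.symm.prodCongr eQ.symm)
  let L' := fun c k => L (eC.symm c) (eK k)
  have hL' : FullRank L' := by
    intro z
    obtain ⟨m, hm⟩ := hL (fun c => z (eC c))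
    refine ⟨fun k => m (eK k), fun c => ?_⟩
    have := hm (eC.symm c)
    rw [Equiv.apply_symm_apply] at this
    rw [← this]
    exact eK.sum_comp fun k => (L (eC.symm c) k : ℝ) * m k
  have hd := h _ _ _ _ (fun s => eQ (e (eS.symm s))) (fun s => eQ (f (eS.symm s))) L'
    (eQ.injective.comp (hf.comp eS.symm.injective))
    (fun s t hst => hef _ _ (eQ.injective hst)) hL' hcount ε hε
  let T : (Fin (Fintype.card B) → C(X × X, ℝ)) → (B → C(X × X, ℝ)) := fun F b => F (eB b)
  have hT : Continuous T := continuous_pi fun b => continuous_apply _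
  have hTs : Function.Surjective T := fun F => ⟨fun b => F (eB.symm b), by simp [T]⟩
  refine (hTs.denseRange.dense_image hT hd).mono ?_
  rintro _ ⟨F, hF, rfl⟩ y hy hφ
  obtain ⟨c, hc⟩ := hF (fun i => y (eQ.symm i))
    ⟨fun i j hij => hy.1 _ _ fun h => hij (eQ.symm.injective h), fun i j => hy.2 _ _⟩
    (fun s i => by simpa using hφ (eS.symm s) i)
  refine ⟨eC.symm c, fun h0 => hc ?_⟩
  rw [← h0]
  simp only [evalRow, T]
  rw [← eK.sum_comp]
  simp [L', eK]

variable [CompactSpace X]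

lemma continuous_evalRow (L : C → B × Q × Q → ℤ) (c : C) :
    Continuous fun p : (B → C(X × X, ℝ)) × (Q → X) => evalRow L p.1 p.2 c := by
  unfold evalRow
  fun_prop

lemma generic_true {n : ℕ} (hX : FinDimLE X n) (φ : Fin 0 → X → X → ℝ) :
    Generic n (fun _ _ : X => True) 0 φ := by
  classical
  intro q s b c e f L _ _ hL hcount ε hε
  simp only [mul_zero, zero_mul, add_zero, zero_add] at hcount
  rw [Metric.dense_iff]
  intro F₀ δ hδ
  obtain ⟨ε₁, hε₁, happ⟩ := exists_approx_of_isFinePartition (Z := X × X)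
    (f := fun z => fun b => F₀ b z) (by fun_prop) (half_pos hδ)
  obtain ⟨Λ, _, ρ, hρ, hdim⟩ := hX (min ε ε₁) (lt_min hε hε₁)
  obtain ⟨D₀, -, hD₀⟩ := happ (Λ × Λ) (tensorFamily ρ ρ)
    ((hρ.tensor hρ).mono (min_le_right _ _))
  let T : (Λ × Λ → Fin b → ℝ) → (Fin b → C(X × X, ℝ)) :=
    fun D b => ∑ a, D a b • tensorFamily ρ ρ a
  have hT : Continuous T := by
    refine continuous_pi fun b' => continuous_finsetSum _ fun a _ => ?_
    have h : Continuous fun D : Λ × Λ → Fin b → ℝ => D a b' := by fun_prop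
    exact h.smul continuous_const
  have hTapp : ∀ D b x y, T D b (x, y) = ∑ a, D a b * (ρ a.1 x * ρ a.2 y) := by
    intro D b x y
    simp [T, tensorFamily, ContinuousMap.sum_apply]
  have hTD : dist (T D₀) F₀ < δ := by
    refine lt_of_le_of_lt ?_ (half_lt_self hδ)
    refine (dist_pi_le_iff (half_pos hδ).le).2 fun b => ?_
    refine (ContinuousMap.dist_le (half_pos hδ).le).2 fun z => ?_
    have h1 := (norm_le_pi_norm _ b).trans (hD₀ z).le
    have h2 : T D₀ b z - F₀ b z =
        (∑ a, (tensorFamily ρ ρ a) z • D₀ a - fun b => (F₀ b) z) b := by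
      rw [hTapp D₀ b z.1 z.2]
      simp [tensorFamily, mul_comm]
    rw [dist_eq_norm, h2]
    exact h1
  -- the linear conditions on the coefficients
  let M : (Fin q → Λ → ℝ) → (Λ × Λ → Fin b → ℝ) →L[ℝ] (Fin c → ℝ) := fun t =>
    ∑ a : Λ × Λ, ∑ k : Fin b × Fin q × Fin q, (t k.2.1 a.1 * t k.2.2 a.2) •
      ((ContinuousLinearMap.pi fun c => (L c k : ℝ) •
        (ContinuousLinearMap.proj (R := ℝ) (φ := fun _ : Fin b => ℝ) k.1 ∘L
          ContinuousLinearMap.proj (R := ℝ) (φ := fun _ : Λ × Λ => Fin b → ℝ) a)) :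
        (Λ × Λ → Fin b → ℝ) →L[ℝ] (Fin c → ℝ))
  have hMapp : ∀ t D c, M t D c = ∑ k : Fin b × Fin q × Fin q, (L c k : ℝ) *
      ∑ a : Λ × Λ, D a k.1 * (t k.2.1 a.1 * t k.2.2 a.2) := by
    intro t D c
    simp only [M, sum_apply, Finset.sum_apply, smul_apply,
      ContinuousLinearMap.pi_apply, Pi.smul_apply, smul_eq_mul, ContinuousLinearMap.comp_apply,
      ContinuousLinearMap.proj_apply]
    rw [Finset.sum_comm]
    refine Finset.sum_congr rfl fun k _ => ?_
    rw [Finset.mul_sum]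
    exact Finset.sum_congr rfl fun a _ => by ring
  have hM : ContDiff ℝ 1 M := by
    refine ContDiff.sum fun a _ => ContDiff.sum fun k _ => ?_
    have h : ContDiff ℝ 1 fun t : Fin q → Λ → ℝ => t k.2.1 a.1 * t k.2.2 a.2 := by fun_prop
    exact h.smul contDiff_const
  let τ : (Fin q → X) → (Fin q → Λ → ℝ) := fun y i a => ρ a (y i)
  have hτ : Continuous τ := by fun_prop
  have hcomp : IsCompact (τ '' separatedTuples (Fin q) (fun _ _ : X => True) ε) :=
    (isCompact_separatedTuples (by simp) ε).image hτ
  have hdimT : C1Dim (τ '' separatedTuples (Fin q) (fun _ _ : X => True) ε) (q * n) := by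
    have := C1Dim.pi (ι := Fin q) (fun _ => hdim)
    rw [Fintype.card_fin] at this
    refine this.mono ?_
    rintro _ ⟨y, -, rfl⟩ i -
    exact ⟨y i, rfl⟩
  have hsurj : ∀ t ∈ τ '' separatedTuples (Fin q) (fun _ _ : X => True) ε,
      Function.Surjective (M t) := by
    rintro _ ⟨y, hy, rfl⟩ z
    obtain ⟨m, hm⟩ := hL z
    have hind : ∀ i j, ∑ a, (if ρ a (y i) ≠ 0 then 1 else 0) * ρ a (y j) =
        if i = j then (1 : ℝ) else 0 := by
      intro i j
      split_ifs with hij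
      · subst hij
        refine Eq.trans ?_ (hρ.sum_eq_one (y i))
        refine Finset.sum_congr rfl fun a _ => ?_
        split_ifs with h
        · rw [one_mul]
        · rw [not_not] at h
          rw [h, mul_zero]
      · refine Finset.sum_eq_zero fun a _ => ?_
        split_ifs with h
        · by_contra hne
          have h1 := hρ.dist_lt a _ _ h (right_ne_zero_of_mul hne)
          exact absurd (hy.1 i j hij) (not_le.2 (h1.trans_le (min_le_left _ _)))
        · rw [zero_mul]
    refine ⟨fun a b => ∑ i, ∑ j, m (b, i, j) *
      ((if ρ a.1 (y i) ≠ 0 then 1 else 0) * (if ρ a.2 (y j) ≠ 0 then 1 else 0)), ?_⟩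
    funext c
    rw [hMapp, ← hm c]
    refine Finset.sum_congr rfl fun k _ => ?_
    congr 1
    obtain ⟨b, i', j'⟩ := k
    simp only [τ]
    calc _ = ∑ i, ∑ j, m (b, i, j) *
          ((∑ a, (if ρ a (y i) ≠ 0 then 1 else 0) * ρ a (y i')) *
          ∑ a, (if ρ a (y j) ≠ 0 then 1 else 0) * ρ a (y j')) := by
          simp only [Finset.sum_mul]
          rw [Finset.sum_comm]
          refine Finset.sum_congr rfl fun i _ => ?_
          rw [Finset.sum_comm]
          refine Finset.sum_congr rfl fun j _ => ?_
          rw [Fintype.sum_prod_type, Finset.mul_sum]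
          refine Finset.sum_congr rfl fun a _ => ?_
          rw [Finset.mul_sum, Finset.mul_sum]
          refine Finset.sum_congr rfl fun a' _ => ?_
          ring
      _ = m (b, i', j') := by
          simp only [hind]
          simp
  have hdense := dense_setOf_forall_ne_zero hM hcomp hsurj hdimT (by simpa using hcount)
  obtain ⟨D, hD, hDT⟩ := hdense.inter_open_nonempty (T ⁻¹' ball F₀ δ) (isOpen_ball.preimage hT)
    ⟨D₀, hTD⟩
  refine ⟨T D, hD, fun y hy _ => ?_⟩
  have := hDT _ ⟨y, hy, rfl⟩
  obtain ⟨c, hc⟩ := Function.ne_iff.1 this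
  refine ⟨c, ?_⟩
  rw [hMapp] at hc
  simpa [evalRow, hTapp, τ] using hc

end Generic

section ClosedPreorder

variable {X : Type*} [TopologicalSpace X] {le : X → X → Prop}

/-- A set containing with each point all points below it. -/
def IsLowerFor (le : X → X → Prop) (u : Set X) : Prop :=
  ∀ x y, le x y → y ∈ u → x ∈ u

lemma Urysohns.CU.approx_le_of_le (c : Urysohns.CU fun _ u => IsLowerFor le u) (n : ℕ) {x y : X}
    (h : le x y) : c.approx n x ≤ c.approx n y := by
  induction n generalizing c with
  | zero =>
    by_cases hy : y ∈ c.U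
    · have hx := c.P_C_U x y h hy
      simp [Urysohns.CU.approx, hx, hy]
    · rw [Urysohns.CU.approx_of_notMem_U _ _ hy]
      exact Urysohns.CU.approx_le_one _ _ _
  | succ n ih => exact midpoint_le_midpoint (ih _) (ih _)

lemma Urysohns.CU.lim_le_of_le (c : Urysohns.CU fun _ u => IsLowerFor le u) {x y : X}
    (h : le x y) : c.lim x ≤ c.lim y :=
  le_of_tendsto_of_tendsto' (c.tendsto_approx_atTop x) (c.tendsto_approx_atTop y)
    fun n => c.approx_le_of_le n h

variable [CompactSpace X]

lemma isOpen_lower_interior (hle : IsClosed {p : X × X | le p.1 p.2}) {u : Set X}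
    (hu : IsOpen u) : IsOpen {x | ∀ y, le y x → y ∈ u} := by
  have : {x | ∀ y, le y x → y ∈ u}ᶜ =
      Prod.snd '' ({p : X × X | le p.1 p.2} ∩ Prod.fst ⁻¹' uᶜ) := by
    ext x
    simp [and_comm]
  rw [← isClosed_compl_iff, this]
  exact isClosedMap_snd_of_compactSpace _
    (hle.inter (hu.isClosed_compl.preimage continuous_fst))

lemma isClosed_lower_closure (hle : IsClosed {p : X × X | le p.1 p.2}) {c : Set X}
    (hc : IsClosed c) : IsClosed {x | ∃ y ∈ c, le x y} := by
  have : {x | ∃ y ∈ c, le x y} =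
      Prod.fst '' ({p : X × X | le p.1 p.2} ∩ Prod.snd ⁻¹' c) := by
    ext x
    simp [and_comm]
  rw [this]
  exact isClosedMap_fst_of_compactSpace _ (hle.inter (hc.preimage continuous_snd))

variable [T2Space X]

/-- Urysohn's lemma for closed preorders. -/
lemma exists_monotone_continuous (hle : IsClosed {p : X × X | le p.1 p.2}) (hrefl : ∀ x, le x x)
    (htrans : ∀ x y z, le x y → le y z → le x z) {c u : Set X} (hc : IsClosed c) (hu : IsOpen u)
    (hlow : IsLowerFor le u) (hcu : c ⊆ u) :
    ∃ f : C(X, ℝ), (∀ x y, le x y → f x ≤ f y) ∧ (∀ x ∈ c, f x = 0) ∧ (∀ x ∉ u, f x = 1) ∧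
      ∀ x, f x ∈ Set.Icc (0 : ℝ) 1 := by
  let K : Urysohns.CU fun _ u => IsLowerFor le u :=
    { C := c
      U := u
      P_C_U := hlow
      closed_C := hc
      open_U := hu
      subset := hcu
      hP := by
        intro c u hc hlow hu hcu
        obtain ⟨w, hw, hcw, hwu⟩ := normal_exists_closure_subset
          (isClosed_lower_closure hle hc) hu (fun x ⟨y, hy, hxy⟩ => hlow _ _ hxy (hcu hy))
        refine ⟨{x | ∀ y, le y x → y ∈ w}, isOpen_lower_interior hle hw, ?_, ?_, ?_, hlow⟩
        · exact fun x hx y hyx => hcw ⟨x, hx, hyx⟩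
        · exact (closure_mono fun x (hx : ∀ y, le y x → y ∈ w) => hx x (hrefl x)).trans hwu
        · exact fun x y hxy hy z hzx => hy z (htrans _ _ _ hzx hxy) }
  exact ⟨⟨K.lim, K.continuous_lim⟩, fun x y h => K.lim_le_of_le h, fun x hx => K.lim_of_mem_C x hx,
    fun x hx => K.lim_of_notMem_U x hx, K.lim_mem_Icc⟩

end ClosedPreorder

/-- A closed partial order on a compact metric space admits a continuous strictly monotone
function. -/
lemma exists_strictMono_continuous {X : Type*} [MetricSpace X] [CompactSpace X]
    {le : X → X → Prop} (hle : IsClosed {p : X × X | le p.1 p.2}) (hrefl : ∀ x, le x x)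
    (htrans : ∀ x y z, le x y → le y z → le x z) (hanti : ∀ x y, le x y → le y x → x = y) :
    ∃ h : C(X, ℝ), ∀ x y, le x y → x ≠ y → h x < h y := by
  let M : Set C(X, ℝ) := {f | ∀ x y, le x y → f x ≤ f y}
  have : Nonempty M := ⟨⟨0, fun x y _ => le_rfl⟩⟩
  let d : ℕ → C(X, ℝ) := fun n => (TopologicalSpace.denseSeq M n : C(X, ℝ))
  have hd : ∀ n x y, le x y → d n x ≤ d n y := fun n => (TopologicalSpace.denseSeq M n).2
  have hstrict : ∀ x y, le x y → x ≠ y → ∃ n, d n x < d n y := by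
    intro x y hxy hne
    obtain ⟨f, hf1, hf2, hf3, -⟩ := exists_monotone_continuous hle hrefl htrans
      (c := {z | le z x}) (u := {z | ¬ le y z})
      (hle.preimage (f := fun z => (z, x)) (by fun_prop))
      (hle.preimage (f := fun z => (y, z)) (by fun_prop)).isOpen_compl
      (fun a b hab hb h => hb (htrans _ _ _ h hab))
      (fun z hz h => hne (hanti _ _ hxy (htrans _ _ _ h hz)))
    have hopen : IsOpen {g : M | (g : C(X, ℝ)) x < (g : C(X, ℝ)) y} :=
      isOpen_lt (by fun_prop) (by fun_prop)
    obtain ⟨g, hg, n, rfl⟩ := (TopologicalSpace.denseRange_denseSeq M).inter_open_nonempty _ hopen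
      ⟨⟨f, hf1⟩, by
        change f x < f y
        rw [hf2 x (hrefl x), hf3 y (fun h => h (hrefl y))]; exact zero_lt_one⟩
    exact ⟨n, hg⟩
  let a : ℕ → ℝ := fun n => (1 / 2) ^ n * (1 + ‖d n‖)⁻¹
  have ha : ∀ n, 0 < a n := fun n => by positivity
  have hsum : Summable fun n => a n • d n := by
    refine Summable.of_norm_bounded summable_geometric_two fun n => ?_
    rw [norm_smul, Real.norm_of_nonneg (ha n).le, mul_assoc]
    refine mul_le_of_le_one_right (by positivity) ?_
    rw [inv_mul_le_iff₀ (by positivity)]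
    linarith [norm_nonneg (d n)]
  have heval : ∀ x, Summable fun n => a n * d n x := fun x => by
    simpa using (ContinuousMap.evalCLM ℝ x : C(X, ℝ) →L[ℝ] ℝ).summable hsum
  refine ⟨∑' n, a n • d n, fun x y hxy hne => ?_⟩
  have happ : ∀ x, (∑' n, a n • d n) x = ∑' n, a n * d n x := fun x => by
    simpa using (ContinuousMap.evalCLM ℝ x : C(X, ℝ) →L[ℝ] ℝ).map_tsum hsum
  rw [happ, happ]
  obtain ⟨n, hn⟩ := hstrict x y hxy hne
  exact Summable.tsum_lt_tsum (fun n => mul_le_mul_of_nonneg_left (hd n x y hxy) (ha n).le)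
    (mul_lt_mul_of_pos_left hn (ha n)) (heval x) (heval y)

/-- A continuous function can be averaged to one that is invariant under a closed equivalence
relation, using only values at points equivalent to nearby points. -/
lemma exists_invariant_continuous {X : Type*} [MetricSpace X] [CompactSpace X]
    {r : X → X → Prop} (hr : IsClosed {p : X × X | r p.1 p.2}) (heq : Equivalence r)
    (v : C(X, ℝ)) {δ : ℝ} (hδ : 0 < δ) :
    ∃ w : C(X, ℝ), (∀ x y, r x y → w x = w y) ∧
      ∀ x, w x ∈ convexHull ℝ (v '' {s | ∃ x', r x' s ∧ dist x x' < δ}) := by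
  have hopen : ∀ a, IsOpen {x | ∃ x', r x' a ∧ dist x x' < δ} := fun a => by
    have : {x | ∃ x', r x' a ∧ dist x x' < δ} = ⋃ x' ∈ {x' | r x' a}, ball x' δ := by
      ext x; simp
    rw [this]
    exact isOpen_biUnion fun _ _ => isOpen_ball
  have hex : ∀ a, ∃ f : C(X, ℝ), (∀ x y, r x y → f x = f y) ∧ f a = 1 ∧ (∀ x, 0 ≤ f x) ∧
      ∀ x, f x ≠ 0 → ∃ x', r x' a ∧ dist x x' < δ := by
    intro a
    obtain ⟨f, h1, h2, h3, h4⟩ := exists_monotone_continuous hr heq.refl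
      (fun x y z => heq.trans) (c := {x | r x a}) (hr.preimage (f := fun z => (z, a)) (by fun_prop))
      (isOpen_lower_interior hr (hopen a)) (fun x y hxy hy z hzx => hy z (heq.trans hzx hxy))
      (fun x hx y hyx => ⟨y, heq.trans hyx hx, by simpa using hδ⟩)
    refine ⟨1 - f, fun x y h => ?_, ?_, fun x => ?_, fun x hx => ?_⟩
    · simp [le_antisymm (h1 _ _ h) (h1 _ _ (heq.symm h))]
    · simp [h2 a (heq.refl a)]
    · simpa using (h4 x).2
    · by_contra hcon
      have hx1 : x ∉ {x | ∀ y, r y x → y ∈ {x | ∃ x', r x' a ∧ dist x x' < δ}} :=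
        fun h => hcon (h x (heq.refl x))
      exact hx (by simp [h3 x hx1])
  choose f hinv hone hpos hsupp using hex
  obtain ⟨T, hT⟩ := isCompact_univ.elim_nhds_subcover (fun a => {x | 0 < f a x}) (fun a _ =>
    (isOpen_lt continuous_const (f a).continuous).mem_nhds (by simp [hone]))
  have hTpos : ∀ x, 0 < ∑ a ∈ T, f a x := fun x => by
    obtain ⟨a, haT, hax⟩ := Set.mem_iUnion₂.1 (hT.2 (Set.mem_univ x))
    exact Finset.sum_pos' (fun a _ => hpos a x) ⟨a, haT, hax⟩
  refine ⟨⟨fun x => T.centerMass (fun a => f a x) (fun a => v a), ?_⟩, fun x y h => ?_, fun x => ?_⟩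
  · unfold Finset.centerMass
    exact Continuous.smul (Continuous.inv₀ (by fun_prop) fun x => (hTpos x).ne') (by fun_prop)
  · simp only [ContinuousMap.coe_mk]
    congr 1
    funext a
    exact hinv a x y h
  · simp only [ContinuousMap.coe_mk]
    rw [← Finset.centerMass_filter_ne_zero]
    refine Finset.centerMass_mem_convexHull _ (fun a _ => hpos a x) ?_ fun a ha => ?_
    · rw [Finset.sum_filter_ne_zero]
      exact hTpos x
    · exact ⟨a, hsupp a x (Finset.mem_filter.1 ha).2, rfl⟩

/-- If countably many open sets are dense in products `A × B i`, then for a dense set of `a : A`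
all their slices at `a` are dense. -/
lemma dense_setOf_forall_dense_slice {A ι : Type*} [TopologicalSpace A] [BaireSpace A]
    [Countable ι] {B : ι → Type*} [∀ i, TopologicalSpace (B i)]
    [∀ i, SecondCountableTopology (B i)] {W : ∀ i, Set (A × B i)} (ho : ∀ i, IsOpen (W i))
    (hd : ∀ i, Dense (W i)) : Dense {a | ∀ i, Dense {b | (a, b) ∈ W i}} := by
  have key : ∀ i, ∀ O ∈ TopologicalSpace.countableBasis (B i),
      IsOpen (Prod.fst '' (W i ∩ Prod.snd ⁻¹' O)) ∧ Dense (Prod.fst '' (W i ∩ Prod.snd ⁻¹' O)) := by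
    intro i O hO
    have hOo := TopologicalSpace.isOpen_of_mem_countableBasis hO
    refine ⟨isOpenMap_fst _ ((ho i).inter (hOo.preimage continuous_snd)), ?_⟩
    rw [dense_iff_inter_open]
    rintro U hU ⟨a, ha⟩
    obtain ⟨b, hb⟩ := TopologicalSpace.nonempty_of_mem_countableBasis hO
    obtain ⟨p, hp, hpW⟩ := (hd i).inter_open_nonempty _ (hU.prod hOo) ⟨(a, b), ha, hb⟩
    exact ⟨p.1, hp.1, p, ⟨hpW, hp.2⟩, rfl⟩
  have : Dense (⋂ i, ⋂ O : TopologicalSpace.countableBasis (B i),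
      Prod.fst '' (W i ∩ Prod.snd ⁻¹' (O : Set (B i)))) := by
    have hcount : ∀ i, Countable (TopologicalSpace.countableBasis (B i)) := fun i =>
      (TopologicalSpace.countable_countableBasis (B i)).to_subtype
    have h := dense_iInter_of_isOpen (ι := Σ i, TopologicalSpace.countableBasis (B i))
      (f := fun k => Prod.fst '' (W k.1 ∩ Prod.snd ⁻¹' (k.2 : Set (B k.1))))
      (fun k => (key _ _ k.2.2).1) (fun k => (key _ _ k.2.2).2)
    rwa [Set.iInter_sigma] at h
  refine this.mono fun a ha i => ?_
  rw [(TopologicalSpace.isBasis_countableBasis (B i)).dense_iff]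
  intro O hO _
  obtain ⟨p, ⟨hpW, hpO⟩, rfl⟩ := Set.mem_iInter.1 (Set.mem_iInter.1 ha i) ⟨O, hO⟩
  exact ⟨p.2, hpO, hpW⟩

lemma isOpen_setOf_forall_mem_of_eventually {V D : Type*} [TopologicalSpace V]
    [TopologicalSpace D] {K : Set D} (hK : IsCompact K) {p : V → D → Prop}
    (hp : ∀ v, ∀ t ∈ K, p v t → ∀ᶠ q : V × D in 𝓝 (v, t), p q.1 q.2) :
    IsOpen {v | ∀ t ∈ K, p v t} :=
  isOpen_iff_eventually.2 fun v hv => hK.eventually_forall_of_forall_eventually fun t ht =>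
    hp v t ht (hv t ht)

section Perturbation

variable {X : Type} [MetricSpace X]

/-- Families of antisymmetric functions that are continuous off the diagonal. -/
structure OddOffDiag {r : ℕ} (φ : Fin r → X → X → ℝ) : Prop where
  cont : ∀ i x y, x ≠ y → ContinuousAt (fun p : X × X => φ i p.1 p.2) (x, y)
  anti : ∀ i x y, φ i y x = -φ i x y

variable [CompactSpace X]

lemma isOpen_goodFamilies {A Q S B C : Type} [TopologicalSpace A] [Fintype Q] [Fintype B]
    {Rel : X → X → Prop} (hRel : IsClosed {p : X × X | Rel p.1 p.2}) {r : ℕ}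
    {φ : A → Fin r → X → X → ℝ} (hφ : ∀ i a x y, x ≠ y →
      ContinuousAt (fun p : A × X × X => φ p.1 i p.2.1 p.2.2) (a, x, y)) {e f : S → Q}
    (hef : ∀ s, e s ≠ f s) (L : C → B × Q × Q → ℤ) {ε : ℝ} (hε : 0 < ε) :
    IsOpen {p : A × (B → C(X × X, ℝ)) | p.2 ∈ goodFamilies Rel (φ p.1) e f L ε} := by
  refine isOpen_setOf_forall_mem_of_eventually (isCompact_separatedTuples hRel ε) ?_
  rintro ⟨a, F⟩ y hy h
  by_cases hc : ∃ c, evalRow L F y c ≠ 0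
  · obtain ⟨c, hc⟩ := hc
    have hcont : Continuous fun q : (A × (B → C(X × X, ℝ))) × (Q → X) =>
        evalRow L q.1.2 q.2 c :=
      (continuous_evalRow L c).comp (by fun_prop : Continuous
        fun q : (A × (B → C(X × X, ℝ))) × (Q → X) => (q.1.2, q.2))
    filter_upwards [hcont.continuousAt.eventually_ne hc] with q hq _
    exact ⟨c, hq⟩
  · have h' : ¬ ∀ s i, φ a i (y (e s)) (y (f s)) = 0 := fun h0 => hc (h h0)
    push Not at h'
    obtain ⟨s, i, hsi⟩ := h'
    have hne : y (e s) ≠ y (f s) := fun h0 => by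
      have := hy.1 _ _ (hef s)
      rw [h0, dist_self] at this
      linarith
    have hcont : Continuous fun q : (A × (B → C(X × X, ℝ))) × (Q → X) =>
        (q.1.1, q.2 (e s), q.2 (f s)) := by fun_prop
    have h1 : ContinuousAt (fun q : (A × (B → C(X × X, ℝ))) × (Q → X) =>
        φ q.1.1 i (q.2 (e s)) (q.2 (f s))) ((a, F), y) :=
      ContinuousAt.comp (g := fun p : A × X × X => φ p.1 i p.2.1 p.2.2)
        (f := fun q : (A × (B → C(X × X, ℝ))) × (Q → X) => (q.1.1, q.2 (e s), q.2 (f s)))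
        (hφ i a _ _ hne) hcont.continuousAt
    filter_upwards [h1.eventually_ne hsi] with q hq hq0
    exact absurd (hq0 s i) hq

/-- The matrix `L` enlarged by rows expressing `g i (e s, f s) = g i (f s, e s)` for further
functions `g i`. -/
def edgeRows {Q S B C : Type} [DecidableEq Q] {r : ℕ} (e f : S → Q) (L : C → B × Q × Q → ℤ) :
    C ⊕ (S × Fin r) → (B ⊕ Fin r) × Q × Q → ℤ
  | Sum.inl c, (Sum.inl b, i, j) => L c (b, i, j)
  | Sum.inl _, (Sum.inr _, _, _) => 0
  | Sum.inr _, (Sum.inl _, _, _) => 0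
  | Sum.inr (s, k), (Sum.inr l, i, j) =>
    if k = l then (if i = e s ∧ j = f s then 1 else 0) - (if i = f s ∧ j = e s then 1 else 0) else 0

section edgeRows

variable {Q S B C : Type} [DecidableEq Q] [Fintype Q] [Fintype B] {r : ℕ} (e f : S → Q)
  (L : C → B × Q × Q → ℤ) (m : (B ⊕ Fin r) × Q × Q → ℝ)

lemma sum_edgeRows_inl (c : C) : ∑ k, (edgeRows (r := r) e f L (Sum.inl c) k : ℝ) * m k =
    ∑ k : B × Q × Q, (L c k : ℝ) * m (Sum.inl k.1, k.2) := by
  rw [Fintype.sum_prod_type, Fintype.sum_prod_type, Fintype.sum_sum_type]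
  simp [edgeRows]

lemma sum_edgeRows_inr (s : S) (i : Fin r) :
    ∑ k, (edgeRows (r := r) e f L (Sum.inr (s, i)) k : ℝ) * m k =
      m (Sum.inr i, e s, f s) - m (Sum.inr i, f s, e s) := by
  rw [Fintype.sum_prod_type, Fintype.sum_sum_type]
  simp [edgeRows, Fintype.sum_prod_type, ite_and, sub_mul, Finset.sum_sub_distrib]

variable {e f L} in
lemma fullRank_edgeRows [Fintype S] (hf : Function.Injective f) (hef : ∀ s t, e s ≠ f t)
    (hL : FullRank L) : FullRank (edgeRows (r := r) e f L) := by
  classical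
  intro z
  obtain ⟨m, hm⟩ := hL fun c => z (Sum.inl c)
  refine ⟨fun k => Sum.elim (fun b => m (b, k.2)) (fun i => ∑ s,
    if k.2 = (e s, f s) then z (Sum.inr (s, i)) else 0) k.1, ?_⟩
  rintro (c | ⟨s, i⟩)
  · rw [sum_edgeRows_inl]
    simpa using hm c
  · rw [sum_edgeRows_inr]
    have h1 : ∀ t, (e s, f s) = (e t, f t) ↔ s = t := fun t =>
      ⟨fun h => hf (Prod.ext_iff.1 h).2, fun h => by rw [h]⟩
    have h2 : ∀ t, ¬ (f s, e s) = (e t, f t) := fun t h => hef s t (Prod.ext_iff.1 h).2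
    simp only [Sum.elim_inr, h1, h2]
    simp

end edgeRows
end Perturbation

section StepA

variable {X : Type} [MetricSpace X]

lemma goodFamilies_mono {Q S B C : Type} [Fintype Q] [Fintype B] {Rel Rel' : X → X → Prop}
    (hRel : ∀ x y, Rel' x y → Rel x y) {r : ℕ} (φ : Fin r → X → X → ℝ) (e f : S → Q)
    (L : C → B × Q × Q → ℤ) {ε ε' : ℝ} (hε : ε ≤ ε') :
    goodFamilies Rel φ e f L ε ⊆ goodFamilies Rel' φ e f L ε' :=
  fun _ hF y hy => hF y (separatedTuples_mono hRel hε hy)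

/-- The data of a system of conditions in general position. -/
abbrev ConditionCode : Type :=
  Σ q s b c : ℕ, (Fin s → Fin q) × (Fin s → Fin q) × (Fin c → Fin b × Fin q × Fin q → ℤ)

instance : Countable ConditionCode := by
  unfold ConditionCode
  infer_instance

lemma OddOffDiag.norm_symm {r : ℕ} {φ : Fin r → X → X → ℝ} (h : OddOffDiag φ) (x y : X) :
    ‖fun j => φ j y x‖ = ‖fun j => φ j x y‖ := by
  rw [show (fun j => φ j y x) = -fun j => φ j x y from funext fun j => h.anti j x y, norm_neg]

/-- The perturbation of the last functions of a family `φ` by antisymmetric functions, relative to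
the size of `φ`. -/
noncomputable def perturbTail {r : ℕ} (φ : Fin (r + 1) → X → X → ℝ) (g : Fin r → C(X × X, ℝ)) :
    Fin r → X → X → ℝ :=
  fun i x y => φ i.succ x y + ‖fun j => φ j x y‖ / 4 * (g i (x, y) - g i (y, x))

lemma dense_setOf_mem_goodFamilies_perturbTail {Q S B C : Type} [Fintype Q] [Fintype S]
    [Fintype B] [Fintype C] {n J r : ℕ} {Rel : X → X → Prop}
    (hRel : IsClosed {p : X × X | Rel p.1 p.2}) {φ : Fin (r + 1) → X → X → ℝ} (h : OddOffDiag φ)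
    (hne : ∀ x y, x ≠ y → Rel x y → ∃ i, φ i x y ≠ 0) {φ₀ : Fin 0 → X → X → ℝ}
    (hgen : Generic n Rel J φ₀) {e f : S → Q} {L : C → B × Q × Q → ℤ}
    (hf : Function.Injective f) (hef : ∀ s t, e s ≠ f t) (hL : FullRank L)
    (hcount : Fintype.card Q * n + J <
      J * Fintype.card Q + Fintype.card S * r + Fintype.card C) {ε : ℝ} (hε : 0 < ε) :
    Dense {p : (Fin r → C(X × X, ℝ)) × (B → C(X × X, ℝ)) |
      p.2 ∈ goodFamilies Rel (perturbTail φ p.1) e f L ε} := by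
  classical
  let K : Set (X × X) := {p | Rel p.1 p.2 ∧ ε ≤ dist p.1 p.2}
  have hK : IsClosed K := hRel.inter (isClosed_le continuous_const continuous_dist)
  have hKne : ∀ p ∈ K, p.1 ≠ p.2 := fun p hp h0 => by
    have := hp.2
    rw [h0, dist_self] at this
    linarith
  have hKpos : ∀ p ∈ K, 0 < ‖fun j => φ j p.1 p.2‖ := fun p hp => by
    obtain ⟨i, hi⟩ := hne _ _ (hKne p hp) hp.1
    exact norm_pos_iff.2 fun h => hi (congrFun h i)
  have hA : ∀ i : Fin r, ∃ A : C(X × X, ℝ), ∀ p ∈ K,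
      A p = φ i.succ p.1 p.2 / (‖fun j => φ j p.1 p.2‖ / 2) := by
    intro i
    have hc : ∀ j, ContinuousOn (fun p : X × X => φ j p.1 p.2) K := fun j p hp =>
      (h.cont j p.1 p.2 (hKne p hp)).continuousWithinAt
    have hcn : ContinuousOn (fun p : X × X => ‖fun j => φ j p.1 p.2‖) K :=
      (continuousOn_pi.2 hc).norm
    have hco : ContinuousOn (fun p : X × X =>
        φ i.succ p.1 p.2 / (‖fun j => φ j p.1 p.2‖ / 2)) K :=
      (hc i.succ).div (hcn.div_const 2) fun p hp => (half_pos (hKpos p hp)).ne'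
    obtain ⟨A, hA⟩ := ContinuousMap.exists_restrict_eq hK ⟨_, hco.domRestrict⟩
    exact ⟨A, fun p hp => congrFun (congrArg DFunLike.coe hA) ⟨p, hp⟩⟩
  choose A hA using hA
  let T : (B ⊕ Fin r → C(X × X, ℝ)) → (Fin r → C(X × X, ℝ)) × (B → C(X × X, ℝ)) :=
    fun G => (fun i => G (Sum.inr i) - A i, fun b => G (Sum.inl b))
  have hT : Continuous T := by fun_prop
  have hTs : Function.Surjective T := fun p =>
    ⟨Sum.elim p.2 fun i => p.1 i + A i, Prod.ext (funext fun i => by simp [T]) rfl⟩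
  have hd : Dense (goodFamilies Rel φ₀ (Fin.elim0 : Fin 0 → Q) Fin.elim0
      (edgeRows (r := r) e f L) ε) := by
    refine hgen.dense (fun s => s.elim0) (fun s => s.elim0) (fullRank_edgeRows hf hef hL) ?_ hε
    simp only [Fintype.card_sum, Fintype.card_prod, Fintype.card_fin]
    omega
  refine (hTs.denseRange.dense_image hT hd).mono ?_
  rintro _ ⟨G, hG, rfl⟩ y hy hφ
  obtain ⟨c, hc⟩ := hG y hy fun s => s.elim0
  rcases c with c | ⟨s, i⟩
  · refine ⟨c, ?_⟩
    have := sum_edgeRows_inl (r := r) e f L (fun k => G k.1 (y k.2.1, y k.2.2)) c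
    rw [evalRow, this] at hc
    exact hc
  · refine absurd ?_ hc
    have h1 := sum_edgeRows_inr (r := r) e f L (fun k => G k.1 (y k.2.1, y k.2.2)) s i
    rw [evalRow, h1]
    have hk1 : (y (e s), y (f s)) ∈ K := ⟨hy.2 _ _, hy.1 _ _ (hef s s)⟩
    have hk2 : (y (f s), y (e s)) ∈ K := ⟨hy.2 _ _, hy.1 _ _ (hef s s).symm⟩
    have h2 := hφ s i
    have hpos := hKpos _ hk1
    simp only [perturbTail, T, ContinuousMap.sub_apply, hA i _ hk1, hA i _ hk2,
      h.norm_symm (y (e s)) (y (f s)), h.anti i.succ (y (e s)) (y (f s))] at h2 hpos ⊢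
    set N := ‖fun j => φ j (y (e s)) (y (f s))‖
    field_simp at h2
    have h3 : N * (G (Sum.inr i) (y (e s), y (f s)) - G (Sum.inr i) (y (f s), y (e s))) = 0 := by
      linarith
    exact (mul_eq_zero.1 h3).resolve_left hpos.ne'

variable [CompactSpace X]


lemma continuousAt_perturbTail {r : ℕ} {φ : Fin (r + 1) → X → X → ℝ} (h : OddOffDiag φ)
    (i : Fin r) (g : Fin r → C(X × X, ℝ)) {x y : X} (hxy : x ≠ y) :
    ContinuousAt (fun p : (Fin r → C(X × X, ℝ)) × X × X => perturbTail φ p.1 i p.2.1 p.2.2)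
      (g, x, y) := by
  have h1 : ∀ j, ContinuousAt
      (fun p : (Fin r → C(X × X, ℝ)) × X × X => φ j p.2.1 p.2.2) (g, x, y) := fun j =>
    ContinuousAt.comp (g := fun p : X × X => φ j p.1 p.2)
      (f := fun p : (Fin r → C(X × X, ℝ)) × X × X => p.2) (h.cont j x y hxy)
      continuous_snd.continuousAt
  have h2 : ContinuousAt (fun p : (Fin r → C(X × X, ℝ)) × X × X =>
      ‖fun j => φ j p.2.1 p.2.2‖) (g, x, y) :=
    (continuousAt_pi.2 h1).norm
  have h3 : Continuous fun p : (Fin r → C(X × X, ℝ)) × X × X =>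
      p.1 i (p.2.1, p.2.2) - p.1 i (p.2.2, p.2.1) := by fun_prop
  exact (h1 i.succ).add ((h2.div_const 4).mul h3.continuousAt)

lemma OddOffDiag.perturbTail {r : ℕ} {φ : Fin (r + 1) → X → X → ℝ} (h : OddOffDiag φ)
    (g : Fin r → C(X × X, ℝ)) : OddOffDiag (perturbTail φ g) where
  cont i x y hxy := ContinuousAt.comp
    (g := fun p : (Fin r → C(X × X, ℝ)) × X × X => _root_.perturbTail φ p.1 i p.2.1 p.2.2)
    (f := fun p : X × X => (g, p.1, p.2)) (continuousAt_perturbTail h i g hxy)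
    (by fun_prop : Continuous fun p : X × X => (g, p.1, p.2)).continuousAt
  anti i x y := by
    simp only [_root_.perturbTail]
    rw [h.norm_symm, h.anti]
    ring

lemma abs_sub_le_of_norm_lt {r : ℕ} {g : Fin r → C(X × X, ℝ)} (hg : ‖g‖ < 1) (i : Fin r)
    (p q : X × X) : |g i p - g i q| ≤ 2 := by
  have h1 : ‖g i‖ ≤ 1 := (norm_le_pi_norm g i).trans hg.le
  have h2 := abs_le.1 (((g i).norm_coe_le_norm p).trans h1)
  have h3 := abs_le.1 (((g i).norm_coe_le_norm q).trans h1)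
  exact abs_le.2 ⟨by linarith, by linarith⟩

lemma exists_perturbTail_ne_zero {r : ℕ} {φ : Fin (r + 1) → X → X → ℝ}
    {g : Fin r → C(X × X, ℝ)} (hg : ‖g‖ < 1) {x y : X} (hxy : ∃ i, φ i x y ≠ 0)
    (h0 : φ 0 x y = 0) : ∃ i, perturbTail φ g i x y ≠ 0 := by
  by_contra! hall
  obtain ⟨i, hi⟩ := hxy
  have hpos : 0 < ‖fun j => φ j x y‖ := norm_pos_iff.2 fun h => hi (congrFun h i)
  have hle : ‖fun j => φ j x y‖ ≤ ‖fun j => φ j x y‖ / 2 := by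
    refine (pi_norm_le_iff_of_nonneg (by positivity)).2 fun j => ?_
    rcases Fin.eq_zero_or_eq_succ j with rfl | ⟨k, rfl⟩
    · rw [h0, norm_zero]
      positivity
    · have h1 : φ k.succ x y = -(‖fun j => φ j x y‖ / 4 * (g k (x, y) - g k (y, x))) :=
        eq_neg_of_add_eq_zero_left (hall k)
      rw [h1, norm_neg, norm_mul, Real.norm_eq_abs, Real.norm_eq_abs, abs_of_pos (by positivity)]
      have := mul_le_mul_of_nonneg_left (abs_sub_le_of_norm_lt hg k (x, y) (y, x))
        (by positivity : 0 ≤ ‖fun j => φ j x y‖ / 4)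
      linarith
  linarith

/-- A nonvanishing family can be perturbed so that all but its first member are in general
position. -/
lemma exists_generic_tail {n J r : ℕ} {Rel : X → X → Prop}
    (hRel : IsClosed {p : X × X | Rel p.1 p.2}) {φ : Fin (r + 1) → X → X → ℝ} (h : OddOffDiag φ)
    (hne : ∀ x y, x ≠ y → Rel x y → ∃ i, φ i x y ≠ 0) {φ₀ : Fin 0 → X → X → ℝ}
    (hgen : Generic n Rel J φ₀) : ∃ φ' : Fin r → X → X → ℝ, OddOffDiag φ' ∧
      (∀ x y, x ≠ y → Rel x y → φ 0 x y = 0 → ∃ i, φ' i x y ≠ 0) ∧ Generic n Rel J φ' := by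
  let ι := {k : ConditionCode × ℕ // Function.Injective k.1.2.2.2.2.2.1 ∧
    (∀ s t, k.1.2.2.2.2.1 s ≠ k.1.2.2.2.2.2.1 t) ∧ FullRank k.1.2.2.2.2.2.2 ∧
    k.1.1 * n + J < J * k.1.1 + k.1.2.1 * r + k.1.2.2.2.1}
  have : TopologicalSpace.IsCompletelyPseudoMetrizableSpace C(X × X, ℝ) :=
    PseudoMetricSpace.toIsCompletelPseudoMetrizableSpace
  have hd := dense_setOf_forall_dense_slice (A := Fin r → C(X × X, ℝ)) (ι := ι)
    (B := fun k => Fin k.1.1.2.2.1 → C(X × X, ℝ))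
    (W := fun k => {p | p.2 ∈ goodFamilies Rel (perturbTail φ p.1) k.1.1.2.2.2.2.1
      k.1.1.2.2.2.2.2.1 k.1.1.2.2.2.2.2.2 (1 / ((k.1.2 : ℝ) + 1))})
    (fun k => isOpen_goodFamilies (φ := perturbTail φ) hRel
      (fun i a x y hxy => continuousAt_perturbTail h i a hxy) (fun s => k.2.2.1 s s) _
      Nat.one_div_pos_of_nat)
    (fun k => dense_setOf_mem_goodFamilies_perturbTail hRel h hne hgen k.2.1 k.2.2.1 k.2.2.2.1
      (by simpa using k.2.2.2.2) Nat.one_div_pos_of_nat)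
  obtain ⟨g, hg, hgW⟩ := hd.inter_open_nonempty (ball 0 1) isOpen_ball ⟨0, by simp⟩
  refine ⟨perturbTail φ g, h.perturbTail g, fun x y hxy hr h0 =>
    exists_perturbTail_ne_zero (by simpa using hg) (hne x y hxy hr) h0, ?_⟩
  intro q s b c e f L hf hef hL hcount ε hε
  obtain ⟨N, hN⟩ := exists_nat_one_div_lt hε
  exact (hgW ⟨(⟨q, s, b, c, e, f, L⟩, N), hf, hef, hL, hcount⟩).mono
    (goodFamilies_mono (fun _ _ => id) _ _ _ _ hN.le)

end StepA

section Matching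

variable {X : Type} [MetricSpace X]

/-- A symmetric relation pairing some of the points of `X` with each other, closed up to the
diagonal. -/
structure IsClosedMatching (Z : X → X → Prop) : Prop where
  symm : ∀ x y, Z x y → Z y x
  ne : ∀ x y, Z x y → x ≠ y
  unique : ∀ x y y', Z x y → Z x y' → y = y'
  closed : IsClosed {p : X × X | p.1 = p.2 ∨ Z p.1 p.2}

lemma isClosed_eq_or {ψ : X → X → ℝ}
    (hψ : ∀ x y, x ≠ y → ContinuousAt (fun p : X × X => ψ p.1 p.2) (x, y)) {t : Set ℝ}
    (ht : IsClosed t) : IsClosed {p : X × X | p.1 = p.2 ∨ ψ p.1 p.2 ∈ t} := by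
  rw [← isOpen_compl_iff, isOpen_iff_eventually]
  rintro ⟨x, y⟩ hp
  simp only [Set.mem_compl_iff, Set.mem_ofPred_eq, not_or] at hp ⊢
  have h1 : ∀ᶠ p : X × X in 𝓝 (x, y), p.1 ≠ p.2 :=
    (isClosed_eq continuous_fst continuous_snd).isOpen_compl.eventually_mem hp.1
  filter_upwards [h1, (hψ x y hp.1).eventually (ht.isOpen_compl.eventually_mem hp.2)]
    with p h2 h3 using ⟨h2, h3⟩

namespace IsClosedMatching

variable {Z : X → X → Prop} (hZ : IsClosedMatching Z)
include hZ

lemma equivalence : Equivalence fun x y => x = y ∨ Z x y where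
  refl _ := Or.inl rfl
  symm := by
    rintro x y (rfl | h)
    exacts [Or.inl rfl, Or.inr (hZ.symm _ _ h)]
  trans := by
    rintro x y z (rfl | h) (rfl | h')
    exacts [Or.inl rfl, Or.inr h', Or.inr h, Or.inl (hZ.unique _ _ _ (hZ.symm _ _ h) h')]

variable [CompactSpace X]

lemma exists_lt_of_neg {ψ : X → X → ℝ}
    (hψ : ∀ x y, x ≠ y → ContinuousAt (fun p : X × X => ψ p.1 p.2) (x, y))
    (hanti : ∀ x y, ψ y x = -ψ x y) (hne : ∀ x y, Z x y → ψ x y ≠ 0) :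
    ∃ h : C(X, ℝ), ∀ x y, Z x y → ψ x y < 0 → h x < h y := by
  have hcl : IsClosed {p : X × X | p.1 = p.2 ∨ (Z p.1 p.2 ∧ ψ p.1 p.2 < 0)} := by
    convert hZ.closed.inter (isClosed_eq_or hψ (isClosed_Iic (a := (0 : ℝ)))) using 1
    ext p
    simp only [Set.mem_ofPred_eq, Set.mem_inter_iff, Set.mem_Iic]
    rw [← or_and_left]
    refine or_congr_right (and_congr_right fun h => ?_)
    exact ⟨le_of_lt, fun h' => h'.lt_of_ne (hne _ _ h)⟩
  have hno : ∀ x y z, Z x y → ψ x y < 0 → Z y z → ψ y z < 0 → False := by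
    intro x y z h1 h2 h3 h4
    obtain rfl := hZ.unique _ _ _ (hZ.symm _ _ h1) h3
    have := hanti x y
    linarith
  obtain ⟨h, hh⟩ := exists_strictMono_continuous (X := X)
      (le := fun x y => x = y ∨ (Z x y ∧ ψ x y < 0)) hcl (fun x => Or.inl rfl)
    (by
      rintro x y z (rfl | ⟨h1, h2⟩) (rfl | ⟨h3, h4⟩)
      exacts [Or.inl rfl, Or.inr ⟨h3, h4⟩, Or.inr ⟨h1, h2⟩, (hno _ _ _ h1 h2 h3 h4).elim])
    (by
      rintro x y (rfl | ⟨h1, h2⟩) (h' | ⟨h3, h4⟩)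
      exacts [rfl, rfl, h'.symm, (hno _ _ _ h1 h2 h3 h4).elim])
  exact ⟨h, fun x y h1 h2 => hh x y (Or.inr ⟨h1, h2⟩) (hZ.ne _ _ h1)⟩

lemma exists_ne {ψ : X → X → ℝ}
    (hψ : ∀ x y, x ≠ y → ContinuousAt (fun p : X × X => ψ p.1 p.2) (x, y))
    (hanti : ∀ x y, ψ y x = -ψ x y) (hne : ∀ x y, Z x y → ψ x y ≠ 0) :
    ∃ h : C(X, ℝ), ∀ x y, Z x y → h x ≠ h y := by
  obtain ⟨h, hh⟩ := hZ.exists_lt_of_neg hψ hanti hne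
  refine ⟨h, fun x y hxy => ?_⟩
  rcases (hne x y hxy).lt_or_gt with h1 | h1
  · exact (hh x y hxy h1).ne
  · exact (hh y x (hZ.symm _ _ hxy) (by rw [hanti]; linarith)).ne'

lemma exists_le_abs_sub {h : C(X, ℝ)} (hh : ∀ x y, Z x y → h x ≠ h y) {ε : ℝ} (hε : 0 < ε) :
    ∃ c > 0, ∀ x y, Z x y → ε ≤ dist x y → c ≤ |h x - h y| := by
  let K := {p : X × X | p.1 = p.2 ∨ Z p.1 p.2} ∩ {p | ε ≤ dist p.1 p.2}
  have hK : IsCompact K :=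
    (hZ.closed.inter (isClosed_le continuous_const continuous_dist)).isCompact
  have hKZ : ∀ p ∈ K, Z p.1 p.2 := fun p hp => hp.1.resolve_left fun h0 => by
    have := hp.2
    rw [Set.mem_ofPred_eq, h0, dist_self] at this
    linarith
  rcases K.eq_empty_or_nonempty with h0 | h0
  · exact ⟨1, one_pos, fun x y h1 h2 =>
      (Set.eq_empty_iff_forall_notMem.1 h0 (x, y) ⟨Or.inr h1, h2⟩).elim⟩
  · obtain ⟨p, hp, hmin⟩ := hK.exists_isMinOn h0
      (f := fun p => |h p.1 - h p.2|) (by fun_prop)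
    exact ⟨_, abs_pos.2 (sub_ne_zero.2 (hh _ _ (hKZ p hp))), fun x y h1 h2 =>
      hmin (show (x, y) ∈ K from ⟨Or.inr h1, h2⟩)⟩

/-- The continuous functions taking the same value at matched points. -/
abbrev _root_.InvariantFunctions (Z : X → X → Prop) : Type :=
  {w : C(X, ℝ) // ∀ x y, Z x y → w x = w y}

/-- Continuous functions `v` close to an invariant function can be approximated by invariant
functions, the approximation being pointwise at unmatched points. -/
lemma exists_seq_invariant (v : C(X, ℝ)) (w₀ : InvariantFunctions Z) {η : ℝ}
    (hv : ∀ x, |v x - w₀.1 x| < η) :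
    ∃ w : ℕ → InvariantFunctions Z, (∀ᶠ k in Filter.atTop, ∀ x, |(w k).1 x - w₀.1 x| < 2 * η) ∧
      ∀ y, (∀ z, ¬ Z y z) → ∀ u : ℕ → X, Filter.Tendsto u Filter.atTop (𝓝 y) →
        ∀ N : ℕ → ℕ, Filter.Tendsto N Filter.atTop Filter.atTop →
        Filter.Tendsto (fun k => (w (N k)).1 (u k)) Filter.atTop (𝓝 (v y)) := by
  have hw : ∀ k : ℕ, ∃ w : C(X, ℝ), (∀ x y, x = y ∨ Z x y → w x = w y) ∧
      ∀ x, w x ∈ convexHull ℝ (v '' {s | ∃ x', (x' = s ∨ Z x' s) ∧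
        dist x x' < 1 / ((k : ℝ) + 1)}) := fun k =>
    exists_invariant_continuous hZ.closed hZ.equivalence v Nat.one_div_pos_of_nat
  choose w hw hwc using hw
  refine ⟨fun k => ⟨w k, fun x y h => hw k x y (Or.inr h)⟩, ?_, ?_⟩
  · rcases isEmpty_or_nonempty X with _ | ⟨⟨x₀⟩⟩
    · exact Filter.Eventually.of_forall fun k x => isEmptyElim x
    have hη : 0 < η := (abs_nonneg _).trans_lt (hv x₀)
    obtain ⟨δ, hδ, hu⟩ := Metric.uniformContinuous_iff.1
      (CompactSpace.uniformContinuous_of_continuous w₀.1.continuous) η hη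
    have htend := tendsto_one_div_add_atTop_nhds_zero_nat (𝕜 := ℝ)
    filter_upwards [htend.eventually_lt_const hδ] with k hk x
    have hsub : v '' {s | ∃ x', (x' = s ∨ Z x' s) ∧ dist x x' < 1 / ((k : ℝ) + 1)} ⊆
        ball (w₀.1 x) (2 * η) := by
      rintro _ ⟨s, ⟨x', hx', hd⟩, rfl⟩
      have h1 : w₀.1 x' = w₀.1 s := by
        rcases hx' with rfl | h
        exacts [rfl, w₀.2 _ _ h]
      have h2 := abs_lt.1 (hv s)
      have h3 := hu (hd.trans hk)
      rw [Real.dist_eq, h1] at h3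
      have h4 := abs_lt.1 h3
      rw [mem_ball, Real.dist_eq, abs_lt]
      constructor <;> linarith
    have := convexHull_min hsub (convex_ball _ _) (hwc k x)
    rwa [mem_ball, Real.dist_eq] at this
  · intro y hy u hu N hN
    rw [Metric.tendsto_nhds]
    intro δ hδ
    let U : Set X := {x | ∀ s, s = x ∨ Z s x → v s ∈ ball (v y) δ}
    have hU : IsOpen U := isOpen_lower_interior hZ.closed
      (isOpen_ball.preimage v.continuous)
    have hyU : y ∈ U := by
      rintro s (rfl | h)
      · exact mem_ball_self hδ
      · exact (hy s (hZ.symm _ _ h)).elim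
    obtain ⟨r, hr, hrU⟩ := Metric.isOpen_iff.1 hU y hyU
    have htend := (tendsto_one_div_add_atTop_nhds_zero_nat (𝕜 := ℝ)).comp hN
    filter_upwards [htend.eventually_lt_const (half_pos hr),
      Metric.tendsto_nhds.1 hu _ (half_pos hr)] with k h1 h2
    refine convexHull_min ?_ (convex_ball (v y) δ) (hwc (N k) (u k))
    rintro _ ⟨s, ⟨x', hx', hd⟩, rfl⟩
    have hx'U : x' ∈ U := hrU <| by
      rw [mem_ball]
      have := dist_triangle x' (u k) y
      rw [dist_comm x' (u k)] at this
      simp only [Function.comp] at h1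
      linarith
    exact hx'U s (hx'.imp Eq.symm (hZ.symm _ _))

end IsClosedMatching

end Matching

section LevelRows

variable {Q B C : Type} [DecidableEq Q]

/-- The matrix `L` on an enlarged index set, with further rows expressing that a new function takes
the same value at all points with index outside `S`. -/
def levelRows (S : Set Q) (root : Q) (L : C → B × Q × Q → ℤ) :
    C ⊕ {a // a ∉ S ∧ a ≠ root} → Option B × (Q ⊕ S) × (Q ⊕ S) → ℤ
  | Sum.inl c, (some b, Sum.inl i, Sum.inl j) => L c (b, i, j)
  | Sum.inr a, (none, Sum.inl i, Sum.inl j) =>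
    (if i = a.1 ∧ j = a.1 then 1 else 0) - (if i = root ∧ j = root then 1 else 0)
  | _, _ => 0

variable [Fintype Q] [Fintype B] (S : Set Q) [Fintype S] (root : Q) (L : C → B × Q × Q → ℤ)
  (m : Option B × (Q ⊕ S) × (Q ⊕ S) → ℝ)

lemma sum_levelRows_inl (c : C) : ∑ k, (levelRows S root L (Sum.inl c) k : ℝ) * m k =
    ∑ k : B × Q × Q, (L c k : ℝ) * m (some k.1, Sum.inl k.2.1, Sum.inl k.2.2) := by
  simp [levelRows, Fintype.sum_prod_type, Fintype.sum_option, Fintype.sum_sum_type]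

lemma sum_levelRows_inr (a : {a // a ∉ S ∧ a ≠ root}) :
    ∑ k, (levelRows S root L (Sum.inr a) k : ℝ) * m k =
      m (none, Sum.inl a.1, Sum.inl a.1) - m (none, Sum.inl root, Sum.inl root) := by
  simp [levelRows, Fintype.sum_prod_type, Fintype.sum_option, Fintype.sum_sum_type, ite_and,
    sub_mul, Finset.sum_sub_distrib]

variable {L} in
lemma fullRank_levelRows (hL : FullRank L) : FullRank (levelRows S root L) := by
  classical
  intro z
  obtain ⟨m, hm⟩ := hL fun c => z (Sum.inl c)
  refine ⟨fun k => match k with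
    | (some b, Sum.inl i, Sum.inl j) => m (b, i, j)
    | (none, Sum.inl i, _) => if h : i ∉ S ∧ i ≠ root then z (Sum.inr ⟨i, h⟩) else 0
    | _ => 0, ?_⟩
  rintro (c | a)
  · rw [sum_levelRows_inl]
    exact hm c
  · rw [sum_levelRows_inr]
    simp [a.2.1, a.2.2]

lemma card_levelRows_count [Fintype C] [Fintype {a // a ∉ S ∧ a ≠ root}] {n J r : ℕ}
    (hcount : Fintype.card Q * n + (J + 1) < (J + 1) * Fintype.card Q + Fintype.card C)
    (hJ : n + 1 ≤ J + r) : Fintype.card (Q ⊕ S) * n + J < J * Fintype.card (Q ⊕ S) +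
      Fintype.card S * r + Fintype.card (C ⊕ {a // a ∉ S ∧ a ≠ root}) := by
  have hmul := Nat.mul_le_mul_left (Fintype.card S) hJ
  have hpos : 0 < Fintype.card Q := Fintype.card_pos_iff.2 ⟨root⟩
  have key : Fintype.card Q ≤ Fintype.card {a // a ∉ S ∧ a ≠ root} + 1 + Fintype.card S := by
    have h1 : Fintype.card Q ≤ Fintype.card (({a // a ∉ S ∧ a ≠ root} ⊕ Unit) ⊕ S) := by
      refine Fintype.card_le_of_surjective (fun k => match k with
        | Sum.inl (Sum.inl a) => a.1
        | Sum.inl (Sum.inr _) => root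
        | Sum.inr a => a.1) fun a => ?_
      by_cases ha : a ∈ S
      · exact ⟨Sum.inr ⟨a, ha⟩, rfl⟩
      by_cases har : a = root
      · exact ⟨Sum.inl (Sum.inr ()), har.symm⟩
      · exact ⟨Sum.inl (Sum.inl ⟨a, ha, har⟩), rfl⟩
    simpa using h1
  have key2 : Fintype.card S = Fintype.card Q ∨
      Fintype.card S + 1 ≤ Fintype.card Q := by
    have h2 : Fintype.card S ≤ Fintype.card Q :=
      Fintype.card_le_of_injective _ Subtype.val_injective
    omega
  simp only [Fintype.card_sum]
  rcases key2 with h | h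
  · rw [h] at hmul ⊢
    nlinarith
  · nlinarith

end LevelRows

section Level

variable {X : Type} [MetricSpace X]

lemma exists_pos_le_dist_of_injective {ι : Type*} [Finite ι] {Y : ι → X}
    (hY : Function.Injective Y) : ∃ ε > 0, ∀ i j, i ≠ j → ε ≤ dist (Y i) (Y j) := by
  have h : ∀ᶠ ε in 𝓝[>] (0 : ℝ), ∀ i j, i ≠ j → ε ≤ dist (Y i) (Y j) := by
    refine Filter.eventually_all.2 fun i => Filter.eventually_all.2 fun j => ?_
    by_cases hij : i = j
    · exact Filter.Eventually.of_forall fun ε h => (h hij).elim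
    · filter_upwards [Ioc_mem_nhdsGT (dist_pos.2 (hY.ne hij))] with ε hε _ using hε.2
  obtain ⟨ε, h1, h2⟩ := (h.and self_mem_nhdsWithin).exists
  exact ⟨ε, h2, h1⟩

variable [CompactSpace X]

lemma isOpen_goodFamilies_right {Q S B C : Type} [Fintype Q] [Fintype B]
    {Rel : X → X → Prop} (hRel : IsClosed {p : X × X | Rel p.1 p.2}) {r : ℕ}
    {φ : Fin r → X → X → ℝ} (hφ : OddOffDiag φ) {e f : S → Q}
    (hef : ∀ s, e s ≠ f s) (L : C → B × Q × Q → ℤ) {ε : ℝ} (hε : 0 < ε) :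
    IsOpen (goodFamilies Rel φ e f L ε) := by
  have h := isOpen_goodFamilies (A := Unit) (φ := fun _ => φ) hRel (fun i a x y hxy =>
    ContinuousAt.comp (g := fun p : X × X => φ i p.1 p.2) (f := fun p : Unit × X × X => p.2)
      (hφ.cont i x y hxy) continuous_snd.continuousAt) hef L hε
  exact h.preimage (f := fun F => ((), F)) (by fun_prop)

/-- The points of `X` related by `Rel` and lying on the same level of `u`. -/
def SameLevel (Rel : X → X → Prop) (u : X → ℝ) (x y : X) : Prop := Rel x y ∧ u x = u y

lemma isOpen_goodFamilies_sameLevel {A Q S B C : Type} [TopologicalSpace A] [Fintype Q]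
    [Fintype B] {Rel : X → X → Prop} (hRel : IsClosed {p : X × X | Rel p.1 p.2})
    {u : A → C(X, ℝ)} (hu : Continuous u) (φ₀ : Fin 0 → X → X → ℝ) (e f : S → Q)
    (L : C → B × Q × Q → ℤ) (ε : ℝ) :
    IsOpen {p : A × (B → C(X × X, ℝ)) |
      p.2 ∈ goodFamilies (SameLevel Rel (u p.1)) φ₀ e f L ε} := by
  have : {p : A × (B → C(X × X, ℝ)) | p.2 ∈ goodFamilies (SameLevel Rel (u p.1)) φ₀ e f L ε} =
      {p | ∀ y ∈ separatedTuples Q Rel ε,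
        (∃ i j, u p.1 (y i) ≠ u p.1 (y j)) ∨ ∃ c, evalRow L p.2 y c ≠ 0} := by
    ext p
    refine ⟨fun h y hy => or_iff_not_imp_left.2 fun hne => ?_, fun h y hy _ =>
      (h y ⟨hy.1, fun i j => (hy.2 i j).1⟩).resolve_left ?_⟩
    · push Not at hne
      exact h y ⟨hy.1, fun i j => ⟨hy.2 i j, hne i j⟩⟩ fun s i => i.elim0
    · push Not
      exact fun i j => (hy.2 i j).2
  rw [this]
  refine isOpen_setOf_forall_mem_of_eventually (isCompact_separatedTuples hRel ε) ?_
  rintro ⟨a, F⟩ y - (⟨i, j, hij⟩ | ⟨c, hc⟩)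
  · have h1 : Continuous fun q : (A × (B → C(X × X, ℝ))) × (Q → X) =>
        u q.1.1 (q.2 i) - u q.1.1 (q.2 j) := by fun_prop
    filter_upwards [h1.continuousAt.eventually_ne (sub_ne_zero.2 hij)] with q hq
    exact Or.inl ⟨i, j, sub_ne_zero.1 hq⟩
  · have h1 : Continuous fun q : (A × (B → C(X × X, ℝ))) × (Q → X) =>
        evalRow L q.1.2 q.2 c :=
      (continuous_evalRow L c).comp (by fun_prop : Continuous
        fun q : (A × (B → C(X × X, ℝ))) × (Q → X) => (q.1.2, q.2))
    filter_upwards [h1.continuousAt.eventually_ne hc] with q hq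
    exact Or.inr ⟨c, hq⟩

/-- Simultaneous genericity with respect to all systems obtained from `L` by adjoining partners to
some of the points and requiring a new function to be constant on the remaining ones. -/
lemma dense_iInter_goodFamilies_levelRows {Q B C : Type} [Fintype Q] [DecidableEq Q]
    [Fintype B] [Fintype C] {n J r : ℕ} {Rel : X → X → Prop}
    (hRel : IsClosed {p : X × X | Rel p.1 p.2}) {φ : Fin r → X → X → ℝ} (hφ : OddOffDiag φ)
    (hgen : Generic n Rel J φ) {L : C → B × Q × Q → ℤ} (hL : FullRank L)
    (hcount : Fintype.card Q * n + (J + 1) < (J + 1) * Fintype.card Q + Fintype.card C)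
    (hJ : n + 1 ≤ J + r) [∀ S : Set Q, Fintype S] :
    Dense (⋂ k : Set Q × Q × ℕ, goodFamilies Rel φ (fun s : k.1 => Sum.inl s.1)
      (fun s : k.1 => (Sum.inr s : Q ⊕ k.1)) (levelRows k.1 k.2.1 L) (1 / ((k.2.2 : ℝ) + 1))) := by
  classical
  have : TopologicalSpace.IsCompletelyPseudoMetrizableSpace C(X × X, ℝ) :=
    PseudoMetricSpace.toIsCompletelPseudoMetrizableSpace
  refine dense_iInter_of_isOpen (fun k => isOpen_goodFamilies_right hRel hφ
    (fun s => Sum.inl_ne_inr) _ Nat.one_div_pos_of_nat) fun k => ?_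
  exact hgen.dense Sum.inr_injective (fun s t => Sum.inl_ne_inr)
    (fullRank_levelRows k.1 k.2.1 hL) (card_levelRows_count k.1 k.2.1 hcount hJ)
    Nat.one_div_pos_of_nat

end Level

section LevelDense

variable {X : Type} [MetricSpace X] [CompactSpace X]

lemma dense_setOf_mem_goodFamilies_sameLevel {Q S B C : Type} [Fintype Q] [Fintype B] [Fintype C]
    {n J r : ℕ} {Rel : X → X → Prop} (hRel : IsClosed {p : X × X | Rel p.1 p.2})
    (heq : Equivalence Rel) {φ : Fin r → X → X → ℝ} (hφ : OddOffDiag φ)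
    (hgen : Generic n Rel J φ) {Z : X → X → Prop} (hZ : IsClosedMatching Z)
    (hZr : ∀ x y, Z x y → Rel x y ∧ ∀ i, φ i x y = 0) {h : C(X, ℝ)}
    (hh : ∀ x y, Z x y → h x ≠ h y) {L : C → B × Q × Q → ℤ} (hL : FullRank L)
    (hcount : Fintype.card Q * n + (J + 1) < (J + 1) * Fintype.card Q + Fintype.card C)
    (hJ : n + 1 ≤ J + r) {ε : ℝ} (hε : 0 < ε) (φ₀ : Fin 0 → X → X → ℝ) (e f : S → Q) :
    Dense {p : InvariantFunctions Z × (B → C(X × X, ℝ)) |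
      p.2 ∈ goodFamilies (SameLevel Rel (h + p.1.1)) φ₀ e f L ε} := by
  classical
  rw [Metric.dense_iff]
  rintro ⟨w₀, F₀⟩ η hη
  obtain ⟨c, hc, hcZ⟩ := hZ.exists_le_abs_sub hh hε
  set η₀ := min η c / 8 with hη₀
  have hη₀pos : 0 < η₀ := by positivity
  have hη₀η : 8 * η₀ ≤ η := by rw [hη₀]; linarith [min_le_left η c]
  have hη₀c : 8 * η₀ ≤ c := by rw [hη₀]; linarith [min_le_right η c]
  -- a family in general position
  let G₀ : Option B → C(X × X, ℝ) := fun b =>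
    b.elim ((h + w₀.1).comp ⟨Prod.fst, continuous_fst⟩) F₀
  obtain ⟨G, hGball, hG⟩ := Metric.dense_iff.1
    (dense_iInter_goodFamilies_levelRows hRel hφ hgen hL hcount hJ) G₀ η₀ hη₀pos
  rw [mem_ball] at hGball
  have hGb : ∀ b, dist (G b) (G₀ b) < η₀ := fun b => (dist_le_pi_dist G G₀ b).trans_lt hGball
  let F : B → C(X × X, ℝ) := fun b => G (some b)
  let v : C(X, ℝ) := (G none).comp ⟨fun x => (x, x), by fun_prop⟩ - h
  have hvapp : ∀ x, h x + v x = G none (x, x) := fun x => by simp [v]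
  have hv : ∀ x, |v x - w₀.1 x| < η₀ := fun x => by
    have := (ContinuousMap.dist_apply_le_dist (f := G none) (g := G₀ none) (x, x)).trans_lt
      (hGb none)
    rw [Real.dist_eq] at this
    have e1 : G₀ none (x, x) = h x + w₀.1 x := rfl
    have e2 : v x = G none (x, x) - h x := eq_sub_of_add_eq' (hvapp x)
    rwa [e2, sub_sub, ← e1]
  obtain ⟨w, hwnear, hwlim⟩ := hZ.exists_seq_invariant v w₀ hv
  obtain ⟨K, hK⟩ := Filter.eventually_atTop.1 hwnear
  suffices hs : ∃ k, F ∈ goodFamilies (SameLevel Rel (h + (w (k + K)).1)) φ₀ e f L ε by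
    obtain ⟨k, hk⟩ := hs
    refine ⟨(w (k + K), F), ?_, hk⟩
    rw [mem_ball, Prod.dist_eq, max_lt_iff]
    constructor
    · refine lt_of_le_of_lt ?_ (by linarith : 2 * η₀ < η)
      refine (ContinuousMap.dist_le (by positivity)).2 fun x => ?_
      rw [Real.dist_eq]
      exact (hK _ (Nat.le_add_left K k) x).le
    · refine lt_of_le_of_lt ?_ (by linarith : η₀ < η)
      exact (dist_pi_le_iff hη₀pos.le).2 fun b => (hGb (some b)).le
  by_contra! hbad
  have hbad' : ∀ k, ∃ y ∈ separatedTuples Q Rel ε,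
      (∀ i j, h (y i) + (w (k + K)).1 (y i) = h (y j) + (w (k + K)).1 (y j)) ∧
        ∀ c, evalRow L F y c = 0 := by
    intro k
    have := hbad k
    simp only [goodFamilies, Set.mem_ofPred_eq, not_forall, not_exists, not_not] at this
    obtain ⟨y, hy, -, hrow⟩ := this
    exact ⟨y, ⟨hy.1, fun i j => (hy.2 i j).1⟩, fun i j => (hy.2 i j).2, hrow⟩
  choose u hu hulev hurow using hbad'
  obtain ⟨y, hy, ψ, hψ, hlim⟩ := (isCompact_separatedTuples hRel ε).tendsto_subseq hu
  have hlim' : ∀ a, Filter.Tendsto (fun k => u (ψ k) a) Filter.atTop (𝓝 (y a)) :=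
    fun a => (tendsto_pi_nhds.1 hlim a)
  have hN : Filter.Tendsto (fun k => ψ k + K) Filter.atTop Filter.atTop :=
    (Filter.tendsto_add_atTop_nat K).comp hψ.tendsto_atTop
  have hrow : ∀ c, evalRow L F y c = 0 := fun c => by
    have h1 : Continuous fun z : Q → X => evalRow L F z c :=
      (continuous_evalRow L c).comp (by fun_prop : Continuous fun z : Q → X => (F, z))
    refine tendsto_nhds_unique ((h1.tendsto y).comp hlim) ?_
    simp only [Function.comp_def, hurow]
    exact tendsto_const_nhds
  have hyne : ∀ a b, a ≠ b → y a ≠ y b := fun a b hab h0 => by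
    have := hy.1 a b hab
    rw [h0, dist_self] at this
    linarith
  -- matched points are not in the tuple
  have hnoZ : ∀ a b, ¬ Z (y a) (y b) := by
    intro a b hab
    have hne : a ≠ b := fun h0 => hZ.ne _ _ hab (by rw [h0])
    have h1 := hcZ _ _ hab (hy.1 a b hne)
    have h2 : |h (y a) - h (y b)| ≤ 4 * η₀ + |w₀.1 (y a) - w₀.1 (y b)| := by
      have hl : Filter.Tendsto (fun k => |h (u (ψ k) a) - h (u (ψ k) b)|) Filter.atTop
          (𝓝 |h (y a) - h (y b)|) :=
        (((h.continuous.tendsto _).comp (hlim' a)).sub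
          ((h.continuous.tendsto _).comp (hlim' b))).abs
      have hr : Filter.Tendsto (fun k => 4 * η₀ + |w₀.1 (u (ψ k) a) - w₀.1 (u (ψ k) b)|)
          Filter.atTop (𝓝 (4 * η₀ + |w₀.1 (y a) - w₀.1 (y b)|)) :=
        ((((w₀.1.continuous.tendsto _).comp (hlim' a)).sub
          ((w₀.1.continuous.tendsto _).comp (hlim' b))).abs).const_add _
      refine le_of_tendsto_of_tendsto' hl hr fun k => ?_
      have e1 := hulev (ψ k) a b
      have e2 := abs_lt.1 (hK (ψ k + K) (Nat.le_add_left _ _) (u (ψ k) a))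
      have e3 := abs_lt.1 (hK (ψ k + K) (Nat.le_add_left _ _) (u (ψ k) b))
      have e4 := neg_abs_le (w₀.1 (u (ψ k) a) - w₀.1 (u (ψ k) b))
      have e5 := le_abs_self (w₀.1 (u (ψ k) a) - w₀.1 (u (ψ k) b))
      rw [abs_le]
      constructor <;> linarith
    rw [w₀.2 _ _ hab, sub_self, abs_zero] at h2
    linarith
  let T : Set Q := {a | ∃ z, Z (y a) z}
  have hT : ∀ a : T, ∃ z, Z (y a) z := fun a => a.2
  choose z hz using hT
  have hlev : ∀ a b, a ∉ T → b ∉ T → G none (y a, y a) = G none (y b, y b) := by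
    have key : ∀ a, a ∉ T → Filter.Tendsto
        (fun k => h (u (ψ k) a) + (w (ψ k + K)).1 (u (ψ k) a)) Filter.atTop
        (𝓝 (G none (y a, y a))) := by
      intro a ha
      rw [← hvapp]
      exact ((h.continuous.tendsto _).comp (hlim' a)).add
        (hwlim (y a) (fun z hz => ha ⟨z, hz⟩) _ (hlim' a) _ hN)
    intro a b ha hb
    refine tendsto_nhds_unique (key a ha) ?_
    simp only [fun k => hulev (ψ k) a b]
    exact key b hb
  have hYinj : Function.Injective (Sum.elim y z) := by
    rintro (a | a) (b | b) hab
    · by_contra hne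
      exact hyne a b (fun h0 => hne (by rw [h0])) hab
    · exact (hnoZ b a (by have := hz b; rwa [← show y a = z b from hab] at this)).elim
    · exact (hnoZ a b (by have := hz a; rwa [show z a = y b from hab] at this)).elim
    · have h1 := hZ.symm _ _ (hz a)
      have h2 := hZ.symm _ _ (hz b)
      rw [show z a = z b from hab] at h1
      by_contra hne
      exact hyne a b (fun h0 => hne (by rw [Subtype.ext h0])) (hZ.unique _ _ _ h1 h2)
  obtain ⟨ε', hε', hsep⟩ := exists_pos_le_dist_of_injective hYinj
  obtain ⟨N, hNε⟩ := exists_nat_one_div_lt hε'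
  have hQ : Nonempty Q := by
    by_contra hQ
    rw [not_nonempty_iff] at hQ
    have : Nonempty C := by
      rw [← Fintype.card_pos_iff]
      simp only [Fintype.card_eq_zero] at hcount
      omega
    obtain ⟨c⟩ := this
    obtain ⟨m, hm⟩ := hL fun _ => 1
    simpa using hm c
  obtain ⟨root, hroot⟩ : ∃ root, ∀ a, a ∉ T → root ∉ T := by
    by_cases h0 : ∃ a, a ∉ T
    · exact ⟨h0.choose, fun _ _ => h0.choose_spec⟩
    · exact ⟨Classical.arbitrary Q, fun a ha => (h0 ⟨a, ha⟩).elim⟩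
  have hYRel : ∀ i, ∀ j, Rel (Sum.elim y z i) (Sum.elim y z j) := by
    have h1 : ∀ i a, Rel (y a) (Sum.elim y z i) := by
      rintro (b | b) a
      · exact hy.2 a b
      · exact heq.trans (hy.2 a b) (hZr _ _ (hz b)).1
    exact fun i j => heq.trans (heq.symm (h1 i root)) (h1 j root)
  obtain ⟨c, hcne⟩ := Set.mem_iInter.1 hG ⟨T, root, N⟩ (Sum.elim y z)
    ⟨fun i j hij => hNε.le.trans (hsep i j hij), hYRel⟩
    (fun s i => (hZr _ _ (hz s)).2 i)
  refine hcne ?_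
  rcases c with c | a
  · rw [evalRow, sum_levelRows_inl T root L (fun k => G k.1 (Sum.elim y z k.2.1,
      Sum.elim y z k.2.2)) c]
    exact hrow c
  · rw [evalRow, sum_levelRows_inr T root L (fun k => G k.1 (Sum.elim y z k.2.1,
      Sum.elim y z k.2.2)) a]
    exact sub_eq_zero.2 (hlev _ _ a.2.1 (hroot _ a.2.1))

end LevelDense

section Realization

variable {X : Type} [MetricSpace X]

lemma Generic.eq_of_common_zero {n J r : ℕ} {Rel : X → X → Prop} (heq : Equivalence Rel)
    {φ : Fin r → X → X → ℝ} (hgen : Generic n Rel J φ) (hcount : 3 * n < 2 * (J + r)) {x y y' : X}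
    (hxy : x ≠ y) (hxy' : x ≠ y') (h : Rel x y) (h' : Rel x y') (h0 : ∀ i, φ i x y = 0)
    (h0' : ∀ i, φ i x y' = 0) : y = y' := by
  by_contra hne
  have hY : Function.Injective ![x, y, y'] := by
    intro i j
    fin_cases i <;> fin_cases j <;> simp [hxy, hxy', hne, Ne.symm hxy, Ne.symm hxy', Ne.symm hne]
  obtain ⟨ε, hε, hsep⟩ := exists_pos_le_dist_of_injective hY
  have hd := hgen 3 2 0 0 (fun _ => 0) ![1, 2] (fun c => c.elim0)
    (by intro i j; fin_cases i <;> fin_cases j <;> simp) (by intro s t; fin_cases t <;> simp)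
    (fun z => ⟨0, fun c => c.elim0⟩) (by omega) ε hε
  obtain ⟨F, hF⟩ := hd.nonempty
  have hx : ∀ i, Rel x (![x, y, y'] i) := by
    intro i
    fin_cases i
    exacts [heq.refl x, h, h']
  obtain ⟨c, -⟩ := hF ![x, y, y'] ⟨hsep, fun i j => heq.trans (heq.symm (hx i)) (hx j)⟩ (by
    intro s i
    fin_cases s
    exacts [h0 i, h0' i])
  exact c.elim0

lemma isClosedMatching_common_zero {n J r : ℕ} {Rel : X → X → Prop}
    (hRel : IsClosed {p : X × X | Rel p.1 p.2}) (heq : Equivalence Rel)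
    {φ : Fin r → X → X → ℝ} (hφ : OddOffDiag φ) (hgen : Generic n Rel J φ)
    (hcount : 3 * n < 2 * (J + r)) :
    IsClosedMatching fun x y => x ≠ y ∧ Rel x y ∧ ∀ i, φ i x y = 0 where
  symm := fun x y h => ⟨h.1.symm, heq.symm h.2.1, fun i => by rw [hφ.anti, h.2.2 i, neg_zero]⟩
  ne := fun x y h => h.1
  unique := fun x y y' h h' => hgen.eq_of_common_zero heq hcount h.1 h'.1 h.2.1 h'.2.1 h.2.2 h'.2.2
  closed := by
    have h1 : IsClosed {p : X × X | p.1 = p.2 ∨ Rel p.1 p.2} :=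
      (isClosed_eq continuous_fst continuous_snd).union hRel
    convert h1.inter (isClosed_iInter fun i : Fin r =>
      isClosed_eq_or (hφ.cont i) (isClosed_singleton (x := (0 : ℝ)))) using 1
    ext p
    simp only [Set.mem_ofPred_eq, Set.mem_inter_iff, Set.mem_iInter, Set.mem_singleton_iff]
    by_cases hp : p.1 = p.2 <;> simp [hp]

lemma isClosed_sameLevel {Rel : X → X → Prop} (hRel : IsClosed {p : X × X | Rel p.1 p.2})
    (f : C(X, ℝ)) : IsClosed {p : X × X | SameLevel Rel f p.1 p.2} :=
  hRel.inter (isClosed_eq (by fun_prop) (by fun_prop))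

variable [CompactSpace X]

/-- The first of a nonvanishing family of antisymmetric functions can be replaced by the
differences of a continuous function. -/
lemma exists_level_function {n J r : ℕ} {Rel : X → X → Prop}
    (hRel : IsClosed {p : X × X | Rel p.1 p.2}) (heq : Equivalence Rel)
    {φ : Fin (r + 1) → X → X → ℝ} (hφ : OddOffDiag φ)
    (hne : ∀ x y, x ≠ y → Rel x y → ∃ i, φ i x y ≠ 0) {φ₀ : Fin 0 → X → X → ℝ}
    (hgen : Generic n Rel J φ₀) (hcount : 3 * n < 2 * (J + r)) (hJ : n + 1 ≤ J + r) :
    ∃ (f : C(X, ℝ)) (φ' : Fin r → X → X → ℝ), OddOffDiag φ' ∧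
      (∀ x y, x ≠ y → SameLevel Rel f x y → ∃ i, φ' i x y ≠ 0) ∧
      Generic n (SameLevel Rel f) (J + 1) φ₀ := by
  obtain ⟨φ', hφ', hne', hgen'⟩ := exists_generic_tail hRel hφ hne hgen
  set Z : X → X → Prop := fun x y => x ≠ y ∧ Rel x y ∧ ∀ i, φ' i x y = 0 with hZdef
  have hZ : IsClosedMatching Z := isClosedMatching_common_zero hRel heq hφ' hgen' hcount
  obtain ⟨h, hh⟩ := hZ.exists_ne (hφ.cont 0) (hφ.anti 0) (by
    rintro x y ⟨h1, h2, h3⟩ h4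
    obtain ⟨i, hi⟩ := hne' x y h1 h2 h4
    exact hi (h3 i))
  have hcl : IsClosed {w : C(X, ℝ) | ∀ x y, Z x y → w x = w y} := by
    simp only [Set.ofPred_forall]
    refine isClosed_iInter fun x => isClosed_iInter fun y => isClosed_iInter fun _ =>
      isClosed_eq (by fun_prop) (by fun_prop)
  have : CompleteSpace (InvariantFunctions Z) := hcl.completeSpace_coe
  let ι := {k : (Σ q b c : ℕ, Fin c → Fin b × Fin q × Fin q → ℤ) × ℕ //
    FullRank k.1.2.2.2 ∧ k.1.1 * n + (J + 1) < (J + 1) * k.1.1 + k.1.2.2.1}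
  have : TopologicalSpace.IsCompletelyPseudoMetrizableSpace (InvariantFunctions Z) :=
    PseudoMetricSpace.toIsCompletelPseudoMetrizableSpace
  have hd := dense_setOf_forall_dense_slice (A := InvariantFunctions Z) (ι := ι)
    (B := fun k => Fin k.1.1.2.1 → C(X × X, ℝ))
    (W := fun k => {p | p.2 ∈ goodFamilies (SameLevel Rel (h + p.1.1)) φ₀ (Fin.elim0 : Fin 0 → _)
      Fin.elim0 k.1.1.2.2.2 (1 / ((k.1.2 : ℝ) + 1))})
    (fun k => isOpen_goodFamilies_sameLevel hRel (u := fun w : InvariantFunctions Z => h + w.1)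
      (by fun_prop) φ₀ _ _ _ _)
    (fun k => dense_setOf_mem_goodFamilies_sameLevel hRel heq hφ' hgen' hZ (fun x y h => h.2) hh
      k.2.1 (by simpa using k.2.2) hJ Nat.one_div_pos_of_nat φ₀ _ _)
  have : Nonempty (InvariantFunctions Z) := ⟨⟨0, fun _ _ _ => rfl⟩⟩
  obtain ⟨w, hw⟩ := hd.nonempty
  refine ⟨h + w.1, φ', hφ', ?_, ?_⟩
  · rintro x y hxy ⟨h1, h2⟩
    by_contra! h3
    have hz : Z x y := ⟨hxy, h1, h3⟩
    have h4 := w.2 x y hz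
    simp only [ContinuousMap.add_apply, h4, add_left_inj] at h2
    exact hh x y hz h2
  · intro q s b c e f L hf hef hL hcount ε hε
    obtain ⟨N, hN⟩ := exists_nat_one_div_lt hε
    refine (hw ⟨(⟨q, b, c, L⟩, N), hL, by simpa using hcount⟩).mono fun F hF y hy _ => ?_
    exact hF y (separatedTuples_mono (fun _ _ => id) hN.le hy) fun s => s.elim0

lemma SameLevel.equivalence {X : Type} {Rel : X → X → Prop} (heq : Equivalence Rel) (f : X → ℝ) :
    Equivalence (SameLevel Rel f) where
  refl x := ⟨heq.refl x, rfl⟩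
  symm h := ⟨heq.symm h.1, h.2.symm⟩
  trans h h' := ⟨heq.trans h.1 h'.1, h.2.trans h'.2⟩

lemma exists_injective_on_classes {n : ℕ} (r : ℕ) : ∀ (J : ℕ) {Rel : X → X → Prop}
    (_ : IsClosed {p : X × X | Rel p.1 p.2}) (_ : Equivalence Rel)
    {φ : Fin r → X → X → ℝ} (_ : OddOffDiag φ)
    (_ : ∀ x y, x ≠ y → Rel x y → ∃ i, φ i x y ≠ 0) {φ₀ : Fin 0 → X → X → ℝ}
    (_ : Generic n Rel J φ₀) (_ : 3 * n + 2 < 2 * (J + r)) (_ : n + 2 ≤ J + r),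
    ∃ f : Fin r → C(X, ℝ), ∀ x y, x ≠ y → Rel x y → ∃ i, f i x ≠ f i y := by
  induction r with
  | zero =>
    intro J Rel _ _ φ _ hne _ _ _ _
    exact ⟨Fin.elim0, fun x y hxy h => (hne x y hxy h).choose.elim0⟩
  | succ r ih =>
    intro J Rel hRel heq φ hφ hne φ₀ hgen hcount hJ
    obtain ⟨f₀, φ', hφ', hne', hgen'⟩ := exists_level_function hRel heq hφ hne hgen
      (by omega) (by omega)
    obtain ⟨f, hf⟩ := ih (J + 1) (isClosed_sameLevel hRel f₀) (SameLevel.equivalence heq f₀) hφ'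
      hne' hgen' (by omega) (by omega)
    refine ⟨Fin.cons f₀ f, fun x y hxy h => ?_⟩
    by_cases h0 : f₀ x = f₀ y
    · obtain ⟨i, hi⟩ := hf x y hxy ⟨h, h0⟩
      exact ⟨i.succ, by simpa using hi⟩
    · exact ⟨0, h0⟩

/-- A compactum of dimension at most `n` whose deleted product admits a nonvanishing antisymmetric
map to `ℝ ^ m` embeds in `ℝ ^ m`, in the metastable range. -/
theorem exists_injective_of_oddOffDiag {n m : ℕ} (hX : FinDimLE X n) (hm : 3 * n + 2 < 2 * m)
    (hnm : n + 2 ≤ m) {φ : Fin m → X → X → ℝ} (hφ : OddOffDiag φ)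
    (hne : ∀ x y, x ≠ y → ∃ i, φ i x y ≠ 0) :
    ∃ f : X → Fin m → ℝ, Continuous f ∧ Function.Injective f := by
  obtain ⟨f, hf⟩ := exists_injective_on_classes m 0 (Rel := fun _ _ : X => True)
    (by simp) ⟨fun _ => trivial, fun _ => trivial, fun _ _ => trivial⟩ hφ
    (fun x y hxy _ => hne x y hxy) (generic_true hX Fin.elim0) (by omega) (by omega)
  refine ⟨fun x i => f i x, by fun_prop, fun x y hxy => ?_⟩
  by_contra h0
  obtain ⟨i, hi⟩ := hf x y h0 trivial
  exact hi (congrFun hxy i)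

end Realization

/-- The interval has fine partitions of unity by functions that extend smoothly to the line. -/
lemma exists_smooth_finePartition_unitInterval {ε : ℝ} (hε : 0 < ε) :
    ∃ (N : ℕ) (χ : Fin N → ℝ → ℝ), (∀ j, ContDiff ℝ 1 (χ j)) ∧ ∃ ρ : Fin N → C(I, ℝ),
      (∀ j t, ρ j t = χ j t) ∧ IsFinePartition ρ ε := by
  obtain ⟨M, hM⟩ := exists_nat_gt (2 / ε)
  have hM0 : (0 : ℝ) < M := lt_trans (by positivity) hM
  let u : ℕ → ℝ → ℝ := fun j s => Real.smoothTransition (M * s - (j - 1))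
  have hu : ∀ j, ContDiff ℝ 1 (u j) := fun j =>
    Real.smoothTransition.contDiff.comp (by fun_prop)
  have hmono : ∀ j s, u (j + 1) s ≤ u j s := fun j s => by
    refine Real.smoothTransition.monotone ?_
    push_cast
    linarith
  have hχ : ∀ j, ContDiff ℝ 1 (fun s => u j s - u (j + 1) s) := fun j => (hu j).sub (hu _)
  refine ⟨M + 1, fun j s => u j s - u (j + 1) s, fun j => hχ j,
    fun j => ⟨fun t => u j t - u (j + 1) t, (hχ j).continuous.comp continuous_subtype_val⟩,
    fun j t => rfl, fun j t => sub_nonneg.2 (hmono _ _), fun t => ?_, fun j x y hx hy => ?_⟩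
  · have h1 := Finset.sum_range_sub' (fun j => u j (t : ℝ)) (M + 1)
    simp only [ContinuousMap.coe_mk]
    rw [Fin.sum_univ_eq_sum_range (fun j => u j (t : ℝ) - u (j + 1) t), h1]
    have h2 : u 0 t = 1 := Real.smoothTransition.one_of_one_le (by
      have := mul_nonneg hM0.le t.2.1
      push_cast
      linarith)
    have h3 : u (M + 1) t = 0 := Real.smoothTransition.zero_of_nonpos (by
      have := mul_le_mul_of_nonneg_left t.2.2 hM0.le
      push_cast
      linarith)
    rw [h2, h3, sub_zero]
  · have key : ∀ t : I, u j t - u (j + 1) t ≠ 0 → (j : ℝ) - 1 < M * (t : ℝ) ∧ M * (t : ℝ) < j + 1 := by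
      intro t ht
      constructor
      · by_contra! h
        refine ht ?_
        simp only [u]
        rw [Real.smoothTransition.zero_of_nonpos (by linarith),
          Real.smoothTransition.zero_of_nonpos (by push_cast; linarith), sub_zero]
      · by_contra! h
        refine ht ?_
        simp only [u]
        rw [Real.smoothTransition.one_of_one_le (by linarith),
          Real.smoothTransition.one_of_one_le (by push_cast; linarith), sub_self]
    obtain ⟨h1, h2⟩ := key x hx
    obtain ⟨h3, h4⟩ := key y hy
    rw [div_lt_iff₀ hε] at hM
    rw [Subtype.dist_eq, Real.dist_eq, abs_lt]
    constructor <;> nlinarith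

/-- A compact space with an involution `ι` has fine partitions of unity `ρ` for which `ρ` and
`ρ ∘ ι` depend jointly on `N` parameters. -/
def InvFinDimLE {E : Type} [MetricSpace E] (ι : E → E) (N : ℕ) : Prop :=
  ∀ ε > (0 : ℝ), ∃ (Λ : Type) (_ : Fintype Λ) (ρ : Λ → C(E, ℝ)), IsFinePartition ρ ε ∧
    C1Dim (Set.range fun x => ((fun a => ρ a x, fun a => ρ a (ι x)) : (Λ → ℝ) × (Λ → ℝ))) N

section InvFinDimLE

variable {X : Type} [MetricSpace X]

lemma FinDimLE.invFinDimLE_swap {n : ℕ} (hX : FinDimLE X n) :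
    InvFinDimLE (Prod.swap : X × X → X × X) (n + n) := by
  intro ε hε
  obtain ⟨Λ, _, ρ, hρ, hdim⟩ := hX ε hε
  refine ⟨Λ × Λ, inferInstance, tensorFamily ρ ρ, hρ.tensor hρ, ?_⟩
  have h : ContDiff ℝ 1 fun p : (Λ → ℝ) × (Λ → ℝ) =>
      ((fun a : Λ × Λ => p.1 a.1 * p.2 a.2, fun a : Λ × Λ => p.2 a.1 * p.1 a.2) :
        (Λ × Λ → ℝ) × (Λ × Λ → ℝ)) := by fun_prop
  refine ((hdim.prod hdim).image h).mono ?_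
  rintro _ ⟨⟨x, y⟩, rfl⟩
  exact ⟨(_, _), ⟨⟨x, rfl⟩, ⟨y, rfl⟩⟩, rfl⟩

lemma InvFinDimLE.prod_unitInterval {N : ℕ} {ι : X → X} (hX : InvFinDimLE ι N) :
    InvFinDimLE (Prod.map ι symm : X × I → X × I) (N + 1) := by
  intro ε hε
  obtain ⟨Λ, _, ρ, hρ, hdim⟩ := hX ε hε
  obtain ⟨M, χ, hχ, η, hη, hfine⟩ := exists_smooth_finePartition_unitInterval hε
  refine ⟨Λ × Fin M, inferInstance, tensorFamily ρ η, hρ.tensor hfine, ?_⟩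
  have h : ContDiff ℝ 1 fun p : ((Λ → ℝ) × (Λ → ℝ)) × ℝ =>
      ((fun a : Λ × Fin M => p.1.1 a.1 * χ a.2 p.2,
        fun a : Λ × Fin M => p.1.2 a.1 * χ a.2 (1 - p.2)) :
        (Λ × Fin M → ℝ) × (Λ × Fin M → ℝ)) := by fun_prop
  have h1 : C1Dim (Set.univ : Set ℝ) 1 := by simpa using C1Dim.univ (F := ℝ)
  refine ((hdim.prod h1).image h).mono ?_
  rintro _ ⟨⟨x, t⟩, rfl⟩
  exact ⟨(_, (t : ℝ)), ⟨⟨x, rfl⟩, trivial⟩, by simp [tensorFamily, hη]⟩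

end InvFinDimLE

namespace IsFinePartition

variable {X Λ : Type*} [MetricSpace X] [Fintype Λ] {ρ : Λ → C(X, ℝ)} {ε : ℝ}

lemma sum_support_mul_self (h : IsFinePartition ρ ε) (x : X) :
    ∑ a, (Function.support (ρ a)).indicator 1 x * ρ a x = 1 := by
  refine (Finset.sum_congr rfl fun a _ => ?_).trans (h.sum_eq_one x)
  by_cases hx : ρ a x = 0 <;> simp [hx]

lemma sum_support_mul_of_le_dist (h : IsFinePartition ρ ε) {x y : X} (hxy : ε ≤ dist x y) :
    ∑ a, (Function.support (ρ a)).indicator 1 x * ρ a y = 0 := by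
  refine Finset.sum_eq_zero fun a _ => ?_
  by_cases hx : ρ a x = 0
  · simp [hx]
  · by_contra hy
    exact (h.dist_lt a x y hx (right_ne_zero_of_mul hy)).not_ge hxy

end IsFinePartition

section TwoZeros

variable {E : Type} [MetricSpace E] [CompactSpace E] {ι : E → E} {N r : ℕ}

lemma dense_setOf_no_double_zero (hE : InvFinDimLE ι N) (hι : Continuous ι)
    (hN : N + 2 < 2 * r) {ε : ℝ} (hε : 0 < ε) :
    Dense {h : C(E × I, Fin r → ℝ) | ∀ q ∈ {q : E × I × I | ε ≤ dist q.1 (ι q.1) ∧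
      ε ≤ dist q.2.1 q.2.2}, ¬ (h (q.1, q.2.1) - h (ι q.1, symm q.2.1) = 0 ∧
        h (q.1, q.2.2) - h (ι q.1, symm q.2.2) = 0)} := by
  classical
  rw [Metric.dense_iff]
  intro h₀ δ hδ
  obtain ⟨ε₁, hε₁, happ⟩ := exists_approx_of_isFinePartition h₀.continuous (half_pos hδ)
  obtain ⟨Λ, _, ρ, hρ, hdim⟩ := hE (min ε ε₁) (lt_min hε hε₁)
  obtain ⟨M, χ, hχ, η, hη, hfine⟩ :=
    exists_smooth_finePartition_unitInterval (lt_min hε hε₁)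
  obtain ⟨D₀, -, hD₀⟩ := happ (Λ × Fin M) (tensorFamily ρ η)
    ((hρ.tensor hfine).mono (min_le_right _ _))
  let T : (Λ × Fin M → Fin r → ℝ) → C(E × I, Fin r → ℝ) := fun D =>
    ⟨fun z => ∑ a, tensorFamily ρ η a z • D a, by fun_prop⟩
  have hT : Continuous T := by
    refine ContinuousMap.continuous_of_continuous_uncurry _ ?_
    simp only [T, Function.uncurry_def, ContinuousMap.coe_mk]
    fun_prop
  have hTD : dist (T D₀) h₀ < δ := by
    refine lt_of_le_of_lt ?_ (half_lt_self hδ)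
    refine (ContinuousMap.dist_le (half_pos hδ).le).2 fun z => ?_
    rw [dist_eq_norm]
    exact (hD₀ z).le
  let L : ((Λ → ℝ) × (Λ → ℝ)) × ℝ → (Λ × Fin M → Fin r → ℝ) →L[ℝ] (Fin r → ℝ) := fun p =>
    ∑ a : Λ × Fin M, (p.1.1 a.1 * χ a.2 p.2 - p.1.2 a.1 * χ a.2 (1 - p.2)) •
      ContinuousLinearMap.proj (R := ℝ) (φ := fun _ : Λ × Fin M => Fin r → ℝ) a
  have hLapp : ∀ p D, L p D = ∑ a : Λ × Fin M,
      (p.1.1 a.1 * χ a.2 p.2 - p.1.2 a.1 * χ a.2 (1 - p.2)) • D a := by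
    intro p D
    simp [L, sum_apply]
  have hL : ContDiff ℝ 1 L := by
    refine ContDiff.sum fun a _ => ?_
    have h : ContDiff ℝ 1 fun p : ((Λ → ℝ) × (Λ → ℝ)) × ℝ =>
      p.1.1 a.1 * χ a.2 p.2 - p.1.2 a.1 * χ a.2 (1 - p.2) := by fun_prop
    exact h.smul contDiff_const
  let par : E → (Λ → ℝ) × (Λ → ℝ) := fun x => (fun a => ρ a x, fun a => ρ a (ι x))
  have hTL : ∀ D x (t : I), T D (x, t) - T D (ι x, symm t) = L (par x, t) D := by
    intro D x t
    rw [hLapp]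
    simp only [T, par, ContinuousMap.coe_mk, tensorFamily, hη, ← Finset.sum_sub_distrib, ← sub_smul,
      unitInterval.coe_symm_eq]
  let B : ((Λ → ℝ) × (Λ → ℝ)) × ℝ × ℝ → (Λ × Fin M → Fin r → ℝ) →L[ℝ]
      (Fin r → ℝ) × (Fin r → ℝ) := fun p =>
    (ContinuousLinearMap.inl ℝ (Fin r → ℝ) (Fin r → ℝ)).comp (L (p.1, p.2.1)) +
      (ContinuousLinearMap.inr ℝ (Fin r → ℝ) (Fin r → ℝ)).comp (L (p.1, p.2.2))
  have hBapp : ∀ p D, B p D = (L (p.1, p.2.1) D, L (p.1, p.2.2) D) := fun p D => by simp [B]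
  have hB : ContDiff ℝ 1 B := by
    have h1 : ContDiff ℝ 1 fun p : ((Λ → ℝ) × (Λ → ℝ)) × ℝ × ℝ => L (p.1, p.2.1) :=
      hL.comp (g := L) (f := fun p : ((Λ → ℝ) × (Λ → ℝ)) × ℝ × ℝ => (p.1, p.2.1)) (by fun_prop)
    have h2 : ContDiff ℝ 1 fun p : ((Λ → ℝ) × (Λ → ℝ)) × ℝ × ℝ => L (p.1, p.2.2) :=
      hL.comp (g := L) (f := fun p : ((Λ → ℝ) × (Λ → ℝ)) × ℝ × ℝ => (p.1, p.2.2)) (by fun_prop)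
    exact (contDiff_const.clm_comp h1).add (contDiff_const.clm_comp h2)
  set K : Set (E × I × I) := {q | ε ≤ dist q.1 (ι q.1) ∧ ε ≤ dist q.2.1 q.2.2} with hK
  have hKc : IsCompact K := by
    refine IsClosed.isCompact ?_
    have h1 : IsClosed {q : E × I × I | ε ≤ dist q.1 (ι q.1)} :=
      isClosed_le continuous_const (by fun_prop)
    have h2 : IsClosed {q : E × I × I | ε ≤ dist q.2.1 q.2.2} :=
      isClosed_le continuous_const (by fun_prop)
    exact h1.inter h2
  let τ : E × I × I → ((Λ → ℝ) × (Λ → ℝ)) × ℝ × ℝ := fun q => (par q.1, q.2.1, q.2.2)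
  have hτ : Continuous τ := by fun_prop
  have hdimT : C1Dim (τ '' K) (N + 2) := by
    have h2 : C1Dim (Set.univ : Set (ℝ × ℝ)) 2 := by simpa using C1Dim.univ (F := ℝ × ℝ)
    refine (hdim.prod h2).mono ?_
    rintro _ ⟨q, -, rfl⟩
    exact ⟨⟨q.1, rfl⟩, trivial⟩
  have hsurj : ∀ p ∈ τ '' K, Function.Surjective (B p) := by
    rintro _ ⟨⟨x, s, t⟩, ⟨hx, hst⟩, rfl⟩ ⟨z, z'⟩
    have hρ' := hρ.mono (min_le_left ε ε₁)
    have hη' := hfine.mono (min_le_left ε ε₁)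
    have hst' : ε ≤ dist t s := by rwa [dist_comm]
    let D : I → (Fin r → ℝ) → Λ × Fin M → Fin r → ℝ := fun u w a =>
      ((Function.support (ρ a.1)).indicator 1 x * (Function.support (η a.2)).indicator 1 u : ℝ) • w
    have hLD : ∀ (u v : I) w, L (par x, v) (D u w) =
        (∑ a, (Function.support (η a)).indicator 1 u * η a v) • w := by
      intro u v w
      have h1 : ∑ a : Λ × Fin M, ((Function.support (ρ a.1)).indicator 1 x * ρ a.1 x) *
            ((Function.support (η a.2)).indicator 1 u * η a.2 v) =
          ∑ a, (Function.support (η a)).indicator 1 u * η a v := by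
        simp only [Fintype.sum_prod_type]
        rw [← Fintype.sum_mul_sum, hρ'.sum_support_mul_self, one_mul]
      have h2 : ∑ a : Λ × Fin M, ((Function.support (ρ a.1)).indicator 1 x * ρ a.1 (ι x)) *
            ((Function.support (η a.2)).indicator 1 u * η a.2 (symm v)) = 0 := by
        simp only [Fintype.sum_prod_type]
        rw [← Fintype.sum_mul_sum, hρ'.sum_support_mul_of_le_dist hx, zero_mul]
      rw [hLapp, ← h1, ← sub_zero (∑ a : Λ × Fin M, (Function.support (ρ a.1)).indicator 1 x * ρ a.1 x *
        ((Function.support (η a.2)).indicator 1 u * η a.2 v)), ← h2, ← Finset.sum_sub_distrib,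
        Finset.sum_smul]
      refine Finset.sum_congr rfl fun a _ => ?_
      simp only [D, par, smul_smul, hη, unitInterval.coe_symm_eq]
      congr 1
      ring
    refine ⟨D s z + D t z', ?_⟩
    rw [hBapp]
    simp only [τ, map_add, hLD, hη'.sum_support_mul_self, hη'.sum_support_mul_of_le_dist hst,
      hη'.sum_support_mul_of_le_dist hst', one_smul, zero_smul, add_zero, zero_add]
  have hd := dense_setOf_forall_ne_zero hB (hKc.image hτ) hsurj hdimT
    (by simp only [Module.finrank_prod, Module.finrank_fin_fun]; omega)
  obtain ⟨D, hD, hDT⟩ := hd.inter_open_nonempty (T ⁻¹' ball h₀ δ) (isOpen_ball.preimage hT)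
    ⟨D₀, hTD⟩
  refine ⟨T D, hD, fun q hq h0 => hDT _ ⟨q, hq, rfl⟩ ?_⟩
  rw [hTL, hTL] at h0
  rw [hBapp]
  exact Prod.ext h0.1 h0.2

end TwoZeros

/-- Maps defined over a set with an involution `ι`, continuous and odd with respect to the
simultaneous flip of the interval coordinate. -/
structure OddOn {E V : Type*} [TopologicalSpace E] [TopologicalSpace V] [Neg V] (U : Set E)
    (ι : E → E) (φ : E × I → V) : Prop where
  contOn : ContinuousOn φ (U ×ˢ Set.univ)
  odd : ∀ e ∈ U, ∀ t, φ (ι e, symm t) = -φ (e, t)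

section Perturb

variable {E : Type} [MetricSpace E] [CompactSpace E] {ι : E → E} {N r : ℕ}

lemma OddOn.exists_perturbation (hE : InvFinDimLE ι N) (hι : Continuous ι)
    (hιι : Function.Involutive ι) (hN : N + 2 < 2 * r) {δ : E → ℝ} (hδ : Continuous δ)
    (hδι : ∀ e, δ (ι e) = δ e) (hδle : ∀ e, δ e ≤ dist e (ι e)) {φ : E × I → Fin r → ℝ}
    (hφ : OddOn {e | 0 < δ e} ι φ) {ν : E × I → ℝ}
    (hν : ContinuousOn ν ({e | 0 < δ e} ×ˢ Set.univ)) (hνpos : ∀ e, 0 < δ e → ∀ t, 0 < ν (e, t))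
    (hνι : ∀ e, 0 < δ e → ∀ t, ν (ι e, symm t) = ν (e, t)) :
    ∃ ψ : E × I → Fin r → ℝ, OddOn {e | 0 < δ e} ι ψ ∧
      (∀ e, 0 < δ e → ∀ t, ‖ψ (e, t) - φ (e, t)‖ ≤ ν (e, t)) ∧
      ∀ e, 0 < δ e → ∀ s t, ψ (e, s) = 0 → ψ (e, t) = 0 → s = t := by
  have hU : IsOpen ({e | 0 < δ e} ×ˢ (Set.univ : Set I)) :=
    (isOpen_lt continuous_const hδ).prod isOpen_univ
  let ψ : C(E × I, Fin r → ℝ) → E × I → Fin r → ℝ := fun g p =>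
    φ p + (ν p / 2) • (g p - g (ι p.1, symm p.2))
  have hψ : ∀ g p, p ∈ {e | 0 < δ e} ×ˢ (Set.univ : Set I) →
      ContinuousAt (fun x : C(E × I, Fin r → ℝ) × E × I => ψ x.1 x.2) (g, p) := by
    intro g p hp
    have h1 : ContinuousAt (fun x : C(E × I, Fin r → ℝ) × E × I => φ x.2) (g, p) :=
      ContinuousAt.comp (g := φ) (hφ.contOn.continuousAt (hU.mem_nhds hp)) continuousAt_snd
    have h2 : ContinuousAt (fun x : C(E × I, Fin r → ℝ) × E × I => ν x.2) (g, p) :=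
      ContinuousAt.comp (g := ν) (hν.continuousAt (hU.mem_nhds hp)) continuousAt_snd
    have h3 : Continuous (fun x : C(E × I, Fin r → ℝ) × E × I =>
      x.1 x.2 - x.1 (ι x.2.1, symm x.2.2)) := by fun_prop
    exact h1.add ((h2.div_const 2).smul h3.continuousAt)
  let K : ℕ → Set (E × I × I) := fun k =>
    {q | 1 / ((k : ℝ) + 1) ≤ δ q.1 ∧ 1 / ((k : ℝ) + 1) ≤ dist q.2.1 q.2.2}
  let W : ℕ → Set C(E × I, Fin r → ℝ) := fun k => {g | ∀ q ∈ K k,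
    ¬ (ψ g (q.1, q.2.1) = 0 ∧ ψ g (q.1, q.2.2) = 0)}
  have hk : ∀ k : ℕ, (0 : ℝ) < 1 / ((k : ℝ) + 1) := fun k => by positivity
  have hWo : ∀ k, IsOpen (W k) := by
    intro k
    have hK : IsCompact (K k) := by
      refine IsClosed.isCompact ?_
      have h1 : IsClosed {q : E × I × I | 1 / ((k : ℝ) + 1) ≤ δ q.1} :=
        isClosed_le continuous_const (by fun_prop)
      have h2 : IsClosed {q : E × I × I | 1 / ((k : ℝ) + 1) ≤ dist q.2.1 q.2.2} :=
        isClosed_le continuous_const (by fun_prop)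
      exact h1.inter h2
    refine isOpen_setOf_forall_mem_of_eventually hK fun g q hq h => ?_
    have hq1 : 0 < δ q.1 := (hk k).trans_le hq.1
    rcases not_and_or.1 h with h | h
    · have : ContinuousAt (fun x : C(E × I, Fin r → ℝ) × E × I × I => ψ x.1 (x.2.1, x.2.2.1))
          (g, q) := ContinuousAt.comp (g := fun x : C(E × I, Fin r → ℝ) × E × I => ψ x.1 x.2)
          (f := fun x : C(E × I, Fin r → ℝ) × E × I × I => (x.1, (x.2.1, x.2.2.1)))
          (hψ g (q.1, q.2.1) ⟨hq1, trivial⟩) (by fun_prop)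
      filter_upwards [this.eventually_ne h] with x hx h0 using hx h0.1
    · have : ContinuousAt (fun x : C(E × I, Fin r → ℝ) × E × I × I => ψ x.1 (x.2.1, x.2.2.2))
          (g, q) := ContinuousAt.comp (g := fun x : C(E × I, Fin r → ℝ) × E × I => ψ x.1 x.2)
          (f := fun x : C(E × I, Fin r → ℝ) × E × I × I => (x.1, (x.2.1, x.2.2.2)))
          (hψ g (q.1, q.2.2) ⟨hq1, trivial⟩) (by fun_prop)
      filter_upwards [this.eventually_ne h] with x hx h0 using hx h0.2
  have hWd : ∀ k, Dense (W k) := by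
    intro k
    have hS : IsClosed {p : E × I | 1 / ((k : ℝ) + 1) ≤ δ p.1} :=
      isClosed_le continuous_const (by fun_prop)
    have hSU : {p : E × I | 1 / ((k : ℝ) + 1) ≤ δ p.1} ⊆ {e | 0 < δ e} ×ˢ (Set.univ : Set I) :=
      fun p hp => ⟨(hk k).trans_le hp, trivial⟩
    have hA : ContinuousOn (fun p => (ν p)⁻¹ • φ p) {p : E × I | 1 / ((k : ℝ) + 1) ≤ δ p.1} :=
      ((hν.mono hSU).inv₀ fun p hp => (hνpos _ (hSU hp).1 _).ne').smul (hφ.contOn.mono hSU)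
    obtain ⟨B, hB⟩ := ContinuousMap.exists_restrict_eq hS ⟨_, hA.domRestrict⟩
    have hB' : ∀ p : E × I, 1 / ((k : ℝ) + 1) ≤ δ p.1 → B p = (ν p)⁻¹ • φ p := fun p hp =>
      congrFun (congrArg DFunLike.coe hB) ⟨p, hp⟩
    have hkey : ∀ g p, 1 / ((k : ℝ) + 1) ≤ δ p.1 →
        ψ g p = (ν p / 2) • ((g + B) p - (g + B) (ι p.1, symm p.2)) := by
      rintro g ⟨e, t⟩ hp
      have hpos := (hk k).trans_le hp
      have h1 : B (ι e, symm t) = -B (e, t) := by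
        rw [hB' _ hp, hB' _ (by simpa only [hδι] using hp), hνι e hpos, hφ.odd e hpos, smul_neg]
      have h2 : φ (e, t) = (ν (e, t) / 2) • (2 : ℝ) • B (e, t) := by
        rw [hB' _ hp, smul_smul, smul_smul, div_mul_cancel₀ _ two_ne_zero,
          mul_inv_cancel₀ (hνpos e hpos t).ne', one_smul]
      simp only [ψ, ContinuousMap.add_apply, h1]
      rw [h2, ← smul_add]
      congr 1
      module
    have h := dense_setOf_no_double_zero (r := r) hE hι hN (hk k)
    refine ((Homeomorph.subRight B).surjective.denseRange.dense_image
      (Homeomorph.subRight B).continuous h).mono ?_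
    rintro _ ⟨h, hh, rfl⟩ q hq h0
    refine hh q ⟨hq.1.trans (hδle _), hq.2⟩ ?_
    rw [hkey _ _ hq.1, hkey _ _ hq.1] at h0
    have hpos := fun t => (half_pos (hνpos q.1 ((hk k).trans_le hq.1) t)).ne'
    simpa [hpos] using h0
  have := dense_iInter_of_isOpen_nat hWo hWd
  obtain ⟨g, hg1, hg⟩ := this.inter_open_nonempty _ isOpen_ball ⟨0, mem_ball_self one_pos⟩
  rw [mem_ball_zero_iff] at hg1
  refine ⟨ψ g, ⟨fun p hp => ?_, fun e he t => ?_⟩, fun e he t => ?_, fun e he s t hs ht => ?_⟩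
  · exact (ContinuousAt.comp (f := fun p : E × I => (g, p)) (hψ g p hp)
      (by fun_prop)).continuousWithinAt
  · simp only [ψ, hιι e, symm_symm, hφ.odd e he, hνι e he]
    module
  · simp only [ψ, add_sub_cancel_left, norm_smul, Real.norm_eq_abs]
    rw [abs_of_pos (half_pos (hνpos e he t))]
    have h1 := norm_sub_le (g (e, t)) (g (ι e, symm t))
    have h2 := g.norm_coe_le_norm (e, t)
    have h3 := g.norm_coe_le_norm (ι e, symm t)
    have := hνpos e he t
    nlinarith
  · by_contra hst
    obtain ⟨k, hk1⟩ := exists_nat_one_div_lt (lt_min he (dist_pos.2 hst))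
    exact Set.mem_iInter.1 hg k (e, s, t) ⟨(hk1.trans_le (min_le_left _ _)).le,
      (hk1.trans_le (min_le_right _ _)).le⟩ ⟨hs, ht⟩

end Perturb

section Selection

variable {Y : Type*} [TopologicalSpace Y] [NormalSpace Y] {ι : Y → Y} {r : ℕ}

/-- Separate the zeros with `γ > 0` from those with `γ < 0` by an odd function avoiding them. -/
lemma exists_odd_section_ne_zero (hι : Continuous ι) (hιι : Function.Involutive ι)
    {F : Y × I → Fin r → ℝ} {γ : Y × I → ℝ} (hF : Continuous F) (hγ : Continuous γ)
    (hFodd : ∀ e t, F (ι e, symm t) = -F (e, t)) (hγodd : ∀ e t, γ (ι e, symm t) = -γ (e, t))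
    (hFγ : ∀ e t, F (e, t) = 0 → γ (e, t) ≠ 0)
    (huniq : ∀ e s t, F (e, s) = 0 → F (e, t) = 0 → s = t)
    (h1 : ∀ e, F (e, 1) = 0 → 0 < γ (e, 1)) {A : Set Y} (hA : IsClosed A)
    (hAι : ∀ e ∈ A, ι e ∉ A) (hAF : ∀ e ∈ A, ∀ t, F (e, t) ≠ 0) (t₁ : I) :
    ∃ τ : Y → I, Continuous τ ∧ (∀ e, τ (ι e) = symm (τ e)) ∧ (∀ e, F (e, τ e) ≠ 0) ∧
      ∀ e ∈ A, τ e = t₁ := by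
  have hFι : ∀ e t, F (ι e, symm t) = 0 ↔ F (e, t) = 0 := fun e t => by rw [hFodd, neg_eq_zero]
  let P : Set Y := {e | ∃ t, F (e, t) = 0 ∧ 0 ≤ γ (e, t)}
  let Q : Set Y := {e | ∃ t, F (e, t) = 0 ∧ γ (e, t) ≤ 0}
  have hproj : ∀ S : Set (Y × I), IsClosed S → IsClosed {e | ∃ t, (e, t) ∈ S} := by
    intro S hS
    have := isClosedMap_fst_of_compactSpace S hS
    convert this using 1
    ext e
    simp
  have hPc : IsClosed P := hproj {p | F p = 0 ∧ 0 ≤ γ p}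
    ((isClosed_eq hF continuous_const).inter (isClosed_le continuous_const hγ))
  have hQc : IsClosed Q := hproj {p | F p = 0 ∧ γ p ≤ 0}
    ((isClosed_eq hF continuous_const).inter (isClosed_le hγ continuous_const))
  have hιA : IsClosed (ι ⁻¹' A) := hA.preimage hι
  have hPQ : ∀ e ∈ P, e ∉ Q := by
    rintro e ⟨s, hs, hs'⟩ ⟨t, ht, ht'⟩
    obtain rfl := huniq e s t hs ht
    exact hFγ e s hs (le_antisymm ht' hs')
  have hPι : ∀ e ∈ P, ι e ∈ Q := by
    rintro e ⟨s, hs, hs'⟩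
    exact ⟨symm s, (hFι _ _).2 hs, by rw [hγodd]; linarith⟩
  have hQι : ∀ e ∈ Q, ι e ∈ P := by
    rintro e ⟨s, hs, hs'⟩
    exact ⟨symm s, (hFι _ _).2 hs, by rw [hγodd]; linarith⟩
  have hAP : ∀ e ∈ A, e ∉ P ∧ e ∉ Q := fun e he =>
    ⟨fun ⟨t, ht, _⟩ => hAF e he t ht, fun ⟨t, ht, _⟩ => hAF e he t ht⟩
  have hAP' : ∀ e, ι e ∈ A → e ∉ P ∧ e ∉ Q := fun e he =>
    ⟨fun h => (hAP _ he).2 (hPι e h), fun h => (hAP _ he).1 (hQι e h)⟩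
  obtain ⟨f, hf0, hf1, -⟩ := exists_continuous_zero_one_of_isClosed
    ((hPc.union hA).union hιA) hQc (by
      rw [Set.disjoint_left]
      rintro e ((h | h) | h) hQ
      exacts [hPQ e h hQ, (hAP e h).2 hQ, (hAP' e h).2 hQ])
  obtain ⟨g, hg0, hg1, -⟩ := exists_continuous_zero_one_of_isClosed
    ((hPc.union hQc).union hιA) hA (by
      rw [Set.disjoint_left]
      rintro e ((h | h) | h) hA
      exacts [(hAP e hA).1 h, (hAP e hA).2 h, hAι e hA h])
  let c : Y → I := fun e => Set.projIcc 0 1 zero_le_one (f e + t₁ * g e + (1 - t₁) * g (ι e))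
  have hc : Continuous c := by
    have : Continuous fun e => f e + t₁ * g e + (1 - t₁) * g (ι e) := by fun_prop
    exact continuous_projIcc.comp this
  have hcP : ∀ e ∈ P, c e = 0 := by
    intro e he
    have a1 : f e = 0 := hf0 (Or.inl (Or.inl he))
    have a2 : g e = 0 := hg0 (Or.inl (Or.inl he))
    have a3 : g (ι e) = 0 := hg0 (Or.inl (Or.inr (hPι e he)))
    simp [c, a1, a2, a3]
  have hcQ : ∀ e ∈ Q, c e = 1 := by
    intro e he
    have a1 : f e = 1 := hf1 he
    have a2 : g e = 0 := hg0 (Or.inl (Or.inr he))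
    have a3 : g (ι e) = 0 := hg0 (Or.inl (Or.inl (hQι e he)))
    simp [c, a1, a2, a3]
  have hcA : ∀ e ∈ A, c e = t₁ := by
    intro e he
    have a1 : f e = 0 := hf0 (Or.inl (Or.inr he))
    have a2 : g e = 1 := hg1 he
    have a3 : g (ι e) = 0 := hg0 (Or.inr (by simpa [hιι e] using he))
    simp [c, a1, a2, a3]
  have hcA' : ∀ e, ι e ∈ A → c e = symm t₁ := by
    intro e he
    have a1 : f e = 0 := hf0 (Or.inr he)
    have a2 : g e = 0 := hg0 (Or.inr he)
    have a3 : g (ι e) = 1 := hg1 he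
    have h : (1 - t₁ : ℝ) ∈ Set.Icc (0 : ℝ) 1 := (symm t₁).2
    simp only [c, a1, a2, a3, zero_add, mul_zero, mul_one]
    rw [Set.projIcc_of_mem _ h]
    rfl
  let τ : Y → I := fun e => ⟨(c e + (1 - c (ι e))) / 2, by
    have := (c e).2
    have := (c (ι e)).2
    simp only [Set.mem_Icc] at *
    constructor <;> linarith⟩
  have hτP : ∀ e ∈ P, τ e = 0 := fun e he => Subtype.ext (by
    simp [τ, hcP e he, hcQ _ (hPι e he)])
  have hτQ : ∀ e ∈ Q, τ e = 1 := fun e he => Subtype.ext (by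
    simp [τ, hcQ e he, hcP _ (hQι e he)])
  refine ⟨τ, by fun_prop, fun e => Subtype.ext ?_, fun e h0 => ?_, fun e he => Subtype.ext ?_⟩
  · simp only [τ, hιι e, unitInterval.coe_symm_eq]
    ring
  · rcases le_total 0 (γ (e, τ e)) with h | h
    · have hP := hτP e ⟨τ e, h0, h⟩
      rw [hP] at h0 h
      have := h1 (ι e) (by rwa [← symm_zero, hFι])
      rw [← symm_zero, hγodd] at this
      linarith
    · have hQ := hτQ e ⟨τ e, h0, h⟩
      rw [hQ] at h0 h
      exact (h1 e h0).not_ge h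
  · have := hcA' (ι e) (by rwa [hιι e])
    simp only [τ, hcA e he, this, unitInterval.coe_symm_eq]
    ring

end Selection

section Reduction

variable {E : Type} [MetricSpace E] [CompactSpace E] {ι : E → E} {N r : ℕ}

/-- Eliminate the interval coordinate together with one function `γ` of a nowhere vanishing odd
family. -/
lemma OddOn.exists_reduction (hE : InvFinDimLE ι N) (hι : Continuous ι)
    (hιι : Function.Involutive ι) (hN : N + 2 < 2 * r) {δ : E → ℝ} (hδ : Continuous δ)
    (hδι : ∀ e, δ (ι e) = δ e) (hδle : ∀ e, δ e ≤ dist e (ι e)) {φ : E × I → Fin r → ℝ}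
    (hφ : OddOn {e | 0 < δ e} ι φ) {γ : E × I → ℝ} (hγ : OddOn {e | 0 < δ e} ι γ)
    (hne : ∀ e, 0 < δ e → ∀ t, φ (e, t) = 0 → γ (e, t) ≠ 0)
    (hγ1 : ∀ e, 0 < δ e → 0 ≤ γ (e, 1)) {A : Set E} (hA : IsClosed A) (hAι : ∀ e ∈ A, ι e ∉ A)
    (hAγ : ∀ e ∈ A, ∀ t, γ (e, t) = 0) (t₁ : I) :
    ∃ Φ : E → Fin r → ℝ, ContinuousOn Φ {e | 0 < δ e} ∧ (∀ e, 0 < δ e → Φ (ι e) = -Φ e) ∧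
      (∀ e, 0 < δ e → Φ e ≠ 0) ∧
      ∀ e ∈ A, 0 < δ e → ‖Φ e - φ (e, t₁)‖ ≤ ‖φ (e, t₁)‖ / 2 := by
  obtain ⟨F, hF, hFφ, huniq⟩ := hφ.exists_perturbation hE hι hιι hN hδ hδι hδle
    (ν := fun p => max ‖φ p‖ ‖γ p‖ / 2) ((hφ.contOn.norm.sup hγ.contOn.norm).div_const 2)
    (fun e he t => by
      refine half_pos (lt_max_iff.2 ?_)
      rw [norm_pos_iff, norm_pos_iff]
      exact or_iff_not_imp_left.2 fun h => hne e he t (not_not.1 h))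
    (fun e he t => by simp only [hφ.odd e he, hγ.odd e he, norm_neg])
  have hFne : ∀ e, 0 < δ e → ∀ t, γ (e, t) = 0 → F (e, t) ≠ 0 := by
    intro e he t h0 hF0
    have h := hFφ e he t
    rw [hF0, h0, zero_sub, norm_neg, norm_zero, max_eq_left (norm_nonneg _)] at h
    have := norm_pos_iff.2 fun h' => hne e he t h' h0
    linarith
  let κ : {e // 0 < δ e} → {e // 0 < δ e} := fun e => ⟨ι e, by rw [hδι]; exact e.2⟩
  have hj : Continuous fun p : {e // 0 < δ e} × I => ((p.1 : E), p.2) := by fun_prop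
  have hj' : ∀ p : {e // 0 < δ e} × I, ((p.1 : E), p.2) ∈ {e | 0 < δ e} ×ˢ (Set.univ : Set I) :=
    fun p => ⟨p.1.2, trivial⟩
  obtain ⟨τ, hτ, hτι, hτF, hτA⟩ := exists_odd_section_ne_zero (ι := κ)
    (F := fun p => F ((p.1 : E), p.2)) (γ := fun p => γ ((p.1 : E), p.2)) (by fun_prop)
    (fun e => Subtype.ext (hιι e)) (hF.contOn.comp_continuous hj hj')
    (hγ.contOn.comp_continuous hj hj') (fun e t => hF.odd e e.2 t) (fun e t => hγ.odd e e.2 t)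
    (fun e t h0 h => hFne e e.2 t h h0) (fun e s t => huniq e e.2 s t)
    (fun e h0 => (hγ1 e e.2).lt_of_ne fun h => hFne e e.2 1 h.symm h0)
    (hA.preimage continuous_subtype_val) (fun e he => hAι e he)
    (fun e he t => hFne e e.2 t (hAγ e he t)) t₁
  classical
  refine ⟨fun e => if h : 0 < δ e then F (e, τ ⟨e, h⟩) else 0, ?_, fun e he => ?_,
    fun e he => ?_, fun e heA he => ?_⟩
  · rw [continuousOn_iff_continuous_domRestrict]
    have : Continuous fun e : {e // 0 < δ e} => F (e, τ e) :=
      hF.contOn.comp_continuous (f := fun e : {e // 0 < δ e} => ((e : E), τ e)) (by fun_prop)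
        fun e => ⟨e.2, trivial⟩
    refine this.congr fun e => ?_
    simp only [Set.domRestrict_apply, dif_pos (show 0 < δ (e : E) from e.2)]
  · have he' : 0 < δ (ι e) := by rwa [hδι]
    have := hτι ⟨e, he⟩
    simp only [κ] at this
    simp only [dif_pos he, dif_pos he']
    rw [this, hF.odd e he]
  · simp only [dif_pos he]
    exact hτF ⟨e, he⟩
  · have h := hFφ e he t₁
    simp only [dif_pos he]
    rw [hτA ⟨e, he⟩ heA]
    simpa only [hAγ e heA, norm_zero, max_eq_left (norm_nonneg (φ (e, t₁)))] using h

end Reduction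

section DeletedJoin

/-- The coordinates `(2s-1, 2t-1, 0)`, normalised to have median zero. -/
def armVec (s t : I) : Fin 3 → ℝ :=
  let a : ℝ := 2 * s - 1
  let b : ℝ := 2 * t - 1
  let c : ℝ := a + b - max (max a b) 0 - min (min a b) 0
  ![a - c, b - c, -c]

lemma armVec_symm (s t : I) : armVec (symm s) (symm t) = -armVec s t := by
  have h : ∀ a b : ℝ, max (max (-a) (-b)) 0 = -min (min a b) 0 ∧
      min (min (-a) (-b)) 0 = -max (max a b) 0 := fun a b => by
    constructor
    · rw [← max_neg_neg, ← max_neg_neg, neg_zero]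
    · rw [← min_neg_neg, ← min_neg_neg, neg_zero]
  obtain ⟨h1, h2⟩ := h (2 * s - 1) (2 * t - 1)
  have e1 : (2 : ℝ) * (symm s : I) - 1 = -(2 * s - 1) := by rw [coe_symm_eq]; ring
  have e2 : (2 : ℝ) * (symm t : I) - 1 = -(2 * t - 1) := by rw [coe_symm_eq]; ring
  simp only [armVec, e1, e2, h1, h2]
  ext i
  fin_cases i <;> simp <;> ring

lemma exists_of_median_eq_zero {w : Fin 3 → ℝ} {i j k : Fin 3} {M : ℝ} (hij : i ≠ j)
    (hl : ∀ l, l = i ∨ l = j ∨ l = k) (hk : w k = 0) (hi : 0 ≤ w i) (hj : w j ≤ 0)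
    (h : M ≤ w i - w j) : ∃ i j, i ≠ j ∧ (∀ k, k ≠ i → w k ≤ 0) ∧
      (∀ k, k ≠ j → 0 ≤ w k) ∧ M ≤ w i - w j := by
  refine ⟨i, j, hij, fun l hli => ?_, fun l hlj => ?_, h⟩
  · rcases hl l with rfl | rfl | rfl
    exacts [absurd rfl hli, hj, hk.le]
  · rcases hl l with rfl | rfl | rfl
    exacts [hi, absurd rfl hlj, hk.ge]

lemma armVec_spec (s t : I) : ∃ i j, i ≠ j ∧ (∀ k, k ≠ i → armVec s t k ≤ 0) ∧
    (∀ k, k ≠ j → 0 ≤ armVec s t k) ∧ max |2 * (s : ℝ) - 1| |2 * (t : ℝ) - 1| ≤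
      armVec s t i - armVec s t j := by
  have hw : armVec s t = ![_, _, _] := rfl
  rw [hw]
  generalize (2 * (s : ℝ) - 1) = a
  generalize (2 * (t : ℝ) - 1) = b
  have hM : ∀ m : ℝ, a ≤ m → -a ≤ m → b ≤ m → -b ≤ m → max |a| |b| ≤ m := fun m h1 h2 h3 h4 =>
    max_le (abs_le.2 ⟨by linarith, h1⟩) (abs_le.2 ⟨by linarith, h3⟩)
  rcases le_total a b with hab | hab <;> rcases le_total a 0 with ha | ha <;>
    rcases le_total b 0 with hb | hb <;>
    simp only [hab, ha, hb, max_eq_left, max_eq_right, min_eq_left, min_eq_right]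
  · refine exists_of_median_eq_zero (i := 2) (j := 0) (k := 1) (by decide) (by decide) ?_ ?_ ?_
      (hM _ ?_ ?_ ?_ ?_) <;> simp <;> linarith
  · refine exists_of_median_eq_zero (i := 1) (j := 0) (k := 2) (by decide) (by decide) ?_ ?_ ?_
      (hM _ ?_ ?_ ?_ ?_) <;> simp <;> linarith
  · refine exists_of_median_eq_zero (i := 1) (j := 2) (k := 0) (by decide) (by decide) ?_ ?_ ?_
      (hM _ ?_ ?_ ?_ ?_) <;> simp <;> linarith
  · refine exists_of_median_eq_zero (i := 1) (j := 2) (k := 0) (by decide) (by decide) ?_ ?_ ?_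
      (hM _ ?_ ?_ ?_ ?_) <;> simp <;> linarith
  · refine exists_of_median_eq_zero (i := 2) (j := 1) (k := 0) (by decide) (by decide) ?_ ?_ ?_
      (hM _ ?_ ?_ ?_ ?_) <;> simp <;> linarith
  · refine exists_of_median_eq_zero (i := 2) (j := 1) (k := 0) (by decide) (by decide) ?_ ?_ ?_
      (hM _ ?_ ?_ ?_ ?_) <;> simp <;> linarith
  · refine exists_of_median_eq_zero (i := 0) (j := 1) (k := 2) (by decide) (by decide) ?_ ?_ ?_
      (hM _ ?_ ?_ ?_ ?_) <;> simp <;> linarith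
  · refine exists_of_median_eq_zero (i := 0) (j := 2) (k := 1) (by decide) (by decide) ?_ ?_ ?_
      (hM _ ?_ ?_ ?_ ?_) <;> simp <;> linarith

variable {X V : Type*} [NormedAddCommGroup V] [NormedSpace ℝ V]

/-- The value of `f` at the point of the cone over `{1,2,3}` with tip `x` described by a vector
with at most one positive coordinate. -/
noncomputable def armSum (f : X → Fin 3 → I → V) (x : X) (w : Fin 3 → ℝ) : V :=
  ∑ i, f x i (Set.projIcc 0 1 zero_le_one (2 * w i)) - (2 : ℝ) • f x 0 0

lemma armSum_eq {f : X → Fin 3 → I → V} (hf : ∀ x i, f x i 0 = f x 0 0) (x : X)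
    {w : Fin 3 → ℝ} {i : Fin 3} (hw : ∀ k, k ≠ i → w k ≤ 0) :
    armSum f x w = f x i (Set.projIcc 0 1 zero_le_one (2 * w i)) := by
  have h : ∀ k, k ≠ i → f x k (Set.projIcc 0 1 zero_le_one (2 * w k)) = f x 0 0 := by
    intro k hk
    rw [Set.projIcc_of_le_left _ (by linarith [hw k hk])]
    exact hf x k
  rw [armSum, Fin.sum_univ_three]
  fin_cases i
  · rw [h 1 (by decide), h 2 (by decide)]; simp only [Fin.zero_eta]; module
  · rw [h 0 (by decide), h 2 (by decide)]; simp only [Fin.mk_one]; module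
  · rw [h 0 (by decide), h 1 (by decide)]; simp only [Fin.reduceFinMk]; module

/-- The difference of the values of `f` at two points on distinct arms. -/
noncomputable def armDiff (f : X → Fin 3 → I → V) (p : ((X × X) × I) × I) : V :=
  armSum f p.1.1.1 (armVec p.1.2 p.2) - armSum f p.1.1.2 (-armVec p.1.2 p.2)

lemma armDiff_symm (f : X → Fin 3 → I → V) (x y : X) (s t : I) :
    armDiff f (((y, x), symm s), symm t) = -armDiff f (((x, y), s), t) := by
  simp only [armDiff, armVec_symm, neg_neg, neg_sub]

lemma exists_armDiff_eq (s t : I) : ∃ (i j : Fin 3) (a b : I), i ≠ j ∧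
    (1 / 2 ≤ max |2 * (s : ℝ) - 1| |2 * (t : ℝ) - 1| → a ≠ 0 ∨ b ≠ 0) ∧
    (1 ≤ max |2 * (s : ℝ) - 1| |2 * (t : ℝ) - 1| → a = 1 ∨ b = 1) ∧
    ∀ f : X → Fin 3 → I → V, (∀ x i, f x i 0 = f x 0 0) → ∀ x y,
      armDiff f (((x, y), s), t) = f x i a - f y j b := by
  obtain ⟨i, j, hij, hi, hj, h⟩ := armVec_spec s t
  refine ⟨i, j, Set.projIcc 0 1 zero_le_one (2 * armVec s t i),
    Set.projIcc 0 1 zero_le_one (2 * (-armVec s t) j), hij, fun hm => ?_, fun hm => ?_,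
    fun f hf x y => ?_⟩
  · by_contra! h0
    have h1 := congrArg Subtype.val h0.1
    have h2 := congrArg Subtype.val h0.2
    simp only [Set.coe_projIcc, Pi.neg_apply] at h1 h2
    have h3 : 2 * armVec s t i ≤ 0 := by
      by_contra! h'
      exact (lt_max_of_lt_right (lt_min one_pos h')).ne' h1
    have h4 : 2 * -armVec s t j ≤ 0 := by
      by_contra! h'
      exact (lt_max_of_lt_right (lt_min one_pos h')).ne' h2
    linarith
  · have : 1 / 2 ≤ armVec s t i ∨ 1 / 2 ≤ -armVec s t j := by
      by_contra! h'
      linarith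
    refine this.imp (fun h' => ?_) fun h' => ?_
    · rw [Set.projIcc_of_right_le _ (by linarith)]; rfl
    · rw [Set.projIcc_of_right_le _ (by simp only [Pi.neg_apply]; linarith)]; rfl
  · rw [armDiff, armSum_eq hf _ hi, armSum_eq (i := j) (w := -armVec s t) hf _ fun k hk => neg_nonpos.2 (hj k hk)]

lemma armDiff_one (f : X → Fin 3 → I → V) (hf : ∀ x i, f x i 0 = f x 0 0) (x y : X) {t : I}
    (ht : (t : ℝ) = 3 / 4) : armDiff f (((x, y), 1), t) = f x 0 1 - f y 2 1 := by
  have h : armVec 1 t = ![1 / 2, 0, -(1 / 2)] := by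
    have : 2 * (3 / 4 : ℝ) - 1 = 1 / 2 := by norm_num
    ext i
    fin_cases i <;> norm_num [armVec, ht]
  have e1 : Set.projIcc (0 : ℝ) 1 zero_le_one (2 * (armVec 1 t 0)) = 1 := by
    rw [h, Set.projIcc_of_right_le _ (by norm_num)]; rfl
  have e2 : Set.projIcc (0 : ℝ) 1 zero_le_one (2 * ((-armVec 1 t) 2)) = 1 := by
    rw [h, Set.projIcc_of_right_le _ (by simp)]; rfl
  rw [armDiff, armSum_eq (i := 0) hf _ (by intro k hk; fin_cases k <;> simp_all),
    armSum_eq (i := 2) hf _ (by intro k hk; fin_cases k <;> simp_all), e1, e2]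

lemma continuous_armDiff [TopologicalSpace X] {f : X → Fin 3 → I → V}
    (hf : ∀ i, Continuous fun p : X × I => f p.1 i p.2) : Continuous (armDiff f) := by
  have hv : ∀ i, Continuous fun p : ((X × X) × I) × I => armVec p.1.2 p.2 i := by
    intro i
    fin_cases i <;> simp [armVec] <;> fun_prop
  have h1 : ∀ i, Continuous fun p : ((X × X) × I) × I =>
      (Set.projIcc 0 1 zero_le_one (2 * armVec p.1.2 p.2 i) : I) := fun i =>
    continuous_projIcc.comp (continuous_const.mul (hv i))
  have h2 : ∀ i, Continuous fun p : ((X × X) × I) × I =>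
      (Set.projIcc 0 1 zero_le_one (2 * (-armVec p.1.2 p.2) i) : I) := fun i =>
    continuous_projIcc.comp (continuous_const.mul (hv i).neg)
  have hs : ∀ {a : ((X × X) × I) × I → X} {b : ((X × X) × I) × I → I} (i : Fin 3), Continuous a →
      Continuous b → Continuous fun p => f (a p) i (b p) := fun i ha hb =>
    (hf i).comp (ha.prodMk hb)
  unfold armDiff armSum
  refine ((continuous_finsetSum _ fun i _ => hs i (by fun_prop) (h1 i)).sub
    ((hs 0 (by fun_prop) continuous_const).const_smul _)).sub
    ((continuous_finsetSum _ fun i _ => hs i (by fun_prop) (h2 i)).sub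
    ((hs 0 (by fun_prop) continuous_const).const_smul _))

end DeletedJoin

lemma FinDimLE.exists_approx {Z V : Type*} [MetricSpace Z] [CompactSpace Z]
    [NormedAddCommGroup V] [NormedSpace ℝ V] {N : ℕ} (hZ : FinDimLE Z N) {f : Z → V}
    (hf : Continuous f) {δ : ℝ} (hδ : 0 < δ) :
    ∃ g : Z → V, Continuous g ∧ (∀ z, ‖g z - f z‖ < δ) ∧ C1Dim (Set.range g) N := by
  obtain ⟨ε, hε, h⟩ := exists_approx_of_isFinePartition hf hδ
  obtain ⟨Λ, _, ρ, hρ, hdim⟩ := hZ ε hε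
  obtain ⟨D, -, hD⟩ := h Λ ρ hρ
  refine ⟨fun z => ∑ a, ρ a z • D a, by fun_prop, hD, ?_⟩
  have hL : ContDiff ℝ 1 fun v : Λ → ℝ => ∑ a, v a • D a := by fun_prop
  refine (hdim.image hL).mono ?_
  rintro _ ⟨z, rfl⟩
  exact ⟨_, ⟨z, rfl⟩, rfl⟩

/-- The linear projection along `u` onto the coordinates other than `j`. -/
noncomputable def projAlong {r : ℕ} (u : Fin (r + 1) → ℝ) (j : Fin (r + 1))
    (v : Fin (r + 1) → ℝ) (i : Fin r) : ℝ :=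
  v (j.succAbove i) - v j / u j * u (j.succAbove i)

lemma continuous_projAlong {r : ℕ} (u : Fin (r + 1) → ℝ) (j : Fin (r + 1)) :
    Continuous (projAlong u j) := by
  unfold projAlong
  fun_prop

lemma projAlong_neg {r : ℕ} (u : Fin (r + 1) → ℝ) (j : Fin (r + 1)) (v : Fin (r + 1) → ℝ) :
    projAlong u j (-v) = -projAlong u j v := by
  ext i
  simp only [projAlong, Pi.neg_apply]
  ring

lemma eq_smul_of_projAlong_eq_zero {r : ℕ} {u v : Fin (r + 1) → ℝ} {j : Fin (r + 1)}
    (hu : u j ≠ 0) (h : projAlong u j v = 0) : v = (v j / u j) • u := by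
  ext k
  rcases Fin.eq_self_or_eq_succAbove j k with rfl | ⟨i, rfl⟩
  · simp [hu]
  · simpa [projAlong, sub_eq_zero] using congrFun h i

section Reduction

variable {X Z : Type} [MetricSpace X] [CompactSpace X] [MetricSpace Z] [CompactSpace Z]

/-- How far `(s, t)` is from the centre of the square. -/
noncomputable def squareRadius (s t : I) : ℝ := max |2 * (s : ℝ) - 1| |2 * (t : ℝ) - 1|

lemma squareRadius_symm (s t : I) : squareRadius (symm s) (symm t) = squareRadius s t := by
  have e1 : (2 : ℝ) * (symm s : I) - 1 = -(2 * s - 1) := by rw [coe_symm_eq]; ring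
  have e2 : (2 : ℝ) * (symm t : I) - 1 = -(2 * t - 1) := by rw [coe_symm_eq]; ring
  rw [squareRadius, squareRadius, e1, e2, abs_neg, abs_neg]

lemma abs_two_mul_sub_one_le (s : I) : |2 * (s : ℝ) - 1| ≤ 1 :=
  abs_le.2 ⟨by linarith [s.2.1], by linarith [s.2.2]⟩

lemma squareRadius_le_one (s t : I) : squareRadius s t ≤ 1 :=
  max_le (abs_two_mul_sub_one_le s) (abs_two_mul_sub_one_le t)

lemma squareRadius_one_left (t : I) : squareRadius 1 t = 1 :=
  (squareRadius_le_one _ _).antisymm (le_max_of_le_left (by norm_num))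

lemma squareRadius_one_right (s : I) : squareRadius s 1 = 1 :=
  (squareRadius_le_one _ _).antisymm (le_max_of_le_right (by norm_num))

lemma continuous_squareRadius {Y : Type*} [TopologicalSpace Y] {a b : Y → I} (ha : Continuous a)
    (hb : Continuous b) : Continuous fun y => squareRadius (a y) (b y) := by
  unfold squareRadius
  fun_prop

/-- An equivariant family over the square, never zero off the diagonal, and meeting a fixed line
only in the interior of the square. -/
lemma exists_odd_family_of_injective {n m : ℕ} (hZ : FinDimLE Z (n + 1)) (hm : n + 2 ≤ m)
    [Nonempty X] {q : X × Fin 3 × I → Z} (hq : Continuous q)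
    (hq0 : ∀ x i, q (x, i, 0) = q (x, 0, 0)) (hq1 : ∀ x y i, q (x, i, 1) = q (y, i, 1))
    (hqinj : ∀ x y i j a b, i ≠ j → q (x, i, a) = q (y, j, b) → x = y ∧ a = 0 ∧ b = 0)
    {g : Z → Fin (m + 2) → ℝ} (hg : Continuous g) (hginj : Function.Injective g) :
    ∃ (G : ((X × X) × I) × I → Fin (m + 2) → ℝ) (u V : Fin (m + 2) → ℝ), Continuous G ∧
      u ≠ 0 ∧ (∀ x y s t, G (((y, x), symm s), symm t) = -G (((x, y), s), t)) ∧
      (∀ x y s t, x ≠ y → G (((x, y), s), t) ≠ 0) ∧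
      (∀ x y s t (c : ℝ), squareRadius s t = 1 → G (((x, y), s), t) ≠ c • u) ∧
      ∀ x y (t : I), (t : ℝ) = 3 / 4 → G (((x, y), 1), t) = V := by
  obtain ⟨x₀⟩ := ‹Nonempty X›
  let f : X → Fin 3 → I → Fin (m + 2) → ℝ := fun x i t => g (q (x, i, t))
  have hf0 : ∀ x i, f x i 0 = f x 0 0 := fun x i => congrArg g (hq0 x i)
  have hfc : Continuous (armDiff f) := continuous_armDiff fun i => by
    have : Continuous fun p : X × I => (p.1, i, p.2) := by fun_prop
    exact hg.comp (hq.comp this)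
  have hf_ne : ∀ x y s t, x ≠ y ∨ 1 / 2 ≤ squareRadius s t →
      armDiff f (((x, y), s), t) ≠ 0 := by
    intro x y s t hxy h0
    obtain ⟨i, j, a, b, hij, h1, -, h⟩ := exists_armDiff_eq (X := X) (V := Fin (m + 2) → ℝ) s t
    rw [h f hf0, sub_eq_zero] at h0
    obtain ⟨rfl, rfl, rfl⟩ := hqinj _ _ _ _ _ _ hij (hginj h0)
    rcases hxy with h' | h'
    · exact h' rfl
    · simpa using h1 h'
  obtain ⟨c, hc, hcK⟩ : ∃ c > 0, ∀ x y s t, 1 / 2 ≤ squareRadius s t →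
      c ≤ ‖armDiff f (((x, y), s), t)‖ := by
    have hK : IsClosed {p : ((X × X) × I) × I | 1 / 2 ≤ squareRadius p.1.2 p.2} :=
      isClosed_le continuous_const (continuous_squareRadius (by fun_prop) (by fun_prop))
    obtain ⟨c, hc, h⟩ := hK.isCompact.exists_forall_le' (f := fun p => ‖armDiff f p‖) (a := 0)
      hfc.norm.continuousOn fun p hp => norm_pos_iff.2 (hf_ne _ _ _ _ (Or.inr hp))
    exact ⟨c, hc, fun x y s t hst => h _ hst⟩
  obtain ⟨g', hg', hgg', hdim⟩ := hZ.exists_approx hg (half_pos hc)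
  let f' : X → Fin 3 → I → Fin (m + 2) → ℝ := fun x i t => g' (q (x, i, t))
  have hf0' : ∀ x i, f' x i 0 = f' x 0 0 := fun x i => congrArg g' (hq0 x i)
  have hfc' : Continuous (armDiff f') := continuous_armDiff fun i => by
    have : Continuous fun p : X × I => (p.1, i, p.2) := by fun_prop
    exact hg'.comp (hq.comp this)
  let V : Fin 3 → Fin (m + 2) → ℝ := fun i => g' (q (x₀, i, 1))
  have hV : ∀ x i, f' x i 1 = V i := fun x i => congrArg g' (hq1 x x₀ i)
  have hff' : ∀ p, ‖armDiff f' p - armDiff f p‖ < c := by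
    rintro ⟨⟨⟨x, y⟩, s⟩, t⟩
    obtain ⟨i, j, a, b, -, -, -, h⟩ := exists_armDiff_eq (X := X) (V := Fin (m + 2) → ℝ) s t
    rw [h f hf0, h f' hf0', sub_sub_sub_comm]
    refine (norm_sub_le _ _).trans_lt ?_
    linarith [hgg' (q (x, i, a)), hgg' (q (y, j, b))]
  obtain ⟨u, hu0, hu⟩ : ∃ u : Fin (m + 2) → ℝ, u ≠ 0 ∧ ∀ (c : ℝ) i z, c • (V i - g' z) ≠ u := by
    have hVdim : C1Dim (Set.range V) 0 :=
      C1Dim.of_countable (E := Fin 0 → ℝ) (by simp) (fun i _ => V i) (fun _ => contDiff_const)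
        (by rintro _ ⟨i, rfl⟩; exact Set.mem_iUnion.2 ⟨i, 0, rfl⟩)
    have h1 : C1Dim (Set.univ : Set ℝ) 1 := by simpa using C1Dim.univ (F := ℝ)
    have hP : ContDiff ℝ 1 fun p : (ℝ × (Fin (m + 2) → ℝ)) × (Fin (m + 2) → ℝ) =>
        p.1.1 • (p.1.2 - p.2) := by fun_prop
    obtain ⟨u, hu0, hu⟩ := ((((h1.prod hVdim).prod hdim).image hP).dense_compl
      (by simp; omega)).exists_mem_open (isOpen_compl_singleton (x := (0 : Fin (m + 2) → ℝ)))
      ⟨1, by simp⟩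
    exact ⟨u, hu, fun c i z h => hu0 ⟨((c, V i), g' z), ⟨⟨trivial, i, rfl⟩, z, rfl⟩, h⟩⟩
  let κ : I → I → ℝ := fun s t => max 0 (2 * squareRadius s t - 1)
  have hκ0 : ∀ s t, 0 ≤ κ s t := fun s t => le_max_left _ _
  have hκ1 : ∀ s t, κ s t ≤ 1 := fun s t =>
    max_le zero_le_one (by linarith [squareRadius_le_one s t])
  have hκone : ∀ s t, squareRadius s t = 1 → κ s t = 1 := fun s t h => by
    simp only [κ, h]; norm_num
  let G : ((X × X) × I) × I → Fin (m + 2) → ℝ := fun p =>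
    armDiff f p + κ p.1.2 p.2 • (armDiff f' p - armDiff f p)
  have hκc : Continuous fun p : ((X × X) × I) × I => κ p.1.2 p.2 :=
    continuous_const.max ((continuous_const.mul
      (continuous_squareRadius (by fun_prop) (by fun_prop))).sub continuous_const)
  have hG_one : ∀ x y s t, squareRadius s t = 1 →
      G (((x, y), s), t) = armDiff f' (((x, y), s), t) := fun x y s t h => by
    simp [G, hκone s t h]
  have hG_ne : ∀ x y s t, x ≠ y ∨ 1 / 2 ≤ squareRadius s t → G (((x, y), s), t) ≠ 0 := by
    intro x y s t hxy h0
    by_cases hst : 1 / 2 ≤ squareRadius s t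
    · have h1 := hcK x y s t hst
      have h2 : ‖armDiff f (((x, y), s), t)‖ ≤
          ‖armDiff f' (((x, y), s), t) - armDiff f (((x, y), s), t)‖ := by
        refine (congrArg norm (eq_neg_of_add_eq_zero_left h0)).trans_le ?_
        rw [norm_neg, norm_smul, Real.norm_of_nonneg (hκ0 s t)]
        exact mul_le_of_le_one_left (norm_nonneg _) (hκ1 s t)
      linarith [hff' (((x, y), s), t)]
    · have hκ : κ s t = 0 := max_eq_left (by linarith)
      refine hf_ne x y s t hxy ?_
      simpa [G, hκ] using h0
  refine ⟨G, u, V 0 - V 2, hfc.add (hκc.smul (hfc'.sub hfc)), hu0, ?_, fun x y s t h =>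
    hG_ne x y s t (Or.inl h), ?_, ?_⟩
  · intro x y s t
    simp only [G, κ, armDiff_symm, squareRadius_symm]
    module
  · intro x y s t c hst h
    have hne := hG_ne x y s t (Or.inr (by rw [hst]; norm_num))
    have hc0 : c ≠ 0 := by
      rintro rfl
      exact hne (by rw [h, zero_smul])
    obtain ⟨i, j, a, b, -, -, h1, h'⟩ := exists_armDiff_eq (X := X) (V := Fin (m + 2) → ℝ) s t
    rw [hG_one x y s t hst, h' f' hf0'] at h
    rcases h1 hst.ge with rfl | rfl
    · rw [hV] at h
      exact hu c⁻¹ i (q (y, j, b)) ((congrArg _ h).trans (inv_smul_smul₀ hc0 u))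
    · rw [hV] at h
      refine hu (-c⁻¹) j (q (x, i, a)) ?_
      rw [neg_smul, ← smul_neg, neg_sub]
      exact (congrArg _ h).trans (inv_smul_smul₀ hc0 u)
  · intro x y t ht
    rw [hG_one x y 1 t (squareRadius_one_left t), armDiff_one f' hf0' x y ht, hV, hV]

lemma exists_oddOffDiag_of_injective {n m : ℕ} (hX : FinDimLE X n) (hZ : FinDimLE Z (n + 1))
    (hm : n + 2 ≤ m) {q : X × Fin 3 × I → Z} (hq : Continuous q)
    (hq0 : ∀ x i, q (x, i, 0) = q (x, 0, 0)) (hq1 : ∀ x y i, q (x, i, 1) = q (y, i, 1))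
    (hqinj : ∀ x y i j a b, i ≠ j → q (x, i, a) = q (y, j, b) → x = y ∧ a = 0 ∧ b = 0)
    {g : Z → Fin (m + 2) → ℝ} (hg : Continuous g) (hginj : Function.Injective g) :
    ∃ φ : Fin m → X → X → ℝ, OddOffDiag φ ∧ ∀ x y, x ≠ y → ∃ i, φ i x y ≠ 0 := by
  rcases isEmpty_or_nonempty X with hX0 | hX0
  · exact ⟨0, ⟨fun _ x => hX0.elim x, fun _ x => hX0.elim x⟩, fun x => hX0.elim x⟩
  obtain ⟨G, u, V, hGc, hu0, hGodd, hGne, hGu, hGV⟩ :=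
    exists_odd_family_of_injective hZ hm hq hq0 hq1 hqinj hg hginj
  obtain ⟨j₀, hj₀⟩ := Function.ne_iff.1 hu0
  obtain ⟨t₁, ht₁⟩ : ∃ t : I, (t : ℝ) = 3 / 4 := ⟨⟨3 / 4, by norm_num, by norm_num⟩, rfl⟩
  have hGP : ∀ x y s t, x ≠ y → projAlong u j₀ (G (((x, y), s), t)) = 0 →
      squareRadius s t ≠ 1 ∧ G (((x, y), s), t) j₀ ≠ 0 := by
    intro x y s t hxy h
    have h' := eq_smul_of_projAlong_eq_zero hj₀ h
    refine ⟨fun hst => hGu x y s t _ hst h', fun h0 => hGne x y s t hxy ?_⟩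
    rw [h', h0, zero_div, zero_smul]
  let γ : ((X × X) × I) × I → ℝ := fun p => G p j₀ * (1 - squareRadius p.1.2 p.2)
  have hγc : Continuous γ := ((continuous_apply j₀).comp hGc).mul
    (continuous_const.sub (continuous_squareRadius (by fun_prop) (by fun_prop)))
  obtain ⟨Φ₁, hΦc, hΦodd, hΦne, hΦA⟩ := OddOn.exists_reduction
    (ι := (Prod.map Prod.swap symm : (X × X) × I → (X × X) × I)) (r := m + 1)
    hX.invFinDimLE_swap.prod_unitInterval (by fun_prop)
    (fun p => Prod.ext (Prod.swap_swap _) (symm_symm _)) (by omega)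
    (δ := fun e => dist e.1.1 e.1.2) (by fun_prop) (fun e => dist_comm _ _)
    (fun e => le_max_of_le_left (le_max_left _ _))
    (φ := fun p => projAlong u j₀ (G p)) (γ := γ)
    ⟨((continuous_projAlong u j₀).comp hGc).continuousOn, fun e _ t => by
      rw [← projAlong_neg, ← hGodd]; rfl⟩
    ⟨hγc.continuousOn, fun e _ t => by
      have := congrFun (hGodd e.1.1 e.1.2 e.2 t) j₀
      change G (((e.1.2, e.1.1), symm e.2), symm t) j₀ * (1 - squareRadius (symm e.2) (symm t)) = _
      rw [this, squareRadius_symm, Pi.neg_apply, neg_mul]⟩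
    (fun e he t h => by
      obtain ⟨h1, h2⟩ := hGP _ _ _ _ (dist_pos.1 he) h
      exact mul_ne_zero h2 (sub_ne_zero.2 h1.symm))
    (fun e _ => by simp [γ, squareRadius_one_right])
    (A := {e | e.2 = 1}) (isClosed_eq continuous_snd continuous_const)
    (fun e he h => by
      have he : e.2 = 1 := he
      have h : symm e.2 = 1 := h
      rw [he, symm_one] at h
      exact uiZeroNeOne h)
    (fun e he t => by
      have he : e.2 = 1 := he
      simp [γ, he, squareRadius_one_left]) t₁
  by_cases hnt : ∃ a b : X, a ≠ b
  swap
  · push Not at hnt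
    exact ⟨0, ⟨fun _ x y h => absurd (hnt x y) h, fun _ _ _ => by simp⟩,
      fun x y h => absurd (hnt x y) h⟩
  obtain ⟨a, b, hab⟩ := hnt
  have hV : projAlong u j₀ V ≠ 0 := fun h =>
    (hGP a b 1 t₁ hab (by rwa [hGV _ _ _ ht₁])).1 (squareRadius_one_left _)
  set e := projAlong u j₀ V with he
  obtain ⟨j, -, hj⟩ := Finset.exists_max_image Finset.univ (fun j => ‖e j‖) Finset.univ_nonempty
  have hej : ‖e‖ = ‖e j‖ := le_antisymm
    ((pi_norm_le_iff_of_nonneg (norm_nonneg _)).2 fun i => hj i (Finset.mem_univ i))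
    (norm_le_pi_norm e j)
  have hej0 : e j ≠ 0 := by rwa [← norm_pos_iff, ← hej, norm_pos_iff]
  have hΦ1 : ∀ x y, x ≠ y → 0 ≤ Φ₁ ((x, y), 1) j / e j := by
    intro x y hxy
    have h := hΦA ((x, y), 1) rfl (dist_pos.2 hxy)
    rw [hGV _ _ _ ht₁, ← he, hej] at h
    have h1 := (norm_le_pi_norm _ j).trans h
    rw [Pi.sub_apply] at h1
    have h2 : ‖Φ₁ ((x, y), 1) j / e j - 1‖ ≤ 1 / 2 := by
      rw [div_sub_one hej0, norm_div, div_le_iff₀ (norm_pos_iff.2 hej0)]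
      linarith
    linarith [(abs_le.1 h2).1]
  have hset : ({e : X × X | 0 < dist e.1 e.2} ×ˢ (Set.univ : Set I)) =
      {e : (X × X) × I | 0 < dist e.1.1 e.1.2} := by
    ext; simp
  have hodd : ∀ x y s i, x ≠ y → Φ₁ ((y, x), symm s) i = -Φ₁ ((x, y), s) i :=
    fun x y s i hxy => congrFun (hΦodd ((x, y), s) (dist_pos.2 hxy)) i
  obtain ⟨Φ, hc, hodd', hne, -⟩ := OddOn.exists_reduction
    (ι := (Prod.swap : X × X → X × X)) (r := m)
    hX.invFinDimLE_swap (by fun_prop) Prod.swap_swap (by omega)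
    (δ := fun e => dist e.1 e.2) (by fun_prop) (fun e => dist_comm _ _)
    (fun e => le_max_left _ _)
    (φ := fun p i => Φ₁ p (j.succAbove i)) (γ := fun p => Φ₁ p j / e j)
    ⟨by rw [hset]; exact continuousOn_pi.2 fun i => continuousOn_pi.1 hΦc _,
      fun p hp t => funext fun i => hodd _ _ _ _ (dist_pos.1 hp)⟩
    ⟨by rw [hset]; exact (continuousOn_pi.1 hΦc _).div_const _, fun p hp t => by
      rw [← neg_div]; exact congrArg (· / e j) (hodd _ _ _ _ (dist_pos.1 hp))⟩
    (fun p hp t h => div_ne_zero (fun h' => hΦne (p, t) hp (funext fun k => by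
      rcases Fin.eq_self_or_eq_succAbove j k with rfl | ⟨i, rfl⟩
      exacts [h', congrFun h i])) hej0)
    (fun p hp => hΦ1 _ _ (dist_pos.1 hp)) isClosed_empty (fun _ h => h.elim)
    (fun _ h => h.elim) 0
  have hopen : IsOpen {e : X × X | 0 < dist e.1 e.2} :=
    isOpen_lt continuous_const (by fun_prop)
  have hat : ∀ i x y, x ≠ y → ContinuousAt (fun p => Φ p i) (x, y) := fun i x y hxy =>
    (continuousOn_pi.1 hc i).continuousAt (hopen.mem_nhds (dist_pos.2 hxy))
  refine ⟨fun i x y => Φ (x, y) i - Φ (y, x) i, ⟨fun i x y hxy => ?_, fun i x y => by ring⟩,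
    fun x y hxy => ?_⟩
  · exact (hat i x y hxy).sub ((hat i y x hxy.symm).comp (f := Prod.swap) (x := (x, y))
      continuous_swap.continuousAt)
  · obtain ⟨i, hi⟩ := Function.ne_iff.1 (hne (x, y) (dist_pos.2 hxy))
    have : Φ (y, x) i = -Φ (x, y) i := congrFun (hodd' (x, y) (dist_pos.2 hxy)) i
    refine ⟨i, ?_⟩
    beta_reduce
    rw [this, sub_neg_eq_add, ← two_mul]
    exact mul_ne_zero two_ne_zero hi

end Reduction

lemma C1Dim.iUnion {ι F : Type*} [Countable ι] [NormedAddCommGroup F] [NormedSpace ℝ F]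
    {A : ι → Set F} {d : ℕ} (hA : ∀ i, C1Dim (A i) d) : C1Dim (⋃ i, A i) d := by
  choose P h1 h2 using hA
  refine C1Dim.of_countable (ι := ι × ℕ) (by simp) (fun s => P s.1 s.2) (fun s => h1 _ _)
    (Set.iUnion_subset fun i x hx => ?_)
  obtain ⟨s, h⟩ := Set.mem_iUnion.1 (h2 i hx)
  exact Set.mem_iUnion.2 ⟨(i, s), h⟩

section JoinDim

variable {X Z : Type} [MetricSpace X] [CompactSpace X] [MetricSpace Z]

open Classical in
/-- The factor of a partition function on `X * {1,2,3}` that depends on the point of `X` and on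
the arm; `c₀` and `c₁` are the values of the remaining factor at the ends of the arms. -/
noncomputable def armFactor (c₀ c₁ : ℝ) (N : ℕ) (i i' : Fin 3) (v : ℝ) : ℝ :=
  if c₁ ≠ 0 then (if i' = i then (N : ℝ)⁻¹ else 0)
  else if c₀ ≠ 0 then v / 3 else if i' = i then v else 0

lemma armFactor_nonneg (c₀ c₁ : ℝ) (N : ℕ) (i i' : Fin 3) {v : ℝ} (hv : 0 ≤ v) :
    0 ≤ armFactor c₀ c₁ N i i' v := by
  unfold armFactor
  split_ifs <;> positivity

lemma contDiff_armFactor (c₀ c₁ : ℝ) (N : ℕ) (i i' : Fin 3) :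
    ContDiff ℝ 1 (armFactor c₀ c₁ N i i') := by
  unfold armFactor
  split_ifs <;> fun_prop

lemma sum_armFactor {Λ : Type*} [Fintype Λ] (c₀ c₁ : ℝ) (i' : Fin 3) {v : Λ → ℝ}
    (hv : ∑ a, v a = 1) : ∑ a, ∑ i, armFactor c₀ c₁ (Fintype.card Λ) i i' (v a) = 1 := by
  have : Nonempty Λ := by
    by_contra h
    rw [not_nonempty_iff] at h
    simp at hv
  unfold armFactor
  split_ifs
  · simp
  · simp only [Finset.sum_const, Finset.card_univ, Fintype.card_fin, nsmul_eq_mul]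
    rw [← hv]
    exact Finset.sum_congr rfl fun a _ => by push_cast; ring
  · simpa using hv

/-- The join with three points raises the dimension by at most one. -/
lemma FinDimLE.join_fin_three {n : ℕ} (hX : FinDimLE X n) {q : C(X × Fin 3 × I, Z)}
    (hq : IsQuotientMap q) (hrel : ∀ p p', q p = q p' ↔ joinRel X (Fin 3) p p') :
    FinDimLE Z (n + 1) := by
  intro ε hε
  obtain ⟨δ, hδ, hqδ⟩ : ∃ δ > 0, ∀ x x' i (t t' : I), dist x x' < δ → dist t t' < δ →
      dist (q (x, i, t)) (q (x', i, t')) < ε / 2 := by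
    have hc : Continuous fun (p : X × I) (i : Fin 3) => q (p.1, i, p.2) := by fun_prop
    obtain ⟨δ, hδ, h⟩ := Metric.uniformContinuous_iff.1
      (CompactSpace.uniformContinuous_of_continuous hc) (ε / 2) (half_pos hε)
    exact ⟨δ, hδ, fun x x' i t t' hx ht => (dist_le_pi_dist _ _ i).trans_lt
      (h (a := (x, t)) (b := (x', t')) (max_lt hx ht))⟩
  obtain ⟨Λ, _, ρ, hρ, hdim⟩ := hX δ hδ
  obtain ⟨N, χ, hχ, η, hηχ, hη⟩ := exists_smooth_finePartition_unitInterval (lt_min hδ one_pos)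
  have hη01 : ∀ j, η j 1 ≠ 0 → η j 0 = 0 := by
    intro j h1
    by_contra h0
    have := (hη.dist_lt j 1 0 h1 h0).trans_le (min_le_right _ _)
    rw [Subtype.dist_eq] at this
    norm_num at this
  let T : Fin N × Λ × Fin 3 → Fin 3 → (Λ → ℝ) × ℝ → ℝ := fun a i' p =>
    χ a.1 p.2 * armFactor (χ a.1 0) (χ a.1 1) (Fintype.card Λ) a.2.2 i' (p.1 a.2.1)
  have hT : ∀ a i', ContDiff ℝ 1 (T a i') := fun a i' =>
    ((hχ a.1).comp contDiff_snd).mul ((contDiff_armFactor _ _ _ _ _).comp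
      ((contDiff_apply ℝ ℝ a.2.1).comp contDiff_fst))
  let R : Fin N × Λ × Fin 3 → C(X × Fin 3 × I, ℝ) := fun a =>
    ⟨fun p => T a p.2.1 (fun b => ρ b p.1, p.2.2), by
      have h1 : Continuous fun p : Fin 3 × ((Λ → ℝ) × ℝ) => T a p.1 p.2 :=
        continuous_prod_of_discrete_left.2 fun i' => (hT a i').continuous
      exact h1.comp (f := fun p : X × Fin 3 × I => (p.2.1, (fun b => ρ b p.1, (p.2.2 : ℝ))))
        (by fun_prop)⟩
  have hχη : ∀ j, χ j 0 = η j 0 ∧ χ j 1 = η j 1 := fun j => by simp [hηχ]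
  have hR : ∀ a, Function.FactorsThrough (R a) q := by
    rintro ⟨j, a, i⟩ ⟨x, i₁, t⟩ ⟨x', i₂, t'⟩ h
    rcases (hrel _ _).1 h with h | ⟨h1, h2, h3⟩ | ⟨h1, h2, h3⟩
    · rw [h]
    · simp only at h1 h2 h3
      subst h1 h2 h3
      simp only [R, T, ContinuousMap.coe_mk, Set.Icc.coe_zero]
      by_cases h0 : χ j 0 = 0
      · simp [h0]
      · have h1 : χ j 1 = 0 := by
          by_contra h1
          exact h0 ((hχη j).1.trans (hη01 j fun h => h1 ((hχη j).2.trans h)))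
        simp [armFactor, h0, h1]
    · simp only at h1 h2 h3
      subst h1 h2 h3
      simp only [R, T, ContinuousMap.coe_mk, Set.Icc.coe_one]
      by_cases h1 : χ j 1 = 0
      · simp [h1]
      · simp [armFactor, h1]
  have hL : ∀ a x i t, hq.lift (R a) (hR a) (q (x, i, t)) = η a.1 t *
      armFactor (χ a.1 0) (χ a.1 1) (Fintype.card Λ) a.2.2 i (ρ a.2.1 x) := fun a x i t => by
    rw [hηχ]
    exact DFunLike.congr_fun (hq.lift_comp (R a) (hR a)) (x, i, t)
  refine ⟨Fin N × Λ × Fin 3, inferInstance, fun a => hq.lift (R a) (hR a), ?_, ?_⟩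
  · refine ⟨fun a z => ?_, fun z => ?_, fun a z w hz hw => ?_⟩
    · obtain ⟨⟨x, i, t⟩, rfl⟩ := hq.surjective z
      rw [hL]
      exact mul_nonneg (hη.nonneg _ _) (armFactor_nonneg _ _ _ _ _ (hρ.nonneg _ _))
    · obtain ⟨⟨x, i, t⟩, rfl⟩ := hq.surjective z
      simp only [hL, Fintype.sum_prod_type, ← Finset.mul_sum]
      simp only [sum_armFactor _ _ i (hρ.sum_eq_one x), mul_one, hη.sum_eq_one]
    · obtain ⟨⟨x, i, t⟩, rfl⟩ := hq.surjective z
      obtain ⟨⟨x', i', t'⟩, rfl⟩ := hq.surjective w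
      rw [hL, mul_ne_zero_iff] at hz hw
      obtain ⟨ht, hx⟩ := hz
      obtain ⟨ht', hx'⟩ := hw
      have hend : ∀ (r : I), η a.1 r ≠ 0 → ∀ t, η a.1 t ≠ 0 → dist t r < δ := fun r hr t ht =>
        (hη.dist_lt _ _ _ ht hr).trans_le (min_le_left _ _)
      rw [(hχη _).1, (hχη _).2] at hx hx'
      rw [← add_halves ε]
      by_cases h1 : η a.1 1 = 0
      · by_cases h0 : η a.1 0 = 0
        · simp only [armFactor, h1, h0, ne_eq, not_true_eq_false, if_false, ite_eq_right_iff,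
            Classical.not_imp] at hx hx'
          rw [hx.1, hx'.1]
          exact (hqδ _ _ _ _ _ (hρ.dist_lt _ _ _ hx.2 hx'.2)
            ((hη.dist_lt _ _ _ ht ht').trans_le (min_le_left _ _))).trans (by linarith)
        · have hv : ∀ i i' v, armFactor (η a.1 0) (η a.1 1) (Fintype.card Λ) i i' v ≠ 0 →
              v ≠ 0 := by
            rintro i i' _ h rfl
            simp [armFactor, h1] at h
          have h := hqδ x x' i t 0 (hρ.dist_lt a.2.1 x x' (hv _ _ _ hx) (hv _ _ _ hx'))
            (hend 0 h0 t ht)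
          have h' := hqδ x' x' i' t' 0 (by simpa using hδ) (hend 0 h0 t' ht')
          rw [(hrel (x', i', 0) (x', i, 0)).2 (Or.inr (Or.inl ⟨rfl, rfl, rfl⟩)), dist_comm] at h'
          exact (dist_triangle _ _ _).trans_lt (add_lt_add h h')
      · have hi : i = a.2.2 := by
          by_contra h
          simp [armFactor, h1, h] at hx
        have hi' : i' = a.2.2 := by
          by_contra h
          simp [armFactor, h1, h] at hx'
        have h := hqδ x x i t 1 (by simpa using hδ) (hend 1 h1 t ht)
        have h' := hqδ x' x' i' t' 1 (by simpa using hδ) (hend 1 h1 t' ht')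
        rw [(hrel (x', i', 1) (x, i, 1)).2 (Or.inr (Or.inr ⟨rfl, rfl, hi'.trans hi.symm⟩)),
          dist_comm] at h'
        exact (dist_triangle _ _ _).trans_lt (add_lt_add h h')
  · have h1 : C1Dim (Set.univ : Set ℝ) 1 := by simpa using C1Dim.univ (F := ℝ)
    refine (C1Dim.iUnion fun i' : Fin 3 => (hdim.prod h1).image
      (f := fun p a => T a i' p) (contDiff_pi.2 fun a => hT a i')).mono ?_
    rintro _ ⟨z, rfl⟩
    obtain ⟨⟨x, i', t⟩, rfl⟩ := hq.surjective z
    refine Set.mem_iUnion.2 ⟨i', (fun b => ρ b x, t), ⟨⟨x, rfl⟩, trivial⟩, ?_⟩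
    ext a
    exact (DFunLike.congr_fun (hq.lift_comp (R a) (hR a)) (x, i', t)).symm

end JoinDim

section JoinMap

universe u v

variable {X : Type u} {Y : Type v} {V W : Type*} [NormedAddCommGroup V] [NormedSpace ℝ V]
  [NormedAddCommGroup W] [NormedSpace ℝ W]

/-- The point of the join with the given coordinates. -/
def Join.mk (p : X × Y × I) : Join X Y := Quotient.mk (joinSetoid X Y) p

lemma Join.mk_eq_mk {p p' : X × Y × I} :
    (Join.mk p : Join X Y) = Join.mk p' ↔ joinRel X Y p p' := Quotient.eq (r := joinSetoid X Y)

lemma Join.mk_surjective : Function.Surjective (Join.mk : X × Y × I → Join X Y) :=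
  Quotient.mk_surjective

/-- The map from the join to the product of vector spaces induced by maps of the factors. -/
noncomputable def joinMap (f : X → V) (g : Y → W) : Join X Y → V × W × ℝ :=
  Quotient.lift (fun p => ((1 - (p.2.2 : ℝ)) • f p.1, (p.2.2 : ℝ) • g p.2.1, (p.2.2 : ℝ))) (by
    rintro ⟨x, y, t⟩ ⟨x', y', t'⟩ h
    rcases (show joinRel X Y _ _ from h) with h | ⟨h1, h2, h3⟩ | ⟨h1, h2, h3⟩
    · rw [h]
    · simp only at h1 h2 h3
      subst h1 h2 h3
      simp
    · simp only at h1 h2 h3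
      subst h1 h2 h3
      simp)

lemma joinMap_mk (f : X → V) (g : Y → W) (x : X) (y : Y) (t : I) :
    joinMap f g (Join.mk (x, y, t)) = ((1 - (t : ℝ)) • f x, (t : ℝ) • g y, (t : ℝ)) := rfl

lemma joinMap_injective {f : X → V} {g : Y → W} (hf : Function.Injective f)
    (hg : Function.Injective g) : Function.Injective (joinMap f g) := by
  intro a b h
  obtain ⟨⟨x, y, t⟩, rfl⟩ := Join.mk_surjective a
  obtain ⟨⟨x', y', t'⟩, rfl⟩ := Join.mk_surjective b
  simp only [joinMap_mk, Prod.mk.injEq] at h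
  obtain ⟨h1, h2, h3⟩ := h
  obtain rfl : t = t' := Subtype.ext h3
  rw [Join.mk_eq_mk]
  have hx : t ≠ 1 → x = x' := fun h => hf (smul_right_injective _
    (sub_ne_zero.2 fun h' => h (Subtype.ext h'.symm)) h1)
  have hy : t ≠ 0 → y = y' := fun h => hg (smul_right_injective _
    (fun h' => h (Subtype.ext h')) h2)
  by_cases h0 : t = 0
  · exact Or.inr (Or.inl ⟨h0, h0, hx (by rw [h0]; exact uiZeroNeOne)⟩)
  by_cases ht1 : t = 1
  · exact Or.inr (Or.inr ⟨ht1, ht1, hy h0⟩)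
  · rw [hx ht1, hy h0]
    exact Or.inl rfl

variable [TopologicalSpace X] [TopologicalSpace Y]

lemma Join.isQuotientMap_mk : IsQuotientMap (Join.mk : X × Y × I → Join X Y) :=
  isQuotientMap_quotient_mk'

lemma Join.continuous_mk : Continuous (Join.mk : X × Y × I → Join X Y) :=
  Join.isQuotientMap_mk.continuous

instance [CompactSpace X] [CompactSpace Y] : CompactSpace (Join X Y) :=
  inferInstanceAs (CompactSpace (Quotient (joinSetoid X Y)))

lemma continuous_joinMap {f : X → V} {g : Y → W} (hf : Continuous f) (hg : Continuous g) :
    Continuous (joinMap f g) := by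
  refine Join.isQuotientMap_mk.continuous_iff.2 ?_
  change Continuous fun p : X × Y × I =>
    ((1 - (p.2.2 : ℝ)) • f p.1, (p.2.2 : ℝ) • g p.2.1, (p.2.2 : ℝ))
  fun_prop

/-- Joins of subsets of `ℝ^a` and `ℝ^b` lie in `ℝ^(a+b+1)`. -/
lemma Join.exists_injective {a b c : ℕ} (hc : a + b + 1 = c)
    (hX : ∃ f : X → Fin a → ℝ, Continuous f ∧ Function.Injective f)
    (hY : ∃ f : Y → Fin b → ℝ, Continuous f ∧ Function.Injective f) :
    ∃ f : Join X Y → Fin c → ℝ, Continuous f ∧ Function.Injective f := by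
  obtain ⟨f, hf, hfi⟩ := hX
  obtain ⟨g, hg, hgi⟩ := hY
  have e : ((Fin a → ℝ) × (Fin b → ℝ) × ℝ) ≃L[ℝ] (Fin c → ℝ) :=
    ContinuousLinearEquiv.ofFinrankEq (by simp; omega)
  exact ⟨e ∘ joinMap f g, e.continuous.comp (continuous_joinMap hf hg),
    e.injective.comp (joinMap_injective hfi hgi)⟩

end JoinMap

lemma exists_injective_fin_three :
    ∃ f : Fin 3 → Fin 1 → ℝ, Continuous f ∧ Function.Injective f :=
  ⟨fun i _ => (i : ℕ), continuous_of_discreteTopology, fun i j h => by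
    simpa [Fin.ext_iff] using congrFun h 0⟩

instance compactSpace_TJoin : ∀ j : ℕ, CompactSpace (TJoin j)
  | 0 => inferInstanceAs (CompactSpace (Fin 3))
  | j + 1 =>
    let _ := compactSpace_TJoin j
    inferInstanceAs (CompactSpace (Join (Fin 3) (TJoin j)))

lemma TJoin.exists_injective : ∀ j : ℕ,
    ∃ f : TJoin j → Fin (2 * j + 1) → ℝ, Continuous f ∧ Function.Injective f
  | 0 => exists_injective_fin_three
  | j + 1 => Join.exists_injective (X := Fin 3) (by ring) exists_injective_fin_three
      (TJoin.exists_injective j)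

/-- One half of the associativity of the join. -/
lemma Join.exists_assoc {X F T : Type} [TopologicalSpace X] [TopologicalSpace F]
    [TopologicalSpace T] [CompactSpace X] [CompactSpace F] [CompactSpace T] {U V W : Type}
    [NormedAddCommGroup U] [NormedSpace ℝ U] [NormedAddCommGroup V] [NormedSpace ℝ V]
    [NormedAddCommGroup W] [NormedSpace ℝ W] {f : X → U} {h : F → V} {k : T → W}
    (hf : Continuous f) (hfi : Function.Injective f) (hh : Continuous h)
    (hhi : Function.Injective h) (hk : Continuous k) (hki : Function.Injective k) :
    ∃ Ψ : Join (Join X F) T → Join X (Join F T), Continuous Ψ ∧ Function.Injective Ψ := by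
  let Θ := joinMap (joinMap f h) k
  let E := joinMap f (joinMap h k)
  have hΘ : Continuous Θ := continuous_joinMap (continuous_joinMap hf hh) hk
  have hΘi : Function.Injective Θ := joinMap_injective (joinMap_injective hfi hhi) hki
  have hE : IsEmbedding E := ((continuous_joinMap hf (continuous_joinMap hh hk)).isClosedEmbedding
    (joinMap_injective hfi (joinMap_injective hhi hki))).isEmbedding
  let B : (U × V × ℝ) × W × ℝ → U × (V × W × ℝ) × ℝ := fun p =>
    (p.1.1, (p.1.2.1, p.2.1, p.2.2), p.1.2.2 + p.2.2)
  have hB : Continuous B := by fun_prop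
  have hBi : Function.Injective B := by
    rintro ⟨⟨a, b, c⟩, d, e⟩ ⟨⟨a', b', c'⟩, d', e'⟩ h
    simp only [B, Prod.mk.injEq] at h
    obtain ⟨rfl, ⟨rfl, rfl, rfl⟩, h⟩ := h
    rw [add_right_cancel h]
  have hex : ∀ z, ∃ w, E w = B (Θ z) := by
    intro z
    obtain ⟨⟨z', y, s⟩, rfl⟩ := Join.mk_surjective z
    obtain ⟨⟨x, i, t⟩, rfl⟩ := Join.mk_surjective z'
    have hs := s.2
    have ht := t.2
    obtain ⟨u, hu⟩ : ∃ u : I, (u : ℝ) = (1 - s) * t + s :=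
      ⟨⟨(1 - s) * t + s, by nlinarith [hs.1, hs.2, ht.1, ht.2],
        by nlinarith [hs.1, hs.2, ht.1, ht.2]⟩, rfl⟩
    have hsu : (s : ℝ) ≤ u := by rw [hu]; nlinarith [hs.1, hs.2, ht.1, ht.2]
    obtain ⟨r, hr⟩ : ∃ r : I, (r : ℝ) = s / u :=
      ⟨⟨s / u, div_nonneg hs.1 u.2.1, div_le_one_of_le₀ hsu u.2.1⟩, rfl⟩
    have hur : (u : ℝ) * r = s := by
      rw [hr]
      rcases eq_or_ne (u : ℝ) 0 with h0 | h0
      · rw [h0, zero_mul]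
        linarith [hs.1]
      · field_simp
    refine ⟨Join.mk (x, Join.mk (i, y, r), u), ?_⟩
    have e1 : (1 - (u : ℝ)) = (1 - s) * (1 - t) := by rw [hu]; ring
    have e2 : (u : ℝ) * (1 - r) = (1 - s) * t := by rw [mul_sub, hur, hu]; ring
    simp only [E, B, Θ, joinMap_mk, Prod.smul_mk, smul_smul, e1, e2, hur, smul_eq_mul, ← hu]
  choose Ψ hΨ using hex
  refine ⟨Ψ, hE.continuous_iff.2 ?_, fun a b hab => hΘi (hBi ?_)⟩
  · rw [show E ∘ Ψ = B ∘ Θ from funext hΨ]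
    exact hB.comp hΘ
  · rw [← hΨ, ← hΨ, hab]

/-- A space whose join with three points embeds two dimensions higher embeds in the metastable
range. -/
lemma exists_injective_of_join_fin_three {n m : ℕ} {X : Type} [MetricSpace X] [CompactSpace X]
    (hX : FinDimLE X n) (hm : 3 * (n + 1) < 2 * m) {g : Join X (Fin 3) → Fin (m + 2) → ℝ}
    (hg : Continuous g) (hgi : Function.Injective g) :
    ∃ f : X → Fin m → ℝ, Continuous f ∧ Function.Injective f := by
  have : TopologicalSpace.MetrizableSpace (Join X (Fin 3)) :=
    (hg.isClosedEmbedding hgi).isEmbedding.metrizableSpace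
  let _ := TopologicalSpace.metrizableSpaceMetric (Join X (Fin 3))
  have hZ : FinDimLE (Join X (Fin 3)) (n + 1) :=
    hX.join_fin_three (q := ⟨Join.mk, Join.continuous_mk⟩) Join.isQuotientMap_mk
      fun p p' => Join.mk_eq_mk
  obtain ⟨φ, hφ, hne⟩ := exists_oddOffDiag_of_injective hX hZ (by omega) (m := m)
    (Join.continuous_mk) (fun x i => Join.mk_eq_mk.2 (Or.inr (Or.inl ⟨rfl, rfl, rfl⟩)))
    (fun x y i => Join.mk_eq_mk.2 (Or.inr (Or.inr ⟨rfl, rfl, rfl⟩)))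
    (fun x y i j a b hij h => by
      rcases Join.mk_eq_mk.1 h with h | ⟨h1, h2, h3⟩ | ⟨h1, h2, h3⟩
      · simp only [Prod.mk.injEq] at h
        exact absurd h.2.1 hij
      · exact ⟨h3, h1, h2⟩
      · exact absurd h3 hij) hg hgi
  exact exists_injective_of_oddOffDiag hX (by omega) (by omega) hφ hne

lemma exists_injective_of_join_TJoin (j : ℕ) : ∀ {n m : ℕ} {X : Type} [MetricSpace X]
    [CompactSpace X], FinDimLE X n → 3 * (n + 1) < 2 * m →
    (∃ g : Join X (TJoin j) → Fin (m + 2 * (j + 1)) → ℝ, Continuous g ∧ Function.Injective g) →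
    ∃ f : X → Fin m → ℝ, Continuous f ∧ Function.Injective f := by
  induction j with
  | zero =>
    rintro n m X _ _ hX hm ⟨g, hg, hgi⟩
    exact exists_injective_of_join_fin_three hX hm (g := g) hg hgi
  | succ j ih =>
    rintro n m X _ _ hX hm ⟨g, hg, hgi⟩
    obtain ⟨h, hh, hhi⟩ := exists_injective_fin_three
    obtain ⟨k, hk, hki⟩ := TJoin.exists_injective j
    have hf := kuratowskiEmbedding.isometry X
    have : TopologicalSpace.MetrizableSpace (Join X (Fin 3)) :=
      ((continuous_joinMap hf.continuous hh).isClosedEmbedding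
        (joinMap_injective hf.injective hhi)).isEmbedding.metrizableSpace
    let _ := TopologicalSpace.metrizableSpaceMetric (Join X (Fin 3))
    have hZ : FinDimLE (Join X (Fin 3)) (n + 1) :=
      hX.join_fin_three (q := ⟨Join.mk, Join.continuous_mk⟩) Join.isQuotientMap_mk
        fun p p' => Join.mk_eq_mk
    obtain ⟨Ψ, hΨ, hΨi⟩ := Join.exists_assoc hf.continuous hf.injective hh hhi hk hki
    have hm' : m + 2 * (j + 1 + 1) = m + 2 + 2 * (j + 1) := by ring
    have e : (Fin (m + 2 * (j + 1 + 1)) → ℝ) ≃L[ℝ] (Fin (m + 2 + 2 * (j + 1)) → ℝ) :=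
      ContinuousLinearEquiv.ofFinrankEq (by simp [hm'])
    obtain ⟨g', hg', hgi'⟩ := ih (m := m + 2) hZ (by omega)
      ⟨e ∘ g ∘ Ψ, e.continuous.comp (hg.comp hΨ), e.injective.comp (hgi.comp hΨi)⟩
    exact exists_injective_of_join_fin_three hX hm hg' hgi'

lemma exists_isEmbedding_euclidean_iff {Y : Type*} [TopologicalSpace Y] [CompactSpace Y] {r : ℕ} :
    (∃ f : Y → EuclideanSpace ℝ (Fin r), IsEmbedding f) ↔
      ∃ f : Y → Fin r → ℝ, Continuous f ∧ Function.Injective f := by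
  have e : EuclideanSpace ℝ (Fin r) ≃L[ℝ] (Fin r → ℝ) := EuclideanSpace.equiv _ _
  refine ⟨fun ⟨f, hf⟩ => ⟨e ∘ f, e.continuous.comp hf.continuous, e.injective.comp hf.injective⟩,
    fun ⟨f, hf, hfi⟩ => ⟨e.symm ∘ f, ?_⟩⟩
  exact ((e.symm.continuous.comp hf).isClosedEmbedding (e.symm.injective.comp hfi)).isEmbedding

/-- Corollary 4.4, (i) ⟺ (iv): for `k > 0` and `2m > 3(n+1)`, an `n`-dimensional
compactum `X` embeds in `ℝ^m` iff `X * T_k` embeds in `ℝ^{m+2k}`, where `T_k` is the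
join of `k` copies of the three-point discrete space. -/
theorem stmt15 (n m k : ℕ) (hk : 0 < k) (hm : 2 * m > 3 * (n + 1))
    (X : Type) [MetricSpace X] [CompactSpace X] (hdim : CoveringDimLE X n) :
    (∃ f : X → EuclideanSpace ℝ (Fin m), IsEmbedding f) ↔
    (∃ f : Join X (TJoin (k - 1)) → EuclideanSpace ℝ (Fin (m + 2 * k)),
      IsEmbedding f) := by
  obtain ⟨j, rfl⟩ := Nat.exists_eq_succ_of_ne_zero hk.ne'
  rw [Nat.succ_sub_one, exists_isEmbedding_euclidean_iff, exists_isEmbedding_euclidean_iff]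
  exact ⟨fun hX => Join.exists_injective (by lia) hX (TJoin.exists_injective j),
    exists_injective_of_join_TJoin j hdim.finDimLE hm⟩
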